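/- arXiv:2405.15147 — 3 statements merged into one kernel-verified Lean document; each statement's English description precedes it below -/
import Mathlib

section
/- Let n ≥ 3 and let x, y, z be three distinct vertices of the godan graph EA_n. Then the subgraph of EA_n induced on {x, y, z} is a 3-cycle (i.e., x, y, z are pairwise adjacent) if and only if {y, z} = {x∘(123), x∘(132)}. -/
namespace Godan

/-- The transposition (12), using 0-based indices 0,1 for symbols 1,2. -/
def perm12 (n : ℕ) (hn : 3 ≤ n) : Equiv.Perm (Fin n) :=
  Equiv.swap ⟨0, by omega⟩ ⟨1, by omega⟩

/-- The 3-cycle (123): symbol 1 ↦ 2 ↦ 3 ↦ 1, i.e. index 0 ↦ 1 ↦ 2 ↦ 0. -/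
def perm123 (n : ℕ) (hn : 3 ≤ n) : Equiv.Perm (Fin n) :=
  Equiv.swap ⟨0, by omega⟩ ⟨2, by omega⟩ * Equiv.swap ⟨0, by omega⟩ ⟨1, by omega⟩

/-- The 3-cycle (132): symbol 1 ↦ 3 ↦ 2 ↦ 1, i.e. index 0 ↦ 2 ↦ 1 ↦ 0. -/
def perm132 (n : ℕ) (hn : 3 ≤ n) : Equiv.Perm (Fin n) :=
  Equiv.swap ⟨0, by omega⟩ ⟨1, by omega⟩ * Equiv.swap ⟨0, by omega⟩ ⟨2, by omega⟩

/-- Ω* = {(12), (123), (132)} ∪ {(12)(3i) : 4 ≤ i ≤ n}; symbol i has index i - 1,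
so the transposition (3i) is `Equiv.swap ⟨2,_⟩ k` with 3 ≤ k = i - 1 ≤ n - 1. -/
def OmegaStar (n : ℕ) (hn : 3 ≤ n) : Set (Equiv.Perm (Fin n)) :=
  {perm12 n hn, perm123 n hn, perm132 n hn} ∪
    {s | ∃ k : Fin n, 3 ≤ (k : ℕ) ∧ s = perm12 n hn * Equiv.swap ⟨2, by omega⟩ k}

/-- The godan graph EA_n: vertices are the permutations of {1,…,n}, and u,v are
adjacent iff u = v ∘ s for some s ∈ Ω* (note `(v * s) i = v (s i)` in Mathlib).
Since Ω* is closed under inverses, `fromRel` yields exactly this adjacency. -/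
def godanGraph (n : ℕ) (hn : 3 ≤ n) : SimpleGraph (Equiv.Perm (Fin n)) :=
  SimpleGraph.fromRel (fun u v => ∃ s ∈ OmegaStar n hn, u = v * s)

section

open Equiv

variable {n : ℕ} {hn : 3 ≤ n}

lemma perm132_eq_inv : perm132 n hn = (perm123 n hn)⁻¹ := by
  simp [perm132, perm123]

lemma perm123_mul_self : perm123 n hn * perm123 n hn = perm132 n hn := by
  ext i
  simp only [perm123, perm132, Perm.mul_apply, swap_apply_def]
  grind

lemma perm132_mul_self : perm132 n hn * perm132 n hn = perm123 n hn := by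
  rw [perm132_eq_inv, ← mul_inv_rev, perm123_mul_self, perm132_eq_inv, inv_inv]

lemma perm123_apply_zero : perm123 n hn ⟨0, by omega⟩ = ⟨1, by omega⟩ := by
  simp [perm123, swap_apply_def]

lemma perm123_apply_one : perm123 n hn ⟨1, by omega⟩ = ⟨2, by omega⟩ := by
  simp [perm123]

lemma perm132_apply_zero : perm132 n hn ⟨0, by omega⟩ = ⟨2, by omega⟩ := by
  simp [perm132, swap_apply_def]

lemma perm132_apply_one : perm132 n hn ⟨1, by omega⟩ = ⟨0, by omega⟩ := by
  simp [perm132, swap_apply_def]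

lemma perm123_mem_OmegaStar : perm123 n hn ∈ OmegaStar n hn := by simp [OmegaStar]

lemma perm132_mem_OmegaStar : perm132 n hn ∈ OmegaStar n hn := by simp [OmegaStar]

/-- An element of `OmegaStar` exchanges the symbols 1 and 2 or is one of the two 3-cycles. -/
lemma eq_or_swaps_of_mem_OmegaStar {s : Perm (Fin n)} (hs : s ∈ OmegaStar n hn) :
    s = perm123 n hn ∨ s = perm132 n hn ∨
      (s ⟨0, by omega⟩ = ⟨1, by omega⟩ ∧ s ⟨1, by omega⟩ = ⟨0, by omega⟩) := by
  rcases hs with (rfl | rfl | rfl) | ⟨k, hk, rfl⟩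
  · simp [perm12]
  · simp
  · simp
  · right; right
    simp only [perm12, Perm.mul_apply, swap_apply_def]
    grind

lemma inv_mem_OmegaStar {s : Perm (Fin n)} (hs : s ∈ OmegaStar n hn) :
    s⁻¹ ∈ OmegaStar n hn := by
  rcases hs with (rfl | rfl | rfl) | ⟨k, hk, rfl⟩
  · simp [perm12, OmegaStar]
  · rw [← perm132_eq_inv]; exact perm132_mem_OmegaStar
  · rw [perm132_eq_inv, inv_inv]; exact perm123_mem_OmegaStar
  · refine Or.inr ⟨k, hk, ?_⟩
    rw [mul_inv_rev, swap_inv, perm12, swap_inv]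
    ext i
    simp only [Perm.mul_apply, swap_apply_def]
    grind

lemma godanGraph_adj_iff {u v : Perm (Fin n)} :
    (godanGraph n hn).Adj u v ↔ u ≠ v ∧ ∃ s ∈ OmegaStar n hn, v = u * s := by
  rw [godanGraph, SimpleGraph.fromRel_adj]
  refine and_congr_right fun _ => ⟨?_, Or.inr⟩
  rintro (⟨s, hs, rfl⟩ | h)
  · exact ⟨s⁻¹, inv_mem_OmegaStar hs, by simp⟩
  · exact h

/-- A product of two elements of `OmegaStar` lies in `OmegaStar` only if both factors are the
same 3-cycle. -/
lemma eq_of_mul_mem_OmegaStar {s r : Perm (Fin n)} (hs : s ∈ OmegaStar n hn)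
    (hr : r ∈ OmegaStar n hn) (hsr : s * r ∈ OmegaStar n hn) :
    s = r ∧ (s = perm123 n hn ∨ s = perm132 n hn) := by
  have key {t : Perm (Fin n)} (ht : t ∈ OmegaStar n hn) :
      (t ⟨0, by omega⟩ = ⟨1, by omega⟩ ∨ t ⟨0, by omega⟩ = ⟨2, by omega⟩) ∧
        t ⟨1, by omega⟩ ≠ ⟨1, by omega⟩ := by
    rcases eq_or_swaps_of_mem_OmegaStar ht with rfl | rfl | ⟨h0, h1⟩
    · simp [perm123_apply_zero, perm123_apply_one]
    · simp [perm132_apply_zero, perm132_apply_one]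
    · simp [h0, h1]
  obtain ⟨h0, h1⟩ := key hsr
  rw [Perm.mul_apply] at h0 h1
  rcases eq_or_swaps_of_mem_OmegaStar hs with rfl | rfl | ⟨hs0, hs1⟩ <;>
  rcases eq_or_swaps_of_mem_OmegaStar hr with rfl | rfl | ⟨hr0, hr1⟩ <;>
  simp_all [perm123_apply_zero, perm123_apply_one, perm132_apply_zero, perm132_apply_one]

end

/-- Let n ≥ 3 and let x, y, z be three distinct vertices of EA_n. The subgraph
induced on {x, y, z} is a 3-cycle (x, y, z pairwise adjacent) iff
{y, z} = {x∘(123), x∘(132)}. -/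
theorem triangle_iff (n : ℕ) (hn : 3 ≤ n) (x y z : Equiv.Perm (Fin n))
    (hxy : x ≠ y) (hxz : x ≠ z) (hyz : y ≠ z) :
    ((godanGraph n hn).Adj x y ∧ (godanGraph n hn).Adj x z ∧
        (godanGraph n hn).Adj y z) ↔
      ({y, z} : Set (Equiv.Perm (Fin n))) = {x * perm123 n hn, x * perm132 n hn} := by
  rw [Set.pair_eq_pair_iff]
  simp only [godanGraph_adj_iff]
  constructor
  · rintro ⟨⟨-, s, hs, rfl⟩, ⟨-, t, ht, rfl⟩, -, r, hr, h⟩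
    rw [mul_assoc, mul_right_inj] at h
    subst h
    obtain ⟨rfl, rfl | rfl⟩ := eq_of_mul_mem_OmegaStar hs hr ht
    · simp [perm123_mul_self]
    · simp [perm132_mul_self]
  · rintro (⟨rfl, rfl⟩ | ⟨rfl, rfl⟩)
    · exact ⟨⟨hxy, _, perm123_mem_OmegaStar, rfl⟩, ⟨hxz, _, perm132_mem_OmegaStar, rfl⟩,
        hyz, _, perm123_mem_OmegaStar, by rw [mul_assoc, perm123_mul_self]⟩
    · exact ⟨⟨hxy, _, perm132_mem_OmegaStar, rfl⟩, ⟨hxz, _, perm123_mem_OmegaStar, rfl⟩,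
        hyz, _, perm132_mem_OmegaStar, by rw [mul_assoc, perm132_mul_self]⟩

end Godan
end

section
/- Let n ≥ 4, let k₁,…,k_h be h ≥ 2 distinct elements of {1,…,n}, and let H be the subgraph of the godan graph EA_n induced on the union of the vertex sets of the clusters EA_n^{n:k₁},…,EA_n^{n:k_h}. Then the connectivity of H is at least n − 2; that is, for every set W of at most n − 3 vertices of H, the graph H − W (the subgraph induced on V(H) \ W) is connected. -/
namespace Godan

/-- The position of the n-th (last) symbol, as an index of `Fin n`. -/
def lastPos (n : ℕ) (hn : 3 ≤ n) : Fin n := ⟨n - 1, by omega⟩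

/-- The permutation (12)(3n), giving the out neighbour x' = x ∘ (12)(3n). -/
def outPerm (n : ℕ) (hn : 4 ≤ n) : Equiv.Perm (Fin n) :=
  perm12 n (by omega) * Equiv.swap ⟨2, by omega⟩ ⟨n - 1, by omega⟩

section Helpers

variable {n : ℕ}

/-- Reachability by a path of the godan graph all of whose vertices lie in `S`. -/
def ReachIn (hn : 3 ≤ n) (S : Set (Equiv.Perm (Fin n))) :
    Equiv.Perm (Fin n) → Equiv.Perm (Fin n) → Prop :=
  Relation.ReflTransGen fun u v => u ∈ S ∧ v ∈ S ∧ (godanGraph n hn).Adj u v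

/-- The permutations that agree with `τ` at all positions of index at least `m`. -/
def tailClass (m : ℕ) (τ : Equiv.Perm (Fin n)) : Set (Equiv.Perm (Fin n)) :=
  {σ | ∀ i : Fin n, m ≤ (i : ℕ) → σ i = τ i}

/-- Every tail class at level `m` stays connected after deleting at most `m - 2` vertices. -/
def RobustAt (hn : 3 ≤ n) (m : ℕ) : Prop :=
  ∀ (τ : Equiv.Perm (Fin n)) (W : Set (Equiv.Perm (Fin n))),
    (W ∩ tailClass m τ).ncard + 2 ≤ m →
    ∀ u ∈ tailClass m τ \ W, ∀ v ∈ tailClass m τ \ W, ReachIn hn (tailClass m τ \ W) u v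

theorem ReachIn.mono {hn : 3 ≤ n} {S T : Set (Equiv.Perm (Fin n))} (h : S ⊆ T)
    {u v : Equiv.Perm (Fin n)} (huv : ReachIn hn S u v) : ReachIn hn T u v :=
  Relation.ReflTransGen.mono (fun _ _ hab => ⟨h hab.1, h hab.2.1, hab.2.2⟩) _ _ huv

theorem ReachIn.trans {hn : 3 ≤ n} {S : Set (Equiv.Perm (Fin n))}
    {u v w : Equiv.Perm (Fin n)} (huv : ReachIn hn S u v) (hvw : ReachIn hn S v w) :
    ReachIn hn S u w :=
  Relation.ReflTransGen.trans huv hvw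

theorem ReachIn.symm {hn : 3 ≤ n} {S : Set (Equiv.Perm (Fin n))}
    {u v : Equiv.Perm (Fin n)} (huv : ReachIn hn S u v) : ReachIn hn S v u := by
  unfold ReachIn at *
  induction huv with
  | refl => exact .refl
  | tail _ h ih => exact .head ⟨h.2.1, h.1, h.2.2.symm⟩ ih

theorem ReachIn.of_adj {hn : 3 ≤ n} {S : Set (Equiv.Perm (Fin n))}
    {u v : Equiv.Perm (Fin n)} (hu : u ∈ S) (hv : v ∈ S) (h : (godanGraph n hn).Adj u v) :
    ReachIn hn S u v :=
  .single ⟨hu, hv, h⟩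

theorem ReachIn.reachable {hn : 3 ≤ n} {S : Set (Equiv.Perm (Fin n))}
    {u v : Equiv.Perm (Fin n)} (huv : ReachIn hn S u v) (hu : u ∈ S) :
    ∃ hv : v ∈ S, ((godanGraph n hn).induce S).Reachable ⟨u, hu⟩ ⟨v, hv⟩ := by
  unfold ReachIn at huv
  induction huv with
  | refl => exact ⟨hu, .refl _⟩
  | tail _ h ih =>
    obtain ⟨hb, ih⟩ := ih
    exact ⟨h.2.1, ih.trans (SimpleGraph.Adj.reachable h.2.2)⟩

theorem tailClass_eq {m : ℕ} {u τ : Equiv.Perm (Fin n)} (h : u ∈ tailClass m τ) :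
    tailClass m u = tailClass m τ := by
  ext σ
  constructor
  · intro hσ i hi
    rw [hσ i hi, h i hi]
  · intro hσ i hi
    rw [hσ i hi, h i hi]

theorem mem_tailClass_self (m : ℕ) (u : Equiv.Perm (Fin n)) : u ∈ tailClass m u :=
  fun _ _ => rfl

theorem tailClass_subset_succ (m : ℕ) (u : Equiv.Perm (Fin n)) :
    tailClass m u ⊆ tailClass (m + 1) u :=
  fun _ h i hi => h i (by omega)

theorem mem_tailClass_of_succ {m : ℕ} (hm : m < n) {u v : Equiv.Perm (Fin n)}
    (h : u ∈ tailClass (m + 1) v) (hk : u ⟨m, hm⟩ = v ⟨m, hm⟩) : u ∈ tailClass m v := by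
  intro i hi
  rcases Nat.lt_or_ge m i with h1 | h1
  · exact h i h1
  · have : i = ⟨m, hm⟩ := Fin.ext (by simp; omega)
    rw [this, hk]

theorem swap_apply_of_le {m : ℕ} {p q i : Fin n} (hp : (p : ℕ) < m) (hq : (q : ℕ) < m)
    (hi : m ≤ (i : ℕ)) : Equiv.swap p q i = i :=
  Equiv.swap_apply_of_ne_of_ne (fun h => by subst h; omega) (fun h => by subst h; omega)

theorem perm12_apply_of_le (hn : 3 ≤ n) {i : Fin n} (hi : 3 ≤ (i : ℕ)) : perm12 n hn i = i :=
  swap_apply_of_le (by simp) (by simp) hi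

theorem perm123_apply_of_le (hn : 3 ≤ n) {i : Fin n} (hi : 3 ≤ (i : ℕ)) :
    perm123 n hn i = i := by
  rw [perm123, Equiv.Perm.mul_apply, swap_apply_of_le (by simp) (by simp) hi,
    swap_apply_of_le (by simp) (by simp) hi]

theorem perm132_apply_of_le (hn : 3 ≤ n) {i : Fin n} (hi : 3 ≤ (i : ℕ)) :
    perm132 n hn i = i := by
  rw [perm132, Equiv.Perm.mul_apply, swap_apply_of_le (by simp) (by simp) hi,
    swap_apply_of_le (by simp) (by simp) hi]

theorem mul_mem_tailClass {m : ℕ} {u τ s : Equiv.Perm (Fin n)} (hu : u ∈ tailClass m τ)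
    (hs : ∀ i : Fin n, m ≤ (i : ℕ) → s i = i) : u * s ∈ tailClass m τ := by
  intro i hi
  rw [Equiv.Perm.mul_apply, hs i hi, hu i hi]

/-- The generator (12)(3k), with `k` a 0-based position. -/
def crossPerm (hn : 3 ≤ n) (k : Fin n) : Equiv.Perm (Fin n) :=
  perm12 n hn * Equiv.swap ⟨2, by omega⟩ k

theorem adj_mul {hn : 3 ≤ n} {s : Equiv.Perm (Fin n)} (hs : s ∈ OmegaStar n hn)
    (u : Equiv.Perm (Fin n)) : (godanGraph n hn).Adj u (u * s) := by
  rw [godanGraph, SimpleGraph.fromRel_adj]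
  refine ⟨fun h => ?_, .inr ⟨s, hs, rfl⟩⟩
  have h1 : s = 1 := by simpa using h.symm
  have h2 : s ⟨0, by omega⟩ = ⟨0, by omega⟩ := by rw [h1]; rfl
  rcases hs with (rfl | rfl | rfl) | ⟨k, hk, rfl⟩
  · simp [perm12] at h2
  · simp [perm123, Equiv.swap_apply_def] at h2
  · simp [perm132, Equiv.swap_apply_def] at h2
  · have : (⟨0, by omega⟩ : Fin n) ≠ k := fun h => by rw [← h] at hk; simp at hk
    rw [Equiv.Perm.mul_apply, Equiv.swap_apply_of_ne_of_ne (by simp) this] at h2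
    simp [perm12] at h2

theorem crossPerm_mem {hn : 3 ≤ n} {k : Fin n} (hk : 3 ≤ (k : ℕ)) :
    crossPerm hn k ∈ OmegaStar n hn :=
  .inr ⟨k, hk, rfl⟩

theorem crossPerm_apply_self {hn : 3 ≤ n} (k : Fin n) :
    crossPerm hn k k = ⟨2, by omega⟩ := by
  simp [crossPerm, perm12, Equiv.swap_apply_def]

theorem crossPerm_apply_of_lt {hn : 3 ≤ n} {k i : Fin n} (hk : 3 ≤ (k : ℕ)) (hi : k < i) :
    crossPerm hn k i = i := by
  have hi' : (k : ℕ) < i := hi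
  rw [crossPerm, Equiv.Perm.mul_apply,
    swap_apply_of_le (m := k + 1) (by simp; omega) (by omega) (by omega),
    perm12_apply_of_le hn (by omega)]

/-- Distinct clusters inside a tail class are joined by at least `m - 1` disjoint edges, so
fewer deletions leave one of them intact. -/
theorem exists_cross_edge {hn : 3 ≤ n} {m : ℕ} (h3 : 3 ≤ m) (hm : m < n)
    {u v : Equiv.Perm (Fin n)} (huv : v ∈ tailClass (m + 1) u) (hne : u ⟨m, hm⟩ ≠ v ⟨m, hm⟩)
    {W : Set (Equiv.Perm (Fin n))}
    (hW : (W ∩ (tailClass m u ∪ tailClass m v)).ncard + 1 < m) :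
    ∃ x ∈ tailClass m u \ W, ∃ y ∈ tailClass m v \ W, (godanGraph n hn).Adj x y := by
  set k : Fin n := ⟨m, hm⟩ with hk
  set p0 : Fin n := ⟨0, by omega⟩ with hp0
  set p2 : Fin n := ⟨2, by omega⟩ with hp2
  obtain ⟨q, hq⟩ : ∃ q, u q = v k := u.surjective _
  have hqm : (q : ℕ) < m := by
    by_contra hcon
    rcases Nat.lt_or_ge m q with h1 | h1
    · have : v q = v k := by rw [huv q h1, hq]
      have := congrArg Fin.val (v.injective this)
      simp [hk] at this
      omega
    · have : q = k := Fin.ext (by simp [hk]; omega)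
      exact hne (by rw [← hq, this])
  let x : Fin n → Equiv.Perm (Fin n) := fun j => u * Equiv.swap p2 q * Equiv.swap p0 j
  let J : Finset (Fin n) := (Finset.univ.filter fun j : Fin n => (j : ℕ) < m).erase p2
  have hJcard : J.card = m - 1 := by
    rw [Finset.card_erase_of_mem (by simp [hp2]; omega)]
    have : (Finset.univ.filter fun j : Fin n => (j : ℕ) < m) = Finset.Iio k := by
      ext j
      simp [hk, Fin.lt_def]
    rw [this, Fin.card_Iio]
  have hxu : ∀ j ∈ J, x j ∈ tailClass m u := by
    intro j hj
    simp only [J, Finset.mem_erase, Finset.mem_filter, Finset.mem_univ, true_and] at hj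
    exact mul_mem_tailClass (mul_mem_tailClass (mem_tailClass_self m u)
      (fun _ => swap_apply_of_le (by simp [hp2]; omega) hqm))
      (fun _ => swap_apply_of_le (by simp [hp0]; omega) hj.2)
  have hx2 : ∀ j ∈ J, x j p2 = v k := by
    intro j hj
    simp only [J, Finset.mem_erase] at hj
    simp only [x, Equiv.Perm.mul_apply]
    rw [Equiv.swap_apply_of_ne_of_ne (by simp [hp0, hp2]) (Ne.symm hj.1),
      Equiv.swap_apply_left, hq]
  have hxv : ∀ j ∈ J, x j * crossPerm hn k ∈ tailClass m v := by
    intro j hj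
    refine mem_tailClass_of_succ hm (fun i hi => ?_) ?_
    · rw [Equiv.Perm.mul_apply, crossPerm_apply_of_lt (by simpa [hk] using h3)
        (by rw [Fin.lt_def]; simp [hk]; omega), hxu j hj i (by omega), huv i hi]
    · rw [Equiv.Perm.mul_apply, crossPerm_apply_self]
      exact hx2 j hj
  have hxinj : Function.Injective x := by
    intro a b hab
    have h1 : Equiv.swap p0 a = Equiv.swap p0 b := mul_left_cancel hab
    simpa using congrArg (fun e : Equiv.Perm (Fin n) => e p0) h1
  have hdisj : ∀ y, y ∈ tailClass m u → y ∈ tailClass m v → False := by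
    intro y h1 h2
    exact hne (by rw [← h1 k le_rfl, h2 k le_rfl])
  by_contra hcon
  push Not at hcon
  have hhit : ∀ j ∈ J, x j ∉ W → x j * crossPerm hn k ∈ W := by
    intro j hj h1
    by_contra h2
    exact hcon _ ⟨hxu j hj, h1⟩ _ ⟨hxv j hj, h2⟩ (adj_mul (crossPerm_mem h3) _)
  classical
  let f : Fin n → Equiv.Perm (Fin n) := fun j => if x j ∈ W then x j else x j * crossPerm hn k
  have hf : Set.InjOn f J := by
    intro a ha b hb hab
    simp only [f] at hab
    split_ifs at hab with h1 h2 h2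
    · exact hxinj hab
    · exact (hdisj _ (hxu a ha) (hab ▸ hxv b hb)).elim
    · exact (hdisj _ (hxu b hb) (hab ▸ hxv a ha)).elim
    · exact hxinj (mul_right_cancel hab)
  have hsub : f '' (J : Set (Fin n)) ⊆ W ∩ (tailClass m u ∪ tailClass m v) := by
    rintro _ ⟨j, hj, rfl⟩
    simp only [f]
    split_ifs with h1
    · exact ⟨h1, .inl (hxu j hj)⟩
    · exact ⟨hhit j hj h1, .inr (hxv j hj)⟩
  have := Set.ncard_le_ncard hsub (Set.toFinite _)
  rw [hf.ncard_image, Set.ncard_coe_finset, hJcard] at this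
  omega

/-- Two vertices in distinct clusters are joined within the two clusters, provided each cluster
is robust and few vertices are deleted. -/
theorem reachIn_of_cross {hn : 3 ≤ n} {m : ℕ} (hP : RobustAt hn m) (h3 : 3 ≤ m) (hm : m < n)
    {u v : Equiv.Perm (Fin n)} (huv : v ∈ tailClass (m + 1) u) (hne : u ⟨m, hm⟩ ≠ v ⟨m, hm⟩)
    {W : Set (Equiv.Perm (Fin n))}
    (hW : (W ∩ (tailClass m u ∪ tailClass m v)).ncard + 1 < m) (hu : u ∉ W) (hv : v ∉ W) :
    ReachIn hn ((tailClass m u ∪ tailClass m v) \ W) u v := by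
  obtain ⟨x, hx, y, hy, hxy⟩ := exists_cross_edge (hn := hn) h3 hm huv hne hW
  have hWu : (W ∩ tailClass m u).ncard + 2 ≤ m := by
    have := Set.ncard_le_ncard (Set.inter_subset_inter_right W
      (Set.subset_union_left (s := tailClass m u) (t := tailClass m v))) (Set.toFinite _)
    omega
  have hWv : (W ∩ tailClass m v).ncard + 2 ≤ m := by
    have := Set.ncard_le_ncard (Set.inter_subset_inter_right W
      (Set.subset_union_right (s := tailClass m u) (t := tailClass m v))) (Set.toFinite _)
    omega
  have h1 := hP u W hWu u ⟨mem_tailClass_self m u, hu⟩ x hx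
  have h2 := hP v W hWv y hy v ⟨mem_tailClass_self m v, hv⟩
  have hxy' : ReachIn hn ((tailClass m u ∪ tailClass m v) \ W) x y :=
    .of_adj ⟨.inl hx.1, hx.2⟩ ⟨.inr hy.1, hy.2⟩ hxy
  exact (h1.mono (Set.sdiff_subset_sdiff_left Set.subset_union_left)).trans
    (hxy'.trans (h2.mono (Set.sdiff_subset_sdiff_left Set.subset_union_right)))

theorem RobustAt.succ {hn : 3 ≤ n} {m : ℕ} (hP : RobustAt hn m) (h3 : 3 ≤ m) (hm : m < n) :
    RobustAt hn (m + 1) := by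
  intro τ W hW
  set k : Fin n := ⟨m, hm⟩ with hk
  have hsub : ∀ a ∈ tailClass (m + 1) τ, tailClass m a ⊆ tailClass (m + 1) τ := by
    intro a ha
    rw [← tailClass_eq ha]
    exact tailClass_subset_succ m a
  have hagree : ∀ a ∈ tailClass (m + 1) τ, ∀ b ∈ tailClass (m + 1) τ,
      b ∈ tailClass (m + 1) a := by
    intro a ha b hb
    rwa [tailClass_eq ha]
  have hsame : ∀ u ∈ tailClass (m + 1) τ \ W, ∀ v ∈ tailClass (m + 1) τ \ W, u k = v k →
      (W ∩ tailClass m u).ncard + 2 ≤ m → ReachIn hn (tailClass (m + 1) τ \ W) u v := by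
    intro u hu v hv huv hc
    exact (hP u W hc u ⟨mem_tailClass_self m u, hu.2⟩ v
      ⟨mem_tailClass_of_succ hm (hagree u hu.1 v hv.1) huv.symm, hv.2⟩).mono
      (Set.sdiff_subset_sdiff_left (hsub u hu.1))
  have hdiff : ∀ u ∈ tailClass (m + 1) τ \ W, ∀ v ∈ tailClass (m + 1) τ \ W, u k ≠ v k →
      (W ∩ (tailClass m u ∪ tailClass m v)).ncard + 1 < m →
      ReachIn hn (tailClass (m + 1) τ \ W) u v := by
    intro u hu v hv huv hc
    exact (reachIn_of_cross hP h3 hm (hagree u hu.1 v hv.1) huv hc hu.2 hv.2).mono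
      (Set.sdiff_subset_sdiff_left (Set.union_subset (hsub u hu.1) (hsub v hv.1)))
  have hfull : ∀ S ⊆ tailClass (m + 1) τ, m ≤ (W ∩ S).ncard + 1 →
      W ∩ tailClass (m + 1) τ ⊆ S := by
    intro S hS hc
    rw [← Set.eq_of_subset_of_ncard_le (Set.inter_subset_inter_right W hS) (by omega)
      (Set.toFinite _)]
    exact Set.inter_subset_right
  by_cases hA : ∃ a ∈ tailClass (m + 1) τ, m ≤ (W ∩ tailClass m a).ncard + 1
  · obtain ⟨a, ha, hac⟩ := hA
    have hall := hfull _ (hsub a ha) hac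
    have hclean : ∀ b ∈ tailClass (m + 1) τ, b k ≠ a k → W ∩ tailClass m b = ∅ := by
      intro b hb hba
      rw [Set.eq_empty_iff_forall_notMem]
      rintro y ⟨hyW, hyb⟩
      have := hall ⟨hyW, hsub b hb hyb⟩
      exact hba (by rw [← hyb k le_rfl, this k le_rfl])
    have hmove : ∀ u ∈ tailClass (m + 1) τ \ W, ∃ u' ∈ tailClass (m + 1) τ \ W,
        u' k ≠ a k ∧ ReachIn hn (tailClass (m + 1) τ \ W) u u' := by
      intro u hu
      by_cases hua : u k = a k
      · have h1 : u * crossPerm hn k ∈ tailClass (m + 1) τ :=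
          mul_mem_tailClass hu.1 fun i hi => crossPerm_apply_of_lt h3 hi
        have h2 : (u * crossPerm hn k) k ≠ a k := by
          rw [Equiv.Perm.mul_apply, crossPerm_apply_self, ← hua]
          intro h
          have := congrArg Fin.val (u.injective h)
          simp [hk] at this
          omega
        have h4 : u * crossPerm hn k ∉ W := fun h =>
          (Set.eq_empty_iff_forall_notMem.mp (hclean _ h1 h2)) _ ⟨h, mem_tailClass_self m _⟩
        exact ⟨_, ⟨h1, h4⟩, h2, .of_adj hu ⟨h1, h4⟩ (adj_mul (crossPerm_mem h3) u)⟩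
      · exact ⟨u, hu, hua, .refl⟩
    intro u hu v hv
    obtain ⟨u', hu', hua, huu⟩ := hmove u hu
    obtain ⟨v', hv', hva, hvv⟩ := hmove v hv
    refine huu.trans (ReachIn.trans ?_ hvv.symm)
    by_cases huv : u' k = v' k
    · exact hsame _ hu' _ hv' huv (by rw [hclean _ hu'.1 hua]; simp; omega)
    · refine hdiff _ hu' _ hv' huv ?_
      rw [Set.inter_union_distrib_left, hclean _ hu'.1 hua, hclean _ hv'.1 hva]
      simp
      omega
  · push Not at hA
    intro u hu v hv
    by_cases huv : u k = v k
    · exact hsame u hu v hv huv (by have := hA u hu.1; omega)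
    by_cases hc : (W ∩ (tailClass m u ∪ tailClass m v)).ncard + 1 < m
    · exact hdiff u hu v hv huv hc
    have hall := hfull _ (Set.union_subset (hsub u hu.1) (hsub v hv.1)) (not_lt.mp hc)
    obtain ⟨j, hjm, hj⟩ : ∃ j : Fin n, (j : ℕ) < m ∧ u j ≠ v k := by
      by_cases h0 : u ⟨0, by omega⟩ = v k
      · refine ⟨⟨1, by omega⟩, by simp; omega, fun h => ?_⟩
        have := u.injective (h.trans h0.symm)
        simp at this
      · exact ⟨⟨0, by omega⟩, by simp; omega, h0⟩
    set w := u * Equiv.swap k j with hw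
    have hwk : w k = u j := by simp [hw]
    have hwu : w k ≠ u k := by
      rw [hwk]
      intro h
      have := congrArg Fin.val (u.injective h)
      simp [hk] at this
      omega
    have hwv : w k ≠ v k := by rwa [hwk]
    have hwτ : w ∈ tailClass (m + 1) τ := by
      refine mul_mem_tailClass hu.1 fun i hi => Equiv.swap_apply_of_ne_of_ne ?_ ?_
      · rintro rfl
        simp [hk] at hi
      · rintro rfl
        omega
    have hWw : W ∩ tailClass m w = ∅ := by
      rw [Set.eq_empty_iff_forall_notMem]
      rintro y ⟨hyW, hyw⟩
      rcases hall ⟨hyW, hsub w hwτ hyw⟩ with h | h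
      · exact hwu (by rw [← hyw k le_rfl, h k le_rfl])
      · exact hwv (by rw [← hyw k le_rfl, h k le_rfl])
    have hwW : w ∉ W := fun h =>
      (Set.eq_empty_iff_forall_notMem.mp hWw) _ ⟨h, mem_tailClass_self m _⟩
    refine (hdiff u hu w ⟨hwτ, hwW⟩ hwu.symm ?_).trans (hdiff w ⟨hwτ, hwW⟩ v hv hwv ?_)
    · rw [Set.inter_union_distrib_left, hWw, Set.union_empty]
      exact hA u hu.1
    · rw [Set.inter_union_distrib_left, hWw, Set.empty_union]
      exact hA v hv.1

theorem eq_of_fixes_tail (hn : 3 ≤ n) {g : Equiv.Perm (Fin n)}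
    (hg : ∀ i : Fin n, 3 ≤ (i : ℕ) → g i = i) :
    g = 1 ∨ g = perm12 n hn ∨ g = perm123 n hn ∨ g = perm132 n hn ∨
      g = perm12 n hn * perm123 n hn ∨ g = perm12 n hn * perm132 n hn := by
  have hlow : ∀ i : Fin n, (i : ℕ) < 3 → ((g i : Fin n) : ℕ) < 3 := by
    intro i hi
    by_contra h
    have := g.injective (hg (g i) (by omega))
    omega
  have hext : ∀ h : Equiv.Perm (Fin n), (∀ i : Fin n, 3 ≤ (i : ℕ) → h i = i) →
      g ⟨0, by omega⟩ = h ⟨0, by omega⟩ → g ⟨1, by omega⟩ = h ⟨1, by omega⟩ →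
      g ⟨2, by omega⟩ = h ⟨2, by omega⟩ → g = h := by
    intro h hh h0 h1 h2
    ext1 ⟨i, hi⟩
    match i, hi with
    | 0, _ => exact h0
    | 1, _ => exact h1
    | 2, _ => exact h2
    | i + 3, hi => rw [hg _ (by simp), hh _ (by simp)]
  have l0 := hlow ⟨0, by omega⟩ (by simp)
  have l1 := hlow ⟨1, by omega⟩ (by simp)
  have l2 := hlow ⟨2, by omega⟩ (by simp)
  have d01 : (g ⟨0, by omega⟩ : ℕ) ≠ g ⟨1, by omega⟩ := fun h => by
    have := g.injective (Fin.ext h); simp at this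
  have d02 : (g ⟨0, by omega⟩ : ℕ) ≠ g ⟨2, by omega⟩ := fun h => by
    have := g.injective (Fin.ext h); simp at this
  have d12 : (g ⟨1, by omega⟩ : ℕ) ≠ g ⟨2, by omega⟩ := fun h => by
    have := g.injective (Fin.ext h); simp at this
  have hvals :
      ((g ⟨0, by omega⟩ : ℕ) = 0 ∧ (g ⟨1, by omega⟩ : ℕ) = 1 ∧ (g ⟨2, by omega⟩ : ℕ) = 2) ∨
      ((g ⟨0, by omega⟩ : ℕ) = 1 ∧ (g ⟨1, by omega⟩ : ℕ) = 0 ∧ (g ⟨2, by omega⟩ : ℕ) = 2) ∨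
      ((g ⟨0, by omega⟩ : ℕ) = 1 ∧ (g ⟨1, by omega⟩ : ℕ) = 2 ∧ (g ⟨2, by omega⟩ : ℕ) = 0) ∨
      ((g ⟨0, by omega⟩ : ℕ) = 2 ∧ (g ⟨1, by omega⟩ : ℕ) = 0 ∧ (g ⟨2, by omega⟩ : ℕ) = 1) ∨
      ((g ⟨0, by omega⟩ : ℕ) = 0 ∧ (g ⟨1, by omega⟩ : ℕ) = 2 ∧ (g ⟨2, by omega⟩ : ℕ) = 1) ∨
      ((g ⟨0, by omega⟩ : ℕ) = 2 ∧ (g ⟨1, by omega⟩ : ℕ) = 1 ∧ (g ⟨2, by omega⟩ : ℕ) = 0) := by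
    omega
  rcases hvals with ⟨h0, h1, h2⟩ | ⟨h0, h1, h2⟩ | ⟨h0, h1, h2⟩ | ⟨h0, h1, h2⟩ |
    ⟨h0, h1, h2⟩ | ⟨h0, h1, h2⟩
  · left
    refine hext _ (fun i hi => rfl) ?_ ?_ ?_ <;>
      simp [Fin.ext_iff, h0, h1, h2]
  · right; left
    refine hext _ (fun i hi => perm12_apply_of_le hn hi) ?_ ?_ ?_ <;>
      simp [perm12, Equiv.swap_apply_def, Fin.ext_iff, h0, h1, h2]
  · iterate 2 right
    left
    refine hext _ (fun i hi => perm123_apply_of_le hn hi) ?_ ?_ ?_ <;>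
      simp [perm123, Equiv.swap_apply_def, Fin.ext_iff, h0, h1, h2]
  · iterate 3 right
    left
    refine hext _ (fun i hi => perm132_apply_of_le hn hi) ?_ ?_ ?_ <;>
      simp [perm132, Equiv.swap_apply_def, Fin.ext_iff, h0, h1, h2]
  · iterate 4 right
    left
    refine hext _ (fun i hi => by
        rw [Equiv.Perm.mul_apply, perm123_apply_of_le hn hi, perm12_apply_of_le hn hi]) ?_ ?_ ?_ <;>
      simp [perm12, perm123, Equiv.swap_apply_def, Fin.ext_iff, h0, h1, h2]
  · iterate 5 right
    refine hext _ (fun i hi => by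
        rw [Equiv.Perm.mul_apply, perm132_apply_of_le hn hi, perm12_apply_of_le hn hi]) ?_ ?_ ?_ <;>
      simp [perm12, perm132, Equiv.swap_apply_def, Fin.ext_iff, h0, h1, h2]

theorem robustAt_three (hn : 3 ≤ n) : RobustAt hn 3 := by
  intro τ W hW u hu v hv
  set a := perm12 n hn with ha
  set b := perm123 n hn with hb
  set c := perm132 n hn with hc
  have haO : a ∈ OmegaStar n hn := .inl (.inl rfl)
  have hbO : b ∈ OmegaStar n hn := .inl (.inr (.inl rfl))
  have hcO : c ∈ OmegaStar n hn := .inl (.inr (.inr rfl))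
  have hat : ∀ i : Fin n, 3 ≤ (i : ℕ) → a i = i := fun i => perm12_apply_of_le hn
  have hbt : ∀ i : Fin n, 3 ≤ (i : ℕ) → b i = i := fun i => perm123_apply_of_le hn
  have hct : ∀ i : Fin n, 3 ≤ (i : ℕ) → c i = i := fun i => perm132_apply_of_le hn
  have hab : a * b = c * a := by
    simp [ha, hb, hc, perm12, perm123, perm132, mul_assoc]
  have hac : a * c = b * a := by
    simp [ha, hb, hc, perm12, perm123, perm132, mul_assoc]
  have hba : b ≠ a := fun h => by
    have := DFunLike.congr_fun h ⟨2, by omega⟩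
    simp [ha, hb, perm12, perm123, Equiv.swap_apply_def] at this
  have hca : c ≠ a := fun h => by
    have := DFunLike.congr_fun h ⟨2, by omega⟩
    simp [ha, hc, perm12, perm132, Equiv.swap_apply_def] at this
  have htwo : ∀ s t, (∀ i : Fin n, 3 ≤ (i : ℕ) → s i = i) → t ∈ OmegaStar n hn →
      s ∈ OmegaStar n hn → s ≠ a → a * t = s * a → v = u * (a * t) →
      ReachIn hn (tailClass 3 τ \ W) u v := by
    intro s t hst htO hsO hsa hats hvu
    have hua := mul_mem_tailClass hu.1 hat
    have hus := mul_mem_tailClass hu.1 hst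
    by_cases h1 : u * a ∈ W
    · by_cases h2 : u * s ∈ W
      · have hlt := (Set.one_lt_ncard_iff (Set.toFinite (W ∩ tailClass 3 τ))).mpr
          ⟨_, _, ⟨h1, hua⟩, ⟨h2, hus⟩, fun h => hsa (mul_left_cancel h).symm⟩
        omega
      · refine (ReachIn.of_adj hu ⟨hus, h2⟩ (adj_mul hsO u)).trans
          (ReachIn.of_adj ⟨hus, h2⟩ hv ?_)
        rw [hvu, hats, ← mul_assoc]
        exact adj_mul haO _
    · refine (ReachIn.of_adj hu ⟨hua, h1⟩ (adj_mul haO u)).trans (ReachIn.of_adj ⟨hua, h1⟩ hv ?_)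
      rw [hvu, ← mul_assoc]
      exact adj_mul htO _
  have hone : ∀ s ∈ OmegaStar n hn, u⁻¹ * v = s → ReachIn hn (tailClass 3 τ \ W) u v := by
    intro s hs h
    refine ReachIn.of_adj hu hv ?_
    rw [← mul_inv_cancel_left u v, h]
    exact adj_mul hs u
  have hfix : ∀ i : Fin n, 3 ≤ (i : ℕ) → (u⁻¹ * v) i = i := by
    intro i hi
    rw [Equiv.Perm.mul_apply, hv.1 i hi, ← hu.1 i hi, ← Equiv.Perm.mul_apply, inv_mul_cancel,
      Equiv.Perm.one_apply]
  rcases eq_of_fixes_tail hn hfix with h | h | h | h | h | h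
  · rw [inv_mul_eq_one.mp h]
    exact .refl
  · exact hone _ haO h
  · exact hone _ hbO h
  · exact hone _ hcO h
  · exact htwo c b hct hbO hcO hca hab (inv_mul_eq_iff_eq_mul.mp h)
  · exact htwo b c hbt hcO hbO hba hac (inv_mul_eq_iff_eq_mul.mp h)

theorem robustAt (hn : 3 ≤ n) {m : ℕ} (h3 : 3 ≤ m) (hm : m ≤ n) : RobustAt hn m := by
  induction m, h3 using Nat.le_induction with
  | base => exact robustAt_three hn
  | succ m h3 ih => exact (ih (by omega)).succ h3 hm

end Helpers

/-- Let n ≥ 4 and let K be a set of h ≥ 2 distinct cluster indices (0-based).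
Let H be the subgraph of EA_n induced on the union of the clusters EA_n^{n:k},
k ∈ K. Then κ(H) ≥ n − 2: for every set W of at most n − 3 vertices of H, the
graph H − W is connected. -/
theorem union_clusters_connectivity (n : ℕ) (hn : 4 ≤ n) (K : Finset (Fin n))
    (hK : 2 ≤ K.card) (W : Set (Equiv.Perm (Fin n)))
    (hWsub : ∀ σ ∈ W, σ (lastPos n (by omega)) ∈ K)
    (hWcard : W.ncard ≤ n - 3) :
    ((godanGraph n (by omega)).induce
      {σ : Equiv.Perm (Fin n) | σ (lastPos n (by omega)) ∈ K ∧ σ ∉ W}).Connected := by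
  obtain ⟨m, rfl⟩ : ∃ m, n = m + 1 := ⟨n - 1, by omega⟩
  have hn3 : 3 ≤ m + 1 := by omega
  have h3 : 3 ≤ m := by omega
  have hP : RobustAt hn3 m := robustAt hn3 h3 (by omega)
  have hlast : lastPos (m + 1) hn3 = ⟨m, by omega⟩ := rfl
  have hall : ∀ u v : Equiv.Perm (Fin (m + 1)), v ∈ tailClass (m + 1) u :=
    fun u v i hi => absurd i.isLt (by omega)
  have hcard : ∀ S : Set (Equiv.Perm (Fin (m + 1))), (W ∩ S).ncard + 1 < m := by
    intro S
    have := Set.ncard_le_ncard (Set.inter_subset_left (s := W) (t := S)) (Set.toFinite _)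
    omega
  have hsub : ∀ u : Equiv.Perm (Fin (m + 1)), u (lastPos (m + 1) hn3) ∈ K →
      ∀ σ ∈ tailClass m u, σ (lastPos (m + 1) hn3) ∈ K := by
    intro u hu σ hσ
    rwa [hσ _ (by simp [hlast])]
  rw [SimpleGraph.connected_iff]
  constructor
  · rintro ⟨u, hu⟩ ⟨v, hv⟩
    have hreach : ReachIn hn3
        {σ | σ (lastPos (m + 1) hn3) ∈ K ∧ σ ∉ W} u v := by
      by_cases huv : u (lastPos (m + 1) hn3) = v (lastPos (m + 1) hn3)
      · refine (hP u W (hcard _) u ⟨mem_tailClass_self m u, hu.2⟩ v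
          ⟨mem_tailClass_of_succ (by omega) (hall u v) huv.symm, hv.2⟩).mono ?_
        exact fun σ hσ => ⟨hsub u hu.1 σ hσ.1, hσ.2⟩
      · refine (reachIn_of_cross hP h3 (by omega) (hall u v) huv (hcard _) hu.2 hv.2).mono ?_
        exact fun σ hσ => ⟨hσ.1.elim (hsub u hu.1 σ) (hsub v hv.1 σ), hσ.2⟩
    exact (hreach.reachable hu).2
  · obtain ⟨i, hi, j, hj, hij⟩ := Finset.one_lt_card.mp hK
    obtain ⟨x, hx, -⟩ := exists_cross_edge (hn := hn3) h3 (by omega)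
      (hall (Equiv.swap ⟨m, by omega⟩ i) (Equiv.swap ⟨m, by omega⟩ j)) (by simpa using hij)
      (hcard _)
    exact ⟨x, hsub _ (by simpa [hlast] using hi) x hx.1, hx.2⟩

end Godan
end

section
/- Let n ≥ 4 and let S = {x, y, z, w} be any set of four distinct vertices of the godan graph EA_n all of the same parity (all four are even permutations, or all four are odd permutations). Then there exist n − 1 pairwise internally edge disjoint S-trees in EA_n. -/
namespace Godan

/-- `T 0, …, T (r-1)` is a family of r pairwise internally edge disjoint S-trees:
each `T i` is a subgraph of `G` which is a tree containing all vertices of `S`,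
and for i ≠ j, `V(T i) ∩ V(T j) = S` and `E(T i) ∩ E(T j) = ∅`. -/
def IsIDSTFamily {V : Type*} (G : SimpleGraph V) (S : Set V) {r : ℕ}
    (T : Fin r → G.Subgraph) : Prop :=
  (∀ i, S ⊆ (T i).verts ∧ ((T i).coe).IsTree) ∧
    ∀ i j, i ≠ j → (T i).verts ∩ (T j).verts = S ∧ (T i).edgeSet ∩ (T j).edgeSet = ∅

/-- The maximum number of pairwise internally edge disjoint S-trees in G. -/
noncomputable def maxIDST {V : Type*} (G : SimpleGraph V) (S : Set V) : ℕ :=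
  sSup {r : ℕ | ∃ T : Fin r → G.Subgraph, IsIDSTFamily G S T}

/-- The generalized k-connectivity κ_k(G): the minimum over all k-element vertex
sets S of the maximum number of pairwise internally edge disjoint S-trees. -/
noncomputable def genConn {V : Type*} [Fintype V] (G : SimpleGraph V) (k : ℕ) : ℕ :=
  sInf {m : ℕ | ∃ S : Finset V, S.card = k ∧ maxIDST G (↑S : Set V) = m}

set_option linter.unusedSectionVars false

open Equiv

section Packing

variable {V W ι κ : Type*}

/-- Adjacency in the part of `G` spanned by `S ∪ U` in which, of the edges inside `S`, only
those selected by `F` are kept. -/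
def LinkAdj (G : SimpleGraph V) (S U : Set V) (F : V → V → Prop) (a b : V) : Prop :=
  G.Adj a b ∧ a ∈ S ∪ U ∧ b ∈ S ∪ U ∧ (a ∈ U ∨ b ∈ U ∨ F a b ∨ F b a)

/-- A system of disjoint vertex sets `U i` outside `S` and disjoint edge sets `F i` inside `S`
such that each `S ∪ U i` is connected through `LinkAdj`. -/
structure IsPacking (G : SimpleGraph V) (S : Set V) (U : ι → Set V)
    (F : ι → V → V → Prop) : Prop where
  disjoint : ∀ i j a, i ≠ j → a ∈ U i → a ∉ U j
  avoid : ∀ i a, a ∈ S → a ∉ U i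
  edges : ∀ i j a b, i ≠ j → a ∈ S → b ∈ S → F i a b → ¬ F j a b ∧ ¬ F j b a
  conn : ∀ i, ∃ r, ∀ a ∈ S ∪ U i, Relation.ReflTransGen (LinkAdj G S (U i) (F i)) a r

/-- `G` has a packing of `S`-connecting pieces indexed by `ι`. -/
def HasPacking (ι : Type*) (G : SimpleGraph V) (S : Set V) : Prop :=
  ∃ (U : ι → Set V) (F : ι → V → V → Prop), IsPacking G S U F

lemma HasPacking.congr {G : SimpleGraph V} {S : Set V} (e : κ ≃ ι) (h : HasPacking ι G S) :
    HasPacking κ G S := by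
  obtain ⟨U, F, h⟩ := h
  refine ⟨fun i => U (e i), fun i => F (e i), ?_, ?_, ?_, ?_⟩
  · intro i j a hij; exact h.disjoint _ _ a (e.injective.ne hij)
  · intro i; exact h.avoid _
  · intro i j a b hij; exact h.edges _ _ a b (e.injective.ne hij)
  · intro i; exact h.conn _

lemma HasPacking.map {G : SimpleGraph V} {H : SimpleGraph W} {S : Set V} (φ : V → W)
    (hφ : Function.Injective φ) (hadj : ∀ a b, G.Adj a b → H.Adj (φ a) (φ b))
    (h : HasPacking ι G S) :
    ∃ (U : ι → Set W) (F : ι → W → W → Prop), IsPacking H (φ '' S) U F ∧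
      ∀ i, U i ⊆ Set.range φ := by
  obtain ⟨U, F, h⟩ := h
  refine ⟨fun i => φ '' U i, fun i a b => ∃ a' b', φ a' = a ∧ φ b' = b ∧ F i a' b',
    ⟨?_, ?_, ?_, ?_⟩, fun i => Set.image_subset_range _ _⟩
  · rintro i j _ hij ⟨a, ha, rfl⟩ ⟨b, hb, hab⟩
    exact h.disjoint i j a hij ha (hφ hab ▸ hb)
  · rintro i _ ⟨a, ha, rfl⟩ ⟨b, hb, hab⟩
    exact h.avoid i a ha (hφ hab ▸ hb)
  · rintro i j _ _ hij ⟨a, ha, rfl⟩ ⟨b, hb, rfl⟩ ⟨a', b', h1, h2, h3⟩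
    obtain rfl := hφ h1
    obtain rfl := hφ h2
    obtain ⟨h4, h5⟩ := h.edges i j _ _ hij ha hb h3
    refine ⟨?_, ?_⟩
    · rintro ⟨c, d, h6, h7, h8⟩
      rw [hφ h6, hφ h7] at h8; exact h4 h8
    · rintro ⟨c, d, h6, h7, h8⟩
      rw [hφ h6, hφ h7] at h8; exact h5 h8
  · intro i
    obtain ⟨r, hr⟩ := h.conn i
    refine ⟨φ r, ?_⟩
    rw [← Set.image_union]
    rintro _ ⟨a, ha, rfl⟩
    refine (hr a ha).lift φ ?_
    rintro x y ⟨h1, h2, h3, h4⟩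
    refine ⟨hadj _ _ h1, by rw [← Set.image_union]; exact ⟨_, h2, rfl⟩,
      by rw [← Set.image_union]; exact ⟨_, h3, rfl⟩, ?_⟩
    rcases h4 with h4 | h4 | h4 | h4
    · exact Or.inl ⟨_, h4, rfl⟩
    · exact Or.inr (Or.inl ⟨_, h4, rfl⟩)
    · exact Or.inr (Or.inr (Or.inl ⟨_, _, rfl, rfl, h4⟩))
    · exact Or.inr (Or.inr (Or.inr ⟨_, _, rfl, rfl, h4⟩))

/-- A further piece, attached to every vertex of `S`, can be added to a packing. -/
lemma IsPacking.insert {G : SimpleGraph V} {S : Set V} {U : ι → Set V}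
    {F : ι → V → V → Prop} (h : IsPacking G S U F) (X : Set V) (r : V)
    (hX : ∀ a ∈ X, a ∉ S ∧ ∀ i, a ∉ U i)
    (hr : ∀ a ∈ S ∪ X, Relation.ReflTransGen (LinkAdj G S X (fun _ _ => False)) a r) :
    HasPacking (Option ι) G S := by
  refine ⟨fun i => i.elim X U, fun i => i.elim (fun _ _ => False) F, ?_, ?_, ?_, ?_⟩
  · rintro (_ | i) (_ | j) a hij h1 h2
    · exact hij rfl
    · exact (hX a h1).2 j h2
    · exact (hX a h2).2 i h1
    · exact h.disjoint i j a (fun h => hij (congrArg some h)) h1 h2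
  · rintro (_ | i) a h1 h2
    · exact (hX a h2).1 h1
    · exact h.avoid i a h1 h2
  · rintro (_ | i) (_ | j) a b hij ha hb h1
    · exact h1.elim
    · exact h1.elim
    · exact ⟨id, id⟩
    · exact h.edges i j a b (fun h => hij (congrArg some h)) ha hb h1
  · rintro (_ | i)
    · exact ⟨r, hr⟩
    · exact h.conn i

lemma HasPacking.exists_isIDSTFamily [Fintype ι] {G : SimpleGraph V} {S : Set V}
    (hS : S.Nonempty) {m : ℕ} (hm : Fintype.card ι = m) (h : HasPacking ι G S) :
    ∃ T : Fin m → G.Subgraph, IsIDSTFamily G S T := by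
  obtain ⟨U, F, h⟩ := h.congr (Fintype.equivFinOfCardEq hm).symm
  have key : ∀ i, ∃ T : G.Subgraph, T.verts = S ∪ U i ∧ T.coe.IsTree ∧
      ∀ a b, T.Adj a b → LinkAdj G S (U i) (F i) a b := by
    intro i
    let K : SimpleGraph ↥(S ∪ U i) :=
      { Adj := fun a b => LinkAdj G S (U i) (F i) a b
        symm := ⟨by
          rintro a b ⟨h1, h2, h3, h4⟩
          exact ⟨h1.symm, h3, h2, by tauto⟩⟩
        loopless := ⟨fun a h => G.loopless.irrefl _ h.1⟩ }
    obtain ⟨r, hr⟩ := h.conn i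
    have hreach : ∀ a b : V, Relation.ReflTransGen (LinkAdj G S (U i) (F i)) a b →
        ∀ ha : a ∈ S ∪ U i, ∃ hb : b ∈ S ∪ U i, K.Reachable ⟨a, ha⟩ ⟨b, hb⟩ := by
      intro a b hab ha
      induction hab with
      | refl => exact ⟨ha, SimpleGraph.Reachable.refl _⟩
      | tail _ hbc ih =>
        obtain ⟨hb, hab⟩ := ih
        refine ⟨hbc.2.2.1, hab.trans (SimpleGraph.Adj.reachable ?_)⟩
        exact hbc
    obtain ⟨s, hs⟩ := hS
    have hK : K.Connected := by
      have : Nonempty ↥(S ∪ U i) := ⟨⟨s, Or.inl hs⟩⟩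
      refine SimpleGraph.Connected.mk ?_
      rintro ⟨a, ha⟩ ⟨b, hb⟩
      obtain ⟨_, h1⟩ := hreach a r (hr a ha) ha
      obtain ⟨_, h2⟩ := hreach b r (hr b hb) hb
      exact h1.trans h2.symm
    obtain ⟨T, hT, hTree⟩ := hK.exists_isTree_le
    refine ⟨{ verts := S ∪ U i
              Adj := fun a b => ∃ ha hb, T.Adj ⟨a, ha⟩ ⟨b, hb⟩
              adj_sub := ?_
              edge_vert := ?_
              symm := ?_ }, rfl, ?_, ?_⟩
    · rintro a b ⟨ha, hb, hab⟩; exact (hT hab).1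
    · rintro a b ⟨ha, hb, hab⟩; exact ha
    · constructor
      rintro a b ⟨ha, hb, hab⟩; exact ⟨hb, ha, hab.symm⟩
    · convert hTree using 1
      ext a b
      exact ⟨fun ⟨_, _, hab⟩ => hab, fun hab => ⟨a.2, b.2, hab⟩⟩
    · rintro a b ⟨ha, hb, hab⟩; exact hT hab
  choose T hT1 hT2 hT3 using key
  refine ⟨T, fun i => ⟨by rw [hT1]; exact Set.subset_union_left, hT2 i⟩, fun i j hij => ⟨?_, ?_⟩⟩
  · rw [hT1, hT1]
    ext a
    refine ⟨?_, fun ha => ⟨Or.inl ha, Or.inl ha⟩⟩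
    rintro ⟨ha | ha, hb | hb⟩
    · exact ha
    · exact ha
    · exact hb
    · exact absurd hb (h.disjoint i j a hij ha)
  · ext e
    refine Sym2.ind (fun a b => ?_) e
    simp only [Set.mem_inter_iff, SimpleGraph.Subgraph.mem_edgeSet, Set.mem_empty_iff_false,
      iff_false, not_and]
    intro h1 h2
    obtain ⟨_, ha1, hb1, h1⟩ := hT3 _ _ _ h1
    obtain ⟨_, ha2, hb2, h2⟩ := hT3 _ _ _ h2
    have hmem : ∀ v, v ∈ S ∪ U i → v ∈ S ∪ U j → v ∈ S := by
      rintro v (hv | hv) (hv' | hv')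
      · exact hv
      · exact hv
      · exact hv'
      · exact absurd hv' (h.disjoint i j v hij hv)
    have ha := hmem a ha1 ha2
    have hb := hmem b hb1 hb2
    have h1' : F i a b ∨ F i b a := by
      rcases h1 with h1 | h1 | h1
      · exact absurd h1 (h.avoid i a ha)
      · exact absurd h1 (h.avoid i b hb)
      · exact h1
    have h2' : F j a b ∨ F j b a := by
      rcases h2 with h2 | h2 | h2
      · exact absurd h2 (h.avoid j a ha)
      · exact absurd h2 (h.avoid j b hb)
      · exact h2
    rcases h1' with h1 | h1
    · have := h.edges i j a b hij ha hb h1; tauto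
    · have := h.edges i j b a hij hb ha h1; tauto

end Packing

/-- Three distinct positions: the two exchanged by the basic transposition, and the pivot `t`. -/
structure Frame (α : Type*) where
  p : α
  q : α
  t : α
  pq : p ≠ q
  pt : p ≠ t
  qt : q ≠ t

namespace Frame

variable {α : Type*} [DecidableEq α] [Fintype α] (f : Frame α)

/-- The positions outside the frame. -/
def High (i : α) : Prop := i ≠ f.p ∧ i ≠ f.q ∧ i ≠ f.t

/-- The even generator bringing position `i` to the pivot. -/
def rho (i : α) : Perm α :=
  if i = f.t then 1 else swap f.p f.q * swap f.t (swap f.p f.q i)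

/-- The neighbour of `v` along the basic transposition. -/
def mate (v : Perm α) : Perm α := v * swap f.p f.q

/-- The neighbour of `v`, of the same sign, that has value `c` at the pivot. -/
def nb (v : Perm α) (c : α) : Perm α := v * f.rho (v⁻¹ c)

/-- The neighbour of `v` in which the values at the pivot and at `k` are exchanged. -/
def fl (k : α) (v : Perm α) : Perm α := f.nb v (v k)

variable {f}

lemma rho_t (i : α) : f.rho i f.t = i := by
  unfold rho
  split_ifs with h
  · simp [h]
  · simp

lemma swap_t : swap f.p f.q f.t = f.t := swap_apply_of_ne_of_ne f.pt.symm f.qt.symm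

lemma swap_high {j : α} (hj : f.High j) : swap f.p f.q j = j := swap_apply_of_ne_of_ne hj.1 hj.2.1

lemma swap_ne_t {i : α} (hi : i ≠ f.t) : swap f.p f.q i ≠ f.t := by
  intro h
  apply hi
  rw [← swap_t] at h
  exact (swap f.p f.q).injective h

lemma rho_high (i : α) {j : α} (hj : f.High j) : f.rho i j = if i = j then f.t else j := by
  unfold rho
  rcases eq_or_ne i f.t with h | h
  · rw [if_pos h, if_neg (by rintro rfl; exact hj.2.2 h)]; rfl
  · rw [if_neg h]
    split_ifs with h1
    · subst h1
      simp [swap_high hj, swap_t]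
    · have : swap f.p f.q i ≠ j := by
        intro h2
        apply h1
        rw [← swap_high hj] at h2
        exact (swap f.p f.q).injective h2
      simp [swap_apply_of_ne_of_ne hj.2.2 this.symm, swap_high hj]

lemma sign_rho (i : α) : Perm.sign (f.rho i) = 1 := by
  unfold rho
  split_ifs with h
  · simp
  · simp [Perm.sign_swap f.pq, Perm.sign_swap (swap_ne_t h).symm]

@[simp] lemma nb_t (v : Perm α) (c : α) : f.nb v c f.t = c := by simp [nb, rho_t]

lemma nb_high (v : Perm α) (c : α) {j : α} (hj : f.High j) :
    f.nb v c j = if v j = c then v f.t else v j := by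
  simp only [nb, Perm.mul_apply, rho_high _ hj, Perm.inv_eq_iff_eq, eq_comm (a := c)]
  split_ifs <;> rfl

@[simp] lemma sign_nb (v : Perm α) (c : α) : Perm.sign (f.nb v c) = Perm.sign v := by
  simp [nb, sign_rho]

@[simp] lemma mate_t (v : Perm α) : f.mate v f.t = v f.t := by simp [mate, swap_t]

lemma mate_high (v : Perm α) {j : α} (hj : f.High j) : f.mate v j = v j := by
  simp [mate, swap_high hj]

@[simp] lemma sign_mate (v : Perm α) : Perm.sign (f.mate v) = -Perm.sign v := by
  simp [mate, Perm.sign_swap f.pq]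

@[simp] lemma mate_mate (v : Perm α) : f.mate (f.mate v) = v := by simp [mate, mul_assoc]

lemma fl_t (k : α) (v : Perm α) : f.fl k v f.t = v k := nb_t _ _

lemma fl_high {k : α} (v : Perm α) {j : α} (hj : f.High j) :
    f.fl k v j = if j = k then v f.t else v j := by
  simp [fl, nb_high _ _ hj]

@[simp] lemma sign_fl (k : α) (v : Perm α) : Perm.sign (f.fl k v) = Perm.sign v := sign_nb _ _

/-- A permutation is determined by its sign and its values off `p` and `q`. -/
lemma ext_sign {u v : Perm α} (h : Perm.sign u = Perm.sign v) (ht : u f.t = v f.t)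
    (hh : ∀ j, f.High j → u j = v j) : u = v := by
  have key : ∀ j, j ≠ f.p → j ≠ f.q → (v⁻¹ * u) j = j := by
    intro j h1 h2
    rw [Perm.mul_apply, Perm.inv_eq_iff_eq]
    rcases eq_or_ne j f.t with rfl | h3
    · exact ht
    · exact hh j ⟨h1, h2, h3⟩
  have hs : Perm.sign (v⁻¹ * u) = 1 := by
    rw [Perm.sign_mul, Perm.sign_inv, h, Int.units_mul_self]
  have hp : (v⁻¹ * u) f.p = f.p ∨ (v⁻¹ * u) f.p = f.q := by
    by_contra! hne
    have := key _ hne.1 hne.2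
    exact hne.1 ((v⁻¹ * u).injective this)
  have hone : v⁻¹ * u = 1 ∨ v⁻¹ * u = swap f.p f.q := by
    have hq : ∀ a, (v⁻¹ * u) f.q = a → a = f.p ∨ a = f.q := by
      intro a ha
      by_contra! hne
      have := key a hne.1 hne.2
      rw [← ha] at this
      have := (v⁻¹ * u).injective this
      exact hne.2 (ha ▸ this)
    have hq := hq _ rfl
    have hinj : (v⁻¹ * u) f.p ≠ (v⁻¹ * u) f.q := fun h => f.pq ((v⁻¹ * u).injective h)
    rcases hp with hp | hp
    · left
      ext j
      by_cases h1 : j = f.p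
      · subst h1; exact hp
      by_cases h2 : j = f.q
      · subst h2
        rcases hq with hq | hq
        · exact absurd (hp.trans hq.symm) hinj
        · exact hq
      · exact key j h1 h2
    · right
      ext j
      by_cases h1 : j = f.p
      · subst h1; simpa using hp
      by_cases h2 : j = f.q
      · subst h2
        rcases hq with hq | hq
        · simpa using hq
        · exact absurd (hp.trans hq.symm) hinj
      · rw [key j h1 h2, swap_apply_of_ne_of_ne h1 h2]
  rcases hone with h1 | h1
  · exact (inv_mul_eq_one.mp h1).symm
  · rw [h1, Perm.sign_swap f.pq] at hs
    exact absurd hs (by decide)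

lemma nb_nb_self (v : Perm α) (c : α) : f.nb (f.nb v c) (v f.t) = v := by
  refine ext_sign (f := f) (by simp) (by simp) fun j hj => ?_
  rw [nb_high _ _ hj, nb_high _ _ hj]
  have : v j ≠ v f.t := fun h => hj.2.2 (v.injective h)
  simp only [nb_t]
  split_ifs <;> simp_all

lemma nb_eq_self {v : Perm α} {c : α} : f.nb v c = v ↔ c = v f.t := by
  constructor
  · intro h; rw [← nb_t (f := f) v c, h]
  · rintro rfl
    simp [nb, rho]

lemma fl_fl {k : α} (hk : f.High k) (v : Perm α) : f.fl k (f.fl k v) = v := by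
  refine ext_sign (f := f) (by simp) ?_ fun j hj => ?_
  · rw [fl_t, fl_high v hk, if_pos rfl]
  · rw [fl_high _ hj, fl_high _ hj, fl_t]
    split_ifs with h
    · rw [h]
    · rfl

lemma nb_mate (v : Perm α) (c : α) : f.nb (f.mate v) c = f.mate (f.nb v c) := by
  refine ext_sign (f := f) (by simp) (by simp) fun j hj => ?_
  rw [nb_high _ _ hj, mate_high _ hj, mate_high _ hj, nb_high _ _ hj, mate_t]

variable (f)

/-- The graph in which every permutation is joined to its mate and to its `nb` neighbours. -/
def graph : SimpleGraph (Perm α) where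
  Adj v u := u ≠ v ∧ (u = f.mate v ∨ ∃ c, u = f.nb v c)
  symm := ⟨by
    rintro v u ⟨h, h1 | ⟨c, h1⟩⟩
    · exact ⟨h.symm, Or.inl (by rw [h1, mate_mate])⟩
    · exact ⟨h.symm, Or.inr ⟨v f.t, by rw [h1, nb_nb_self]⟩⟩⟩
  loopless := ⟨fun v h => h.1 rfl⟩

variable {f}

lemma adj_mate (v : Perm α) : f.graph.Adj v (f.mate v) := by
  refine ⟨fun h => ?_, Or.inl rfl⟩
  have := congrArg Perm.sign h
  rw [sign_mate] at this
  rcases Int.units_eq_one_or (Perm.sign v) with h1 | h1 <;> rw [h1] at this <;>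
    exact absurd this (by decide)

lemma adj_nb {v : Perm α} {c : α} (h : c ≠ v f.t) : f.graph.Adj v (f.nb v c) :=
  ⟨fun h1 => h (nb_eq_self.mp h1), Or.inr ⟨c, rfl⟩⟩

lemma adj_fl {k : α} (hk : f.High k) (v : Perm α) : f.graph.Adj v (f.fl k v) :=
  adj_nb fun h => hk.2.2 (v.injective h)

/-- Left multiplication is an automorphism. -/
lemma adj_mul_left (g : Perm α) {u v : Perm α} (h : f.graph.Adj u v) :
    f.graph.Adj (g * u) (g * v) := by
  obtain ⟨h, h1 | ⟨c, h1⟩⟩ := h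
  · exact ⟨fun h2 => h (mul_left_cancel h2), Or.inl (by rw [h1]; simp [mate, mul_assoc])⟩
  · refine ⟨fun h2 => h (mul_left_cancel h2), Or.inr ⟨g c, ?_⟩⟩
    rw [h1]
    simp [nb, mul_assoc]

end Frame

/-- The frame of the godan graph. -/
def stdFrame (n : ℕ) (hn : 3 ≤ n) : Frame (Fin n) where
  p := ⟨0, by omega⟩
  q := ⟨1, by omega⟩
  t := ⟨2, by omega⟩
  pq := by simp
  pt := by simp
  qt := by simp

lemma stdFrame_graph_le (n : ℕ) (hn : 3 ≤ n) {u v : Perm (Fin n)}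
    (h : (stdFrame n hn).graph.Adj u v) : (godanGraph n hn).Adj u v := by
  set f := stdFrame n hn with hf
  have hmem : ∀ i, f.rho i = 1 ∨ f.rho i ∈ OmegaStar n hn := by
    intro i
    by_cases ht : i = f.t
    · left; simp [Frame.rho, ht]
    right
    by_cases hp : i = f.p
    · left; right; left
      rw [Frame.rho, if_neg ht, hp, swap_apply_left, perm123]
      rw [show (⟨0, by omega⟩ : Fin n) = f.p from rfl, show (⟨1, by omega⟩ : Fin n) = f.q from rfl,
        show (⟨2, by omega⟩ : Fin n) = f.t from rfl]
      ext1 x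
      have := f.pq; have := f.pt; have := f.qt
      simp only [Perm.mul_apply, swap_apply_def]
      grind
    by_cases hq : i = f.q
    · left; right; right
      rw [Set.mem_singleton_iff, Frame.rho, if_neg ht, hq, swap_apply_right, perm132]
      rw [show (⟨0, by omega⟩ : Fin n) = f.p from rfl, show (⟨1, by omega⟩ : Fin n) = f.q from rfl,
        show (⟨2, by omega⟩ : Fin n) = f.t from rfl, swap_comm f.t f.p]
    · right
      refine ⟨i, ?_, ?_⟩
      · have h0 : (i : ℕ) ≠ 0 := fun h => hp (Fin.ext h)
        have h1 : (i : ℕ) ≠ 1 := fun h => hq (Fin.ext h)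
        have h2 : (i : ℕ) ≠ 2 := fun h => ht (Fin.ext h)
        omega
      · rw [Frame.rho, if_neg ht, swap_apply_of_ne_of_ne hp hq]
        rfl
  obtain ⟨hne, h1⟩ := h
  rw [godanGraph, SimpleGraph.fromRel_adj]
  refine ⟨hne.symm, Or.inr ?_⟩
  rcases h1 with h1 | ⟨c, h1⟩
  · exact ⟨_, Or.inl (Or.inl rfl), h1⟩
  · rcases hmem (u⁻¹ c) with h2 | h2
    · exact absurd (by rw [h1, Frame.nb, h2, mul_one]) hne
    · exact ⟨_, h2, h1⟩

namespace Frame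

variable {α : Type*} [DecidableEq α] [Fintype α] {f : Frame α}

/-- Adjacency inside the set of permutations of sign `ε` with value `c` at `k`. -/
def HubAdj (f : Frame α) (k : α) (ε : ℤˣ) (c : α) (a b : Perm α) : Prop :=
  f.graph.Adj a b ∧ (Perm.sign a = ε ∧ a k = c) ∧ Perm.sign b = ε ∧ b k = c

lemma HubAdj.nb {k : α} (hk : f.High k) {ε : ℤˣ} {c : α} {v : Perm α} (hε : Perm.sign v = ε)
    (hc : v k = c) {d : α} (hd : d ≠ c) :
    Relation.ReflTransGen (f.HubAdj k ε c) v (f.nb v d) := by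
  by_cases h : d = v f.t
  · rw [nb_eq_self.mpr h]
  · refine Relation.ReflTransGen.single ⟨adj_nb h, ⟨hε, hc⟩, by simpa using hε, ?_⟩
    rw [nb_high _ _ hk, hc, if_neg hd.symm]

lemma hub_connected {k : α} (hk : f.High k) {m m' : Perm α} (hs : Perm.sign m = Perm.sign m')
    (hkk : m k = m' k) :
    Relation.ReflTransGen (f.HubAdj k (Perm.sign m') (m' k)) m m' := by
  classical
  induction hN : (Finset.univ.filter fun j => f.High j ∧ m j ≠ m' j).card
    using Nat.strong_induction_on generalizing m with
  | _ N ih =>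
    by_cases h : ∀ j, f.High j → m j = m' j
    · have h1 : f.nb m (m' f.t) = m' := by
        refine ext_sign (f := f) (by simpa using hs) (by simp) fun j hj => ?_
        rw [nb_high _ _ hj, if_neg, h j hj]
        rw [h j hj]
        exact fun h2 => hj.2.2 (m'.injective h2)
      have := HubAdj.nb hk hs hkk (d := m' f.t) fun h2 => hk.2.2 (m'.injective h2.symm)
      rwa [h1] at this
    · push Not at h
      obtain ⟨j, hj, hne⟩ := h
      have hjk : j ≠ k := by rintro rfl; exact hne hkk
      have h1 := HubAdj.nb hk hs hkk (d := m' j) fun h2 => hjk (m'.injective h2)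
      have hsm : Perm.sign (f.nb m (m' j)) = Perm.sign m' := by simpa using hs
      have hkm : f.nb m (m' j) k = m' k := by
        rw [nb_high _ _ hk, hkk, if_neg fun h2 => hjk (m'.injective h2.symm)]
      have h2 : Relation.ReflTransGen (f.HubAdj k (Perm.sign m') (m' k)) (f.nb m (m' j))
          (f.fl j (f.nb m (m' j))) := by
        refine HubAdj.nb hk hsm hkm fun h2 => ?_
        rw [← hkm] at h2
        exact hjk ((f.nb m (m' j)).injective h2)
      refine (h1.trans h2).trans (ih _ ?_ (by simpa using hs) ?_ rfl)
      · rw [← hN]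
        refine Finset.card_lt_card (Finset.ssubset_iff_of_subset ?_ |>.mpr ⟨j, ?_, ?_⟩)
        · intro i
          simp only [Finset.mem_filter, Finset.mem_univ, true_and]
          rintro ⟨hi, h3⟩
          refine ⟨hi, ?_⟩
          rw [fl_high _ hi, nb_t, nb_high _ _ hi] at h3
          intro h4
          split_ifs at h3 with h5 h6
          · rw [h5] at h3; exact h3 rfl
          · exact h5 (m'.injective (h4.symm.trans h6))
          · exact h3 h4
        · simp [hj, hne]
        · simp [fl_high _ hj]
      · rw [fl_high _ hk, if_neg hjk.symm, hkm]

end Frame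

lemma LinkAdj.mono {V : Type*} {G : SimpleGraph V} {S U U' : Set V} {F F' : V → V → Prop}
    (hU : U ⊆ U') (hF : ∀ a b, F a b → F' a b) {a b : V} (h : LinkAdj G S U F a b) :
    LinkAdj G S U' F' a b := by
  obtain ⟨h1, h2, h3, h4⟩ := h
  refine ⟨h1, Set.union_subset_union_right S hU h2, Set.union_subset_union_right S hU h3, ?_⟩
  rcases h4 with h4 | h4 | h4 | h4
  · exact Or.inl (hU h4)
  · exact Or.inr (Or.inl (hU h4))
  · exact Or.inr (Or.inr (Or.inl (hF _ _ h4)))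
  · exact Or.inr (Or.inr (Or.inr (hF _ _ h4)))

namespace Frame

variable {α : Type*} [DecidableEq α] [Fintype α] {f : Frame α}

/-- Two permutations are in conflict at position `k` when their routes to each other's
value meet. -/
def Conf (f : Frame α) (k : α) (v u : Perm α) : Prop :=
  v ≠ u ∧ ((v k ≠ u k ∧ f.fl k (f.nb v (u k)) = f.nb u (v k)) ∨ (v k = u k ∧ f.nb v (u f.t) = u))

/-- The value whose route from `v` causes the conflict with `u`. -/
def lab (f : Frame α) (k : α) (v u : Perm α) : α := if v k = u k then u f.t else u k

lemma Conf.symm {k : α} (hk : f.High k) {v u : Perm α} (h : f.Conf k v u) : f.Conf k u v := by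
  obtain ⟨h1, ⟨h2, h3⟩ | ⟨h2, h3⟩⟩ := h
  · exact ⟨h1.symm, Or.inl ⟨h2.symm, by rw [← h3, fl_fl hk]⟩⟩
  · refine ⟨h1.symm, Or.inr ⟨h2.symm, ?_⟩⟩
    nth_rewrite 1 [← h3]
    exact nb_nb_self _ _

/-- The permutations of sign `ε` with value `c` at `k`. -/
def hub (k : α) (ε : ℤˣ) (c : α) : Set (Perm α) := {m | Perm.sign m = ε ∧ m k = c}

/-- The direct routes (`D` lists the pairs without one) together with the detours `L` and the
hubs of opposite sign form a packing indexed by the values different from `a`. -/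
theorem hasPacking_of_detours {k : α} (hk : f.High k) (a : α) {ε : ℤˣ} {S : Set (Perm α)}
    (hne : S.Nonempty) (hS : ∀ v ∈ S, Perm.sign v = ε) (D : Perm α → α → Prop)
    (L : Perm α → α → Set (Perm α))
    (hconf : ∀ v ∈ S, ∀ u ∈ S, f.Conf k v u → f.lab k v u ≠ a → f.lab k u v ≠ a →
      D v (f.lab k v u) ∨ D u (f.lab k u v))
    (hhub : ∀ v ∈ S, ∀ c, c ≠ a → D v c → ∀ m ∈ L v c, Perm.sign m = -ε → m k = a ∨ m k = c)
    (hpath : ∀ v ∈ S, ∀ c, c ≠ a → D v c → ∀ m ∈ L v c, m ∉ S → ∀ u ∈ S, ∀ d, d ≠ a → d ≠ u k →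
      ¬ D u d → m = f.nb u d ∨ m = f.fl k (f.nb u d) → d = c)
    (hL : ∀ v ∈ S, ∀ c, c ≠ a → D v c → ∀ u ∈ S, ∀ d, d ≠ a → D u d →
      ∀ m ∈ L v c, m ∈ L u d → m ∉ S → c = d)
    (hlink : ∀ v ∈ S, ∀ c, c ≠ a → D v c → ∀ m ∈ insert v (L v c), ∃ r ∈ hub k (-ε) c,
      Relation.ReflTransGen
        (LinkAdj f.graph S (hub k (-ε) c ∪ (L v c \ S)) (fun _ _ => False)) m r) :
    HasPacking {c // c ≠ a} f.graph S := by
  have hεS : ∀ m, Perm.sign m = -ε → m ∉ S := by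
    intro m h1 h2
    have h3 := hS m h2
    rw [h1] at h3
    rcases Int.units_eq_one_or ε with h4 | h4 <;> rw [h4] at h3 <;> exact absurd h3 (by decide)
  let U : {c // c ≠ a} → Set (Perm α) := fun c => {m | m ∉ S ∧ (m ∈ hub k (-ε) c.1 ∨
    (∃ v ∈ S, ¬ D v c.1 ∧ c.1 ≠ v k ∧ (m = f.nb v c.1 ∨ m = f.fl k (f.nb v c.1))) ∨
    ∃ v ∈ S, D v c.1 ∧ m ∈ L v c.1)}
  let F : {c // c ≠ a} → Perm α → Perm α → Prop := fun c x y => ∃ v ∈ S, ¬ D v c.1 ∧ c.1 ≠ v k ∧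
    ((x = v ∧ y = f.nb v c.1) ∨ (x = f.nb v c.1 ∧ y = f.fl k (f.nb v c.1)))
  have hPk : ∀ v c, c ≠ v k → f.nb v c k = v k := by
    intro v c h
    rw [nb_high _ _ hk, if_neg h.symm]
  have hQk : ∀ v c, f.fl k (f.nb v c) k = c := by
    intro v c
    rw [fl_high _ hk, if_pos rfl, nb_t]
  have hQt : ∀ v c, c ≠ v k → f.fl k (f.nb v c) f.t = v k := by
    intro v c h
    rw [fl_t, hPk v c h]
  have hPQ : ∀ v ∈ S, ∀ u ∈ S, ∀ c d, c ≠ a → d ≠ a → c ≠ v k → d ≠ u k → ¬ D v c → ¬ D u d →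
      f.nb v c = f.fl k (f.nb u d) → False := by
    intro v hv u hu c d hc hd hcv hdu h1 h2 h3
    have e1 : c = u k := by rw [← hQt u d hdu, ← h3, nb_t]
    have e2 : v k = d := by rw [← hPk v c hcv, h3, hQk]
    have hne : v k ≠ u k := by rw [← e1]; exact hcv.symm
    have hcf : f.Conf k v u := by
      refine ⟨fun h => hne (by rw [h]), Or.inl ⟨hne, ?_⟩⟩
      rw [← e1, h3, fl_fl hk, e2]
    have l1 : f.lab k v u = c := by rw [lab, if_neg hne, e1]
    have l2 : f.lab k u v = d := by rw [lab, if_neg hne.symm, e2]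
    have := hconf v hv u hu hcf (by rw [l1]; exact hc) (by rw [l2]; exact hd)
    rw [l1, l2] at this
    exact this.elim h1 h2
  refine ⟨U, F, ?_, ?_, ?_, ?_⟩
  · rintro ⟨c, hc⟩ ⟨d, hd⟩ m hcd ⟨hmS, h1⟩ ⟨-, h2⟩
    have hcd : c ≠ d := fun h => hcd (Subtype.ext h)
    simp only at h1 h2
    have hsP : ∀ v ∈ S, ∀ c, (m = f.nb v c ∨ m = f.fl k (f.nb v c)) → Perm.sign m ≠ -ε := by
      intro v hv c h3 h4
      refine hεS m h4 ?_ |>.elim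
      exfalso
      have : Perm.sign m = ε := by
        rcases h3 with rfl | rfl
        · rw [sign_nb, hS v hv]
        · rw [sign_fl, sign_nb, hS v hv]
      rw [this] at h4
      exact hεS v (by rw [hS v hv]; exact h4) hv
    rcases h1 with h1 | ⟨v, hv, h1, hcv, h1'⟩ | ⟨v, hv, h1, h1'⟩ <;>
      rcases h2 with h2 | ⟨u, hu, h2, hdu, h2'⟩ | ⟨u, hu, h2, h2'⟩
    · exact hcd (h1.2.symm.trans h2.2)
    · exact hsP u hu d h2' h1.1
    · rcases hhub u hu d hd h2 m h2' h1.1 with h3 | h3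
      · exact hc (h1.2.symm.trans h3)
      · exact hcd (h1.2.symm.trans h3)
    · exact hsP v hv c h1' h2.1
    · rcases h1' with rfl | rfl <;> rcases h2' with h3 | h3
      · exact hcd (by rw [← nb_t (f := f) v c, h3, nb_t])
      · exact hPQ v hv u hu c d hc hd hcv hdu h1 h2 h3
      · exact hPQ u hu v hv d c hd hc hdu hcv h2 h1 h3.symm
      · exact hcd (by rw [← hQk v c, h3, hQk])
    · exact hcd (hpath u hu d hd h2 m h2' hmS v hv c hc hcv h1 h1')
    · rcases hhub v hv c hc h1 m h1' h2.1 with h3 | h3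
      · exact hd (h2.2.symm.trans h3)
      · exact hcd (h3.symm.trans h2.2)
    · exact hcd (hpath v hv c hc h1 m h1' hmS u hu d hd hdu h2 h2').symm
    · exact hcd (hL v hv c hc h1 u hu d hd h2 m h1' h2' hmS)
  · rintro c m h1 ⟨h2, -⟩
    exact h2 h1
  · rintro ⟨c, hc⟩ ⟨d, hd⟩ x y hcd hx hy ⟨v, hv, h1, hcv, h1'⟩
    simp only at h1 hcv h1'
    have hcd : c ≠ d := fun h => hcd (Subtype.ext h)
    constructor
    · rintro ⟨u, hu, h2, hdu, h2'⟩
      simp only at h2 hdu h2'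
      rcases h1' with ⟨rfl, rfl⟩ | ⟨rfl, rfl⟩ <;> rcases h2' with ⟨h3, h4⟩ | ⟨h3, h4⟩
      · exact hcd (by rw [← nb_t (f := f) x c, h4, nb_t])
      · have e1 := hPk x c hcv
        rw [h4, hQk] at e1
        have e2 := hPk u d hdu
        rw [← h3] at e2
        exact hdu (e1.trans e2)
      · have e1 := hPk u d hdu
        rw [← h4, hQk] at e1
        have e2 := hPk v c hcv
        rw [h3] at e2
        exact hcv (e1.trans e2)
      · exact hcd (by rw [← nb_t (f := f) v c, h3, nb_t])
    · rintro ⟨u, hu, h2, hdu, h2'⟩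
      simp only at h2 hdu h2'
      rcases h1' with ⟨rfl, rfl⟩ | ⟨rfl, rfl⟩ <;> rcases h2' with ⟨h3, h4⟩ | ⟨h3, h4⟩
      · -- both edges inside a cluster
        have e1 : d = x f.t := by rw [h4, nb_t]
        have e2 : c = u f.t := by rw [← h3, nb_t]
        have e3 : x k = u k := by rw [← h3, hPk x c hcv]
        by_cases hxu : x = u
        · exact hcd (by rw [e1, e2, hxu])
        have hcf : f.Conf k x u := ⟨hxu, Or.inr ⟨e3, by rw [← e2, h3]⟩⟩
        have l1 : f.lab k x u = c := by rw [lab, if_pos e3, e2]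
        have l2 : f.lab k u x = d := by rw [lab, if_pos e3.symm, e1]
        have := hconf x hv u hu hcf (by rw [l1]; exact hc) (by rw [l2]; exact hd)
        rw [l1, l2] at this
        exact this.elim h1 h2
      · have e1 := hPk x c hcv
        rw [h3] at e1
        have e2 := hQk u d
        rw [← h4] at e2
        exact hdu ((e2.symm.trans e1.symm).trans (hPk u d hdu))
      · have e1 := hPk u d hdu
        rw [← h4, hPk v c hcv, ← h3, hQk] at e1
        exact hcv e1.symm
      · exact hPQ v hv u hu c d hc hd hcv hdu h1 h2 h4
  · rintro ⟨c, hc⟩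
    have hsub : hub k (-ε) c ⊆ U ⟨c, hc⟩ := fun m hm => ⟨hεS m hm.1, Or.inl hm⟩
    have hhubne : ∃ r, r ∈ hub k (-ε) c := by
      obtain ⟨v, hv⟩ := hne
      by_cases h : v k = c
      · exact ⟨f.mate v, by simp [hS v hv], by rw [mate_high _ hk, h]⟩
      · exact ⟨f.mate (f.fl k (f.nb v c)), by simp [hS v hv], by rw [mate_high _ hk, hQk]⟩
    obtain ⟨r, hr⟩ := hhubne
    have hhubr : ∀ m ∈ hub k (-ε) c,
        Relation.ReflTransGen (LinkAdj f.graph S (U ⟨c, hc⟩) (F ⟨c, hc⟩)) m r := by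
      intro m hm
      have := hub_connected (f := f) hk (m := m) (m' := r) (hm.1.trans hr.1.symm)
        (hm.2.trans hr.2.symm)
      refine this.lift id ?_
      rintro x y ⟨h1, h2, h3⟩
      rw [hr.1, hr.2] at h2 h3
      exact ⟨h1, Or.inr (hsub h2), Or.inr (hsub h3), Or.inl (hsub h2)⟩
    refine ⟨r, ?_⟩
    have hact : ∀ v ∈ S, ¬ D v c → ∀ m, (m = v ∨ (c ≠ v k ∧
        (m = f.nb v c ∨ m = f.fl k (f.nb v c)))) →
        Relation.ReflTransGen (LinkAdj f.graph S (U ⟨c, hc⟩) (F ⟨c, hc⟩)) m r := by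
      intro v hv hD
      by_cases hcv : c = v k
      · rintro m (rfl | ⟨h, -⟩)
        · have h1 : f.mate m ∈ hub k (-ε) c := ⟨by simp [hS m hv], by rw [mate_high _ hk, hcv]⟩
          refine (Relation.ReflTransGen.single ?_).trans (hhubr _ h1)
          exact ⟨adj_mate m, Or.inl hv, Or.inr (hsub h1), Or.inr (Or.inl (hsub h1))⟩
        · exact absurd hcv h
      · have hmem : ∀ m, (m = f.nb v c ∨ m = f.fl k (f.nb v c)) → m ∈ S ∨ m ∈ U ⟨c, hc⟩ := by
          intro m hm
          by_cases h : m ∈ S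
          · exact Or.inl h
          · exact Or.inr ⟨h, Or.inr (Or.inl ⟨v, hv, hD, hcv, hm⟩)⟩
        have hQ : Relation.ReflTransGen (LinkAdj f.graph S (U ⟨c, hc⟩) (F ⟨c, hc⟩))
            (f.fl k (f.nb v c)) r := by
          have h1 : f.mate (f.fl k (f.nb v c)) ∈ hub k (-ε) c :=
            ⟨by simp [hS v hv], by rw [mate_high _ hk, hQk]⟩
          refine (Relation.ReflTransGen.single ?_).trans (hhubr _ h1)
          exact ⟨adj_mate _, hmem _ (Or.inr rfl), Or.inr (hsub h1), Or.inr (Or.inl (hsub h1))⟩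
        have hP : Relation.ReflTransGen (LinkAdj f.graph S (U ⟨c, hc⟩) (F ⟨c, hc⟩))
            (f.nb v c) r := by
          refine (Relation.ReflTransGen.single ?_).trans hQ
          exact ⟨adj_fl hk _, hmem _ (Or.inl rfl), hmem _ (Or.inr rfl),
            Or.inr (Or.inr (Or.inl ⟨v, hv, hD, hcv, Or.inr ⟨rfl, rfl⟩⟩))⟩
        rintro m (rfl | ⟨-, rfl | rfl⟩)
        · by_cases h : c = m f.t
          · rwa [nb_eq_self.mpr h] at hP
          · refine (Relation.ReflTransGen.single ?_).trans hP
            exact ⟨adj_nb h, Or.inl hv, hmem _ (Or.inl rfl),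
              Or.inr (Or.inr (Or.inl ⟨m, hv, hD, hcv, Or.inl ⟨rfl, rfl⟩⟩))⟩
        · exact hP
        · exact hQ
    have hdet : ∀ v ∈ S, D v c → ∀ m ∈ insert v (L v c),
        Relation.ReflTransGen (LinkAdj f.graph S (U ⟨c, hc⟩) (F ⟨c, hc⟩)) m r := by
      intro v hv hD m hm
      obtain ⟨r', hr', h⟩ := hlink v hv c hc hD m hm
      refine Relation.ReflTransGen.trans (h.lift id ?_) (hhubr r' hr')
      intro x y hxy
      refine hxy.mono ?_ fun _ _ => False.elim
      rintro z (hz | ⟨hz, hzS⟩)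
      · exact hsub hz
      · exact ⟨hzS, Or.inr (Or.inr ⟨v, hv, hD, hz⟩)⟩
    rintro m (hm | ⟨-, hm | ⟨v, hv, hD, hcv, hm⟩ | ⟨v, hv, hD, hm⟩⟩)
    · by_cases hD : D m c
      · exact hdet m hm hD m (Set.mem_insert _ _)
      · exact hact m hm hD m (Or.inl rfl)
    · exact hhubr m hm
    · exact hact v hv hD m (Or.inr ⟨hcv, hm⟩)
    · exact hdet v hv hD m (Set.mem_insert_of_mem _ hm)

end Frame

namespace Frame

variable {α : Type*} [DecidableEq α] [Fintype α] {f : Frame α}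

lemma ne_of_sign_neg {ε : ℤˣ} {u v : Perm α} (hu : Perm.sign u = ε) (hv : Perm.sign v = -ε) :
    u ≠ v := by
  rintro rfl
  rw [hu] at hv
  rcases Int.units_eq_one_or ε with h4 | h4 <;> rw [h4] at hv <;> exact absurd hv (by decide)

lemma mate_injective : Function.Injective f.mate := fun u v h => by
  rw [← mate_mate (f := f) u, h, mate_mate]

lemma fl_nb_k {k : α} (hk : f.High k) (v : Perm α) (c : α) : f.fl k (f.nb v c) k = c := by
  rw [fl_high _ hk, if_pos rfl, nb_t]

lemma nb_k {k : α} (hk : f.High k) {v : Perm α} {c : α} (h : c ≠ v k) : f.nb v c k = v k := by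
  rw [nb_high _ _ hk, if_neg h.symm]

lemma fl_nb_t {k : α} (hk : f.High k) {v : Perm α} {c : α} (h : c ≠ v k) :
    f.fl k (f.nb v c) f.t = v k := by
  rw [fl_t, nb_k hk h]

lemma conf_of_fl_nb {k : α} (hk : f.High k) {v u : Perm α} {c d : α} (hc : c ≠ v k) (hd : d ≠ u k)
    (h : f.fl k (f.nb v c) = f.nb u d) : f.Conf k v u := by
  have e1 : u k = c := by rw [← nb_k hk hd, ← h, fl_nb_k hk]
  have e2 : d = v k := by rw [← nb_t (f := f) u d, ← h, fl_nb_t hk hc]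
  have hne : v k ≠ u k := by rw [e1]; exact hc.symm
  exact ⟨fun h => hne (by rw [h]), Or.inl ⟨hne, by rw [e1, h, e2]⟩⟩

lemma conf_fl_nb {k : α} (hk : f.High k) {v : Perm α} {c : α} (hc : c ≠ v k) :
    f.Conf k v (f.fl k (f.nb v c)) := by
  refine conf_of_fl_nb hk hc (d := v k) ?_ ?_
  · rw [fl_nb_k hk]; exact hc.symm
  · rw [nb_eq_self.mpr (fl_nb_t hk hc).symm]

lemma linkAdj_of_mem_right {S U : Set (Perm α)} {a b : Perm α} (h : f.graph.Adj a b)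
    (ha : a ∈ S ∪ U) (hb : b ∈ U) : LinkAdj f.graph S U (fun _ _ => False) a b :=
  ⟨h, ha, Or.inr hb, Or.inr (Or.inl hb)⟩

/-- Packing when the value `a` is dropped: all conflicts within the cluster of `a` involve `y`,
and the only conflict away from that cluster can be resolved by a detour for `(w, h)`. -/
theorem hasPacking_of_center {k : α} (hk : f.High k) (a : α) {ε : ℤˣ} {S : Set (Perm α)}
    (hne : S.Nonempty) (hS : ∀ v ∈ S, Perm.sign v = ε) (y w : Perm α) (h : α)
    (hyS : y ∈ S) (hya : y k = a) (hwa : h ≠ a → w ∈ S ∧ w k ≠ a ∧ h ≠ w k)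
    (hfree : h ≠ a → ∀ u ∈ S, u k = a → ¬ f.Conf k w u)
    (hout : ∀ v ∈ S, ∀ u ∈ S, f.Conf k v u → v k ≠ a → u k ≠ a →
      (v = w ∧ f.lab k v u = h) ∨ (u = w ∧ f.lab k u v = h))
    (hin : ∀ v ∈ S, ∀ u ∈ S, f.Conf k v u → v k = a → u k = a → v = y ∨ u = y)
    (hcenter : h ≠ a → ∀ e ∈ S, e k = a →
      f.nb (f.mate (f.fl k (f.nb w a))) h = f.mate e → e = y) :
    HasPacking {c // c ≠ a} f.graph S := by
  classical
  have hεS : ∀ m, Perm.sign m = -ε → m ∉ S := fun m h1 h2 => ne_of_sign_neg (hS m h2) h1 rfl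
  let L : Perm α → α → Set (Perm α) := fun v c => if v k = a then {f.mate v, f.mate y} else
    {f.nb v a, f.fl k (f.nb v a), f.mate (f.fl k (f.nb v a)),
      f.nb (f.mate (f.fl k (f.nb v a))) c}
  let D : Perm α → α → Prop := fun v c => (v = w ∧ c = h) ∨
    (v k = a ∧ f.Conf k v y ∧ c = y f.t)
  have hD : ∀ v ∈ S, ∀ c, c ≠ a → D v c → (v = w ∧ c = h ∧ v k ≠ a ∧ h ≠ a ∧ h ≠ w k ∧
      L v c = {f.nb v a, f.fl k (f.nb v a), f.mate (f.fl k (f.nb v a)),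
      f.nb (f.mate (f.fl k (f.nb v a))) c}) ∨ (v k = a ∧ f.Conf k v y ∧ c = y f.t ∧
      L v c = {f.mate v, f.mate y}) := by
    rintro v hv c hc (⟨h1, h2⟩ | ⟨h1, h2, h3⟩)
    · subst h1; subst h2
      exact Or.inl ⟨rfl, rfl, (hwa hc).2.1, hc, (hwa hc).2.2, if_neg (hwa hc).2.1⟩
    · exact Or.inr ⟨h1, h2, h3, if_pos h1⟩
  have hwQ : ∀ u ∈ S, ∀ d, h ≠ a → d ≠ u k → f.fl k (f.nb w a) = f.nb u d → False := by
    intro u hu d ha hd h1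
    have h2 := conf_of_fl_nb hk (hwa ha).2.1.symm hd h1
    refine hfree ha u hu ?_ h2
    rw [← nb_k hk hd, ← h1, fl_nb_k hk]
  have hwQS : h ≠ a → f.fl k (f.nb w a) ∉ S := by
    intro ha h1
    exact hfree ha _ h1 (fl_nb_k hk _ _) (conf_fl_nb hk (hwa ha).2.1.symm)
  have hLL : ∀ u ∈ S, u k = a → h ≠ a → ∀ m,
      (m = f.nb w a ∨ m = f.fl k (f.nb w a) ∨ m = f.mate (f.fl k (f.nb w a)) ∨
      m = f.nb (f.mate (f.fl k (f.nb w a))) h) → (m = f.mate u ∨ m = f.mate y) →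
      h = y f.t := by
    rintro u hu hua ha m h1 h2
    obtain ⟨e, he, hea, h2⟩ : ∃ e ∈ S, e k = a ∧ m = f.mate e := by
      rcases h2 with h2 | h2
      · exact ⟨u, hu, hua, h2⟩
      · exact ⟨y, hyS, hya, h2⟩
    subst h2
    have hse : Perm.sign (f.mate e) = -ε := by rw [sign_mate, hS e he]
    have hsw := hS w (hwa ha).1
    rcases h1 with h1 | h1 | h1 | h1
    · exact absurd h1.symm (ne_of_sign_neg (by simp [hsw]) hse)
    · exact absurd h1.symm (ne_of_sign_neg (by simp [hsw]) hse)
    · exact absurd (mate_injective h1 ▸ he) (hwQS ha)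
    · have := hcenter ha e he hea h1.symm
      rw [← this, ← mate_t (f := f) e, h1, nb_t]
  refine hasPacking_of_detours hk a hne hS D L ?_ ?_ ?_ ?_ ?_
  · intro v hv u hu hcf l1 l2
    by_cases h1 : v k = a
    · by_cases h2 : u k = a
      · rcases hin v hv u hu hcf h1 h2 with rfl | rfl
        · right; right
          exact ⟨h2, hcf.symm hk, by rw [lab, if_pos (h2.trans h1.symm)]⟩
        · left; right
          exact ⟨h1, hcf, by rw [lab, if_pos (h1.trans h2.symm)]⟩
      · exfalso; apply l2
        rw [lab, if_neg, h1]
        rw [h1]; exact h2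
    · by_cases h2 : u k = a
      · exfalso; apply l1
        rw [lab, if_neg, h2]
        rw [h2]; exact h1
      · rcases hout v hv u hu hcf h1 h2 with ⟨h3, h4⟩ | ⟨h3, h4⟩
        · exact Or.inl (Or.inl ⟨h3, h4⟩)
        · exact Or.inr (Or.inl ⟨h3, h4⟩)
  · intro v hv c hc hd m hm hsm
    left
    rcases hD v hv c hc hd with ⟨rfl, rfl, h1, -, h2, h3⟩ | ⟨h1, -, -, h3⟩
    · rw [h3] at hm
      rcases hm with rfl | rfl | rfl | rfl
      · exact absurd hsm fun h => ne_of_sign_neg (hS v hv) (by simpa using h) rfl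
      · exact absurd hsm fun h => ne_of_sign_neg (hS v hv) (by simpa using h) rfl
      · rw [mate_high _ hk, fl_nb_k hk]
      · rw [nb_k hk, mate_high _ hk, fl_nb_k hk]
        rw [mate_high _ hk, fl_nb_k hk]; exact hc
    · rw [h3] at hm
      rcases hm with rfl | rfl
      · rw [mate_high _ hk, h1]
      · rw [mate_high _ hk, hya]
  · intro v hv c hc hd m hm hmS u hu d hda hdu hnd hmu
    have hsm : Perm.sign m = ε := by rcases hmu with rfl | rfl <;> simp [hS u hu]
    exfalso
    rcases hD v hv c hc hd with ⟨rfl, rfl, h1, -, h2, h3⟩ | ⟨h1, -, -, h3⟩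
    · rw [h3] at hm
      rcases hm with rfl | rfl | rfl | rfl
      · rcases hmu with h4 | h4
        · exact hda (by rw [← nb_t (f := f) u d, ← h4, nb_t])
        · exact hwQ u hu d hc hdu (by rw [h4, fl_fl hk])
      · rcases hmu with h4 | h4
        · exact hwQ u hu d hc hdu h4
        · exact hda (by rw [← fl_nb_k hk u d, ← h4, fl_nb_k hk])
      · exact ne_of_sign_neg hsm (by simp [hS v hv]) rfl
      · exact ne_of_sign_neg hsm (by simp [hS v hv]) rfl
    · rw [h3] at hm
      rcases hm with rfl | rfl
      · exact ne_of_sign_neg hsm (by simp [hS v hv]) rfl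
      · exact ne_of_sign_neg hsm (by simp [hS y hyS]) rfl
  · intro v hv c hc hd u hu d hda hd' m hm hm' hmS
    rcases hD v hv c hc hd with ⟨rfl, rfl, h1, -, h2, h3⟩ | ⟨h1, -, rfl, h3⟩ <;>
      rcases hD u hu d hda hd' with ⟨rfl, rfl, h1', -, h2', h3'⟩ | ⟨h1', -, rfl, h3'⟩
    · rfl
    · rw [h3] at hm
      rw [h3'] at hm'
      exact hLL u hu h1' hc m hm hm'
    · rw [h3] at hm
      rw [h3'] at hm'
      exact (hLL v hv h1 hda m hm' hm).symm
    · rfl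
  · intro v hv c hc hd m hm
    rcases hD v hv c hc hd with ⟨rfl, rfl, h1, -, h2, h3⟩ | ⟨h1, hcf, rfl, h3⟩
    · have hQS := hwQS hc
      have hPS : f.nb v a ≠ v → f.nb v a ∉ S := by
        intro hne hP
        have h4 : f.nb v a k = v k := nb_k hk (Ne.symm h1)
        have hcf : f.Conf k v (f.nb v a) := ⟨hne.symm, Or.inr ⟨h4.symm, by rw [nb_t]⟩⟩
        have := hout v hv _ hP hcf h1 (by rw [h4]; exact h1)
        rcases this with ⟨-, h5⟩ | ⟨h5, -⟩
        · rw [lab, if_pos h4.symm, nb_t] at h5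
          exact hc h5.symm
        · exact hne h5
      have hsQ : Perm.sign (f.mate (f.fl k (f.nb v a))) = -ε := by simp [hS v hv]
      have hmQ := hεS _ hsQ
      have hsg : Perm.sign (f.nb (f.mate (f.fl k (f.nb v a))) c) = -ε := by simp [hS v hv]
      have hg := hεS _ hsg
      rw [h3] at hm ⊢
      set P := f.nb v a with hP
      set Q := f.fl k P with hQ
      set g := f.nb (f.mate Q) c with hgdef
      set U := hub k (-ε) c ∪ (({P, Q, f.mate Q, g} : Set (Perm α)) \ S) with hU
      have hflg : f.fl k g ∈ hub k (-ε) c := ⟨by simp [hsg], by rw [hgdef, fl_nb_k hk]⟩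
      have uflg : f.fl k g ∈ U := Or.inl hflg
      have ug : g ∈ U := Or.inr ⟨by simp, hg⟩
      have umQ : f.mate Q ∈ U := Or.inr ⟨by simp, hmQ⟩
      have uQ : Q ∈ U := Or.inr ⟨by simp, hQS⟩
      refine ⟨f.fl k g, hflg, ?_⟩
      have rg : Relation.ReflTransGen (LinkAdj f.graph S U fun _ _ => False) g (f.fl k g) :=
        .single (linkAdj_of_mem_right (adj_fl hk _) (Or.inr ug) uflg)
      have rmQ : Relation.ReflTransGen (LinkAdj f.graph S U fun _ _ => False)
          (f.mate Q) (f.fl k g) := by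
        by_cases h5 : c = f.mate Q f.t
        · have : g = f.mate Q := nb_eq_self.mpr h5
          rwa [this] at rg ⊢
        · exact .head (linkAdj_of_mem_right (adj_nb h5) (Or.inr umQ) ug) rg
      have rQ : Relation.ReflTransGen (LinkAdj f.graph S U fun _ _ => False) Q (f.fl k g) :=
        .head (linkAdj_of_mem_right (adj_mate _) (Or.inr uQ) umQ) rmQ
      by_cases h6 : P = v
      · have rP : Relation.ReflTransGen (LinkAdj f.graph S U fun _ _ => False) P (f.fl k g) :=
          .head (linkAdj_of_mem_right (adj_fl hk _) (Or.inl (h6 ▸ hv)) uQ) rQ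
        rcases hm with hm | hm | hm | hm | hm <;> rw [hm]
        · rwa [← h6]
        · exact rP
        · exact rQ
        · exact rmQ
        · exact rg
      · have uP : P ∈ U := Or.inr ⟨by simp, hPS h6⟩
        have rP : Relation.ReflTransGen (LinkAdj f.graph S U fun _ _ => False) P (f.fl k g) :=
          .head (linkAdj_of_mem_right (adj_fl hk _) (Or.inr uP) uQ) rQ
        rcases hm with hm | hm | hm | hm | hm <;> rw [hm]
        · exact .head (linkAdj_of_mem_right (adj_nb fun h => h6 (nb_eq_self.mpr h))
            (Or.inl hv) uP) rP
        · exact rP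
        · exact rQ
        · exact rmQ
        · exact rg
    · rw [h3] at hm ⊢
      set U := hub k (-ε) (y f.t) ∪ (({f.mate v, f.mate y} : Set (Perm α)) \ S) with hU
      have hyt : f.fl k (f.mate y) ∈ hub k (-ε) (y f.t) :=
        ⟨by simp [hS y hyS], by rw [fl_high _ hk, if_pos rfl, mate_t]⟩
      have umy : f.mate y ∈ U := Or.inr ⟨by simp, hεS _ (by simp [hS y hyS])⟩
      have umv : f.mate v ∈ U := Or.inr ⟨by simp, hεS _ (by simp [hS v hv])⟩
      refine ⟨f.fl k (f.mate y), hyt, ?_⟩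
      have ry : Relation.ReflTransGen (LinkAdj f.graph S U fun _ _ => False) (f.mate y)
          (f.fl k (f.mate y)) :=
        .single (linkAdj_of_mem_right (adj_fl hk _) (Or.inr umy) (Or.inl hyt))
      have hvy : f.nb v (y f.t) = y := by
        rcases hcf.2 with h5 | h5
        · exact absurd (h1.trans hya.symm) h5.1
        · exact h5.2
      have hadj : f.graph.Adj (f.mate v) (f.mate y) := by
        have h6 := adj_nb (f := f) (v := f.mate v) (c := y f.t) (by
          rw [mate_t]; intro h7; exact hcf.1 (hvy ▸ (nb_eq_self.mpr h7).symm))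
        rwa [nb_mate, hvy] at h6
      have rv : Relation.ReflTransGen (LinkAdj f.graph S U fun _ _ => False) (f.mate v)
          (f.fl k (f.mate y)) :=
        .head (linkAdj_of_mem_right hadj (Or.inr umv) umy) ry
      rcases hm with hm | hm | hm <;> rw [hm]
      · exact .head (linkAdj_of_mem_right (adj_mate _) (Or.inl hv) umv) rv
      · exact rv
      · exact ry

/-- Packing when the cluster of `a` consists of three permutations in pairwise conflict. -/
theorem hasPacking_of_triangle {k i : α} (hk : f.High k) (hi : f.High i) (hik : i ≠ k) (a : α)
    {ε : ℤˣ} {S : Set (Perm α)} (hS : ∀ v ∈ S, Perm.sign v = ε) {x y z : Perm α}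
    (hx : x ∈ S) (hy : y ∈ S) (hz : z ∈ S) (hxa : x k = a) (hya : y k = a) (hza : z k = a)
    (hxy : f.Conf k x y) (hxz : f.Conf k x z) (hyz : f.Conf k y z)
    (hin : ∀ v ∈ S, v k = a → v = x ∨ v = y ∨ v = z)
    (hout : ∀ v ∈ S, ∀ u ∈ S, f.Conf k v u → v k = a ∨ u k = a) :
    HasPacking {c // c ≠ a} f.graph S := by
  have hεS : ∀ m, Perm.sign m = -ε → m ∉ S := fun m h1 h2 => ne_of_sign_neg (hS m h2) h1 rfl
  have hnb : ∀ {u v : Perm α}, f.Conf k u v → u k = a → v k = a →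
      f.nb u (v f.t) = v ∧ u f.t ≠ v f.t ∧ (v i = if u i = v f.t then u f.t else u i) := by
    intro u v h h1 h2
    obtain ⟨h3, h4⟩ := h
    have h5 : f.nb u (v f.t) = v := by
      rcases h4 with h4 | h4
      · exact absurd (h1.trans h2.symm) h4.1
      · exact h4.2
    refine ⟨h5, fun h6 => h3 (h5 ▸ (nb_eq_self.mpr h6.symm).symm), ?_⟩
    nth_rewrite 1 [← h5]
    rw [nb_high _ _ hi]
  obtain ⟨nxy, txy, ixy⟩ := hnb hxy hxa hya
  obtain ⟨nxz, txz, ixz⟩ := hnb hxz hxa hza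
  obtain ⟨nyz, tyz, iyz⟩ := hnb hyz hya hza
  have hti : ∀ v : Perm α, v f.t ≠ v i := fun v h => hi.2.2 (v.injective h).symm
  have htk : ∀ v : Perm α, v f.t ≠ v k := fun v h => hk.2.2 (v.injective h).symm
  have hki : ∀ v : Perm α, v i ≠ v k := fun v h => hik (v.injective h)
  obtain ⟨b, hb⟩ : ∃ b, b = x i := ⟨_, rfl⟩
  have e2 : y i = b := by have := hti x; have := hti y; have := hti z; grind
  have e3 : z i = b := by have := hti x; have := hti y; have := hti z; grind
  let D : Perm α → α → Prop := fun v c =>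
    (v = x ∧ c = z f.t) ∨ (v = y ∧ c = x f.t) ∨ (v = z ∧ c = y f.t)
  let L : Perm α → α → Set (Perm α) := fun v c =>
    {f.mate v, f.nb (f.mate v) b, f.nb (f.nb (f.mate v) b) c}
  have hD : ∀ v c, D v c → v ∈ S ∧ v k = a ∧ v i = b ∧ c ≠ a ∧ c ≠ v f.t ∧ c ≠ b := by
    have := htk x; have := htk y; have := htk z
    have := hti x; have := hti y; have := hti z
    rintro v c (⟨rfl, rfl⟩ | ⟨rfl, rfl⟩ | ⟨rfl, rfl⟩) <;> grind
  have hsL : ∀ v c, D v c → ∀ m ∈ L v c, Perm.sign m = -ε := by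
    rintro v c hd m (rfl | rfl | rfl) <;> simp [hS v (hD v c hd).1]
  have hval : ∀ v c, D v c → ∀ m ∈ L v c, m k = a ∧ ((m f.t = v f.t ∧ m i = b) ∨
      (m f.t = b ∧ m i = v f.t) ∨ (m f.t = c ∧ m i = v f.t)) := by
    intro v c hd m hm
    obtain ⟨-, h1, h2, h3, h4, h5⟩ := hD v c hd
    have hba : b ≠ a := by rw [← h1, ← h2]; exact hki v
    rcases hm with rfl | rfl | rfl
    · simp [mate_high _ hk, mate_high _ hi, h1, h2]
    · simp [nb_high _ _ hk, nb_high _ _ hi, mate_high _ hk, mate_high _ hi, h1, h2, hba.symm]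
    · simp [nb_high _ _ hk, nb_high _ _ hi, mate_high _ hk, mate_high _ hi, h1, h2, hba.symm,
        h3.symm, h4.symm]
  refine hasPacking_of_detours hk a ⟨x, hx⟩ hS D L ?_ ?_ ?_ ?_ ?_
  · intro v hv u hu hcf l1 l2
    have h12 : v k = a ∧ u k = a := by
      rcases hout v hv u hu hcf with h1 | h1
      · refine ⟨h1, ?_⟩
        by_contra h2
        apply l2
        rw [lab, if_neg, h1]; rw [h1]; exact h2
      · refine ⟨?_, h1⟩
        by_contra h2
        apply l1
        rw [lab, if_neg, h1]; rw [h1]; exact h2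
    rw [lab, lab, if_pos (h12.1.trans h12.2.symm), if_pos (h12.2.trans h12.1.symm)]
    have hvu := hcf.1
    have d1 : D x (z f.t) := Or.inl ⟨rfl, rfl⟩
    have d2 : D y (x f.t) := Or.inr (Or.inl ⟨rfl, rfl⟩)
    have d3 : D z (y f.t) := Or.inr (Or.inr ⟨rfl, rfl⟩)
    clear_value D
    rcases hin v hv h12.1 with rfl | rfl | rfl <;> rcases hin u hu h12.2 with rfl | rfl | rfl <;>
      first
      | exact absurd rfl hvu
      | exact Or.inl d1
      | exact Or.inl d2
      | exact Or.inl d3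
      | exact Or.inr d1
      | exact Or.inr d2
      | exact Or.inr d3
  · intro v hv c hc hd m hm _
    exact Or.inl (hval v c hd m hm).1
  · intro v hv c hc hd m hm hmS u hu d _ _ _ hmu
    exfalso
    refine ne_of_sign_neg ?_ (hsL v c hd m hm) rfl
    rcases hmu with rfl | rfl <;> simp [hS u hu]
  · intro v hv c hc hd u hu d hda hd' m hm hm' _
    have h1 := (hval v c hd m hm).2
    have h2 := (hval u d hd' m hm').2
    have := hti x; have := hti y; have := hti z
    rcases hd with ⟨rfl, rfl⟩ | ⟨rfl, rfl⟩ | ⟨rfl, rfl⟩ <;>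
      rcases hd' with ⟨h3, h4⟩ | ⟨h3, h4⟩ | ⟨h3, h4⟩ <;> subst h4 <;> grind
  · intro v hv c hc hd m hm
    obtain ⟨-, h1, h2, h3, h4, h5⟩ := hD v c hd
    have hsm := hsL v c hd
    set U := hub k (-ε) c ∪ (L v c \ S) with hU
    have hmU : ∀ m ∈ L v c, m ∈ U := fun m hm => Or.inr ⟨hm, hεS m (hsm m hm)⟩
    have u1 : f.mate v ∈ U := hmU _ (by simp [L])
    have u2 : f.nb (f.mate v) b ∈ U := hmU _ (by simp [L])
    have u3 : f.nb (f.nb (f.mate v) b) c ∈ U := hmU _ (by simp [L])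
    have hr : f.fl k (f.nb (f.nb (f.mate v) b) c) ∈ hub k (-ε) c :=
      ⟨by simp [hS v hv], fl_nb_k hk _ _⟩
    refine ⟨_, hr, ?_⟩
    have r3 := Relation.ReflTransGen.single
      (linkAdj_of_mem_right (S := S) (adj_fl hk (f.nb (f.nb (f.mate v) b) c)) (Or.inr u3)
        (Or.inl hr : _ ∈ U))
    have r2 := Relation.ReflTransGen.head (linkAdj_of_mem_right (S := S)
      (adj_nb (f := f) (v := f.nb (f.mate v) b) (c := c) (by rwa [nb_t])) (Or.inr u2) u3) r3
    have r1 := Relation.ReflTransGen.head (linkAdj_of_mem_right (S := S)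
      (adj_nb (f := f) (v := f.mate v) (c := b) (by rw [mate_t, ← h2]; exact (hti v).symm))
      (Or.inr u1) u2) r2
    rcases hm with rfl | rfl | rfl | rfl
    · exact .head (linkAdj_of_mem_right (adj_mate _) (Or.inl hv) u1) r1
    · exact r1
    · exact r2
    · exact r3

end Frame

/-- Indices for four vertices. -/
inductive Four
  | a | b | c | d
  deriving DecidableEq

namespace Four

instance : Fintype Four := ⟨{a, b, c, d}, fun x => by cases x <;> simp⟩

/-- Boolean universal quantifier. -/
def all (p : Four → Bool) : Bool := p a && p b && p c && p d

/-- Boolean existential quantifier. -/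
def any (p : Four → Bool) : Bool := p a || p b || p c || p d

lemma all_iff {p : Four → Bool} : all p = true ↔ ∀ i, p i = true := by
  simp only [all, Bool.and_eq_true]
  exact ⟨fun h i => by cases i <;> tauto, fun h => ⟨⟨⟨h _, h _⟩, h _⟩, h _⟩⟩

lemma any_iff {p : Four → Bool} : any p = true ↔ ∃ i, p i = true := by
  simp only [any, Bool.or_eq_true]
  exact ⟨by rintro (((h | h) | h) | h) <;> exact ⟨_, h⟩, fun ⟨i, h⟩ => by cases i <;> tauto⟩

/-- Boolean equality test. -/
def same : Four → Four → Bool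
  | a, a | b, b | c, c | d, d => true
  | _, _ => false

lemma same_iff {i j : Four} : same i j = true ↔ i = j := by cases i <;> cases j <;> simp [same]

/-- The symmetric relation with the given diagonal value and off-diagonal entries. -/
def pairs (r ab ac ad bc bd cd : Bool) : Four → Four → Bool
  | a, a | b, b | c, c | d, d => r
  | a, b | b, a => ab
  | a, c | c, a => ac
  | a, d | d, a => ad
  | b, c | c, b => bc
  | b, d | d, b => bd
  | c, d | d, c => cd

lemma eq_pairs {r : Bool} {R : Four → Four → Bool} (hd : ∀ i, R i i = r)
    (hs : ∀ i j, R i j = R j i) :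
    R = pairs r (R a b) (R a c) (R a d) (R b c) (R b d) (R c d) := by
  funext i j
  cases i <;> cases j <;> first | exact hd _ | rfl | exact hs _ _

/-- Three elements of pairwise different clusters in pairwise conflict, or a cycle of four
conflicts whose opposite members lie in different clusters. -/
def bad (e c : Four → Four → Bool) : Bool :=
  any fun x => any fun y => c x y && any fun z => c y z && !e x z &&
    ((c x z && !e x y && !e y z) || any fun w => c z w && c w x && !e y w)

/-- A cluster meeting all conflicts. -/
def covering (e c : Four → Four → Bool) : Bool :=
  any fun y => all fun i => all fun j => !c i j ||
    ((e i y || e j y) && (!e i y || !e j y || same i y || same j y))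

/-- A cluster meeting all conflicts except one. -/
def almostCovering (e c : Four → Four → Bool) : Bool :=
  any fun w => any fun s => c w s && any fun y => !e w y && !e s y &&
    (all fun u => !e u y || !c w u) &&
    all fun i => all fun j => !c i j ||
      ((e i y || e j y || (same i w && same j s) || (same i s && same j w)) &&
        (!e i y || !e j y || all fun y' => !e y' y || same i y' || same j y'))

/-- A cluster of three elements in pairwise conflict. -/
def triangle (e c : Four → Four → Bool) : Bool :=
  any fun x => any fun y => e y x && c x y && any fun z => e z x && c x z && c y z &&
    (all fun v => !e v x || same v x || same v y || same v z) &&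
    all fun i => all fun j => !c i j || e i x || e j x

/-- Boolean quantifier over all pairs of values. -/
def forallBool (p : Bool → Bool) : Bool := p true && p false

lemma forallBool_iff {p : Bool → Bool} : forallBool p = true ↔ ∀ i, p i = true := by
  simp only [forallBool, Bool.and_eq_true]
  exact ⟨fun h i => by cases i <;> tauto, fun h => ⟨h _, h _⟩⟩

/-- Boolean quantifier over all symmetric relations with constant diagonal. -/
def forallPairs (r : Bool) (p : (Four → Four → Bool) → Bool) : Bool :=
  forallBool fun x₁ => forallBool fun x₂ => forallBool fun x₃ => forallBool fun x₄ =>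
    forallBool fun x₅ => forallBool fun x₆ => p (pairs r x₁ x₂ x₃ x₄ x₅ x₆)

lemma forallPairs_iff {r : Bool} {p : (Four → Four → Bool) → Bool} : forallPairs r p = true ↔
    ∀ R : Four → Four → Bool, (∀ i, R i i = r) → (∀ i j, R i j = R j i) → p R = true := by
  simp only [forallPairs, forallBool_iff]
  constructor
  · intro h R h1 h2
    rw [eq_pairs h1 h2]
    exact h _ _ _ _ _ _
  · intro h x₁ x₂ x₃ x₄ x₅ x₆
    exact h _ (fun i => by cases i <;> rfl) (fun i j => by cases i <;> cases j <;> rfl)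

lemma pattern_cases {e c : Four → Four → Bool} (he : ∀ i, e i i = true)
    (hes : ∀ i j, e i j = e j i) (het : ∀ i j k, e i j = true → e j k = true → e i k = true)
    (hne : ∃ i j, e i j = false) (hc : ∀ i, c i i = false) (hcs : ∀ i j, c i j = c j i) :
    bad e c = true ∨ covering e c = true ∨ almostCovering e c = true ∨ triangle e c = true := by
  have key : (forallPairs true fun e => !(all fun i => all fun j => all fun k =>
      !e i j || !e j k || e i k) || (all fun i => all fun j => e i j) ||
      forallPairs false fun c => bad e c || covering e c || almostCovering e c || triangle e c)
      = true := by decide +kernel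
  have h1 := forallPairs_iff.mp key e he hes
  simp only [Bool.or_eq_true, Bool.not_eq_true', forallPairs_iff, all_iff,
    ← Bool.not_eq_true] at h1
  rcases h1 with (h1 | h1) | h1
  · exact absurd (fun i j k => by
      cases h2 : e i j
      · simp
      · cases h3 : e j k
        · simp
        · simp [het i j k h2 h3]) h1
  · obtain ⟨i, j, h2⟩ := hne
    rw [h1 i j] at h2
    exact absurd h2 (by decide)
  · rcases h1 c (fun i => by simp [hc]) hcs with ((h | h) | h) | h
    · exact Or.inl h
    · exact Or.inr (Or.inl h)
    · exact Or.inr (Or.inr (Or.inl h))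
    · exact Or.inr (Or.inr (Or.inr h))

end Four

namespace Frame

variable {α : Type*} [DecidableEq α] [Fintype α] {f : Frame α}

open Classical in
/-- The bad pattern for the clusters and conflicts at position `k`. -/
def Bad (f : Frame α) (k : α) (s : Four → Perm α) : Prop :=
  Four.bad (fun i j => decide (s i k = s j k)) (fun i j => decide (f.Conf k (s i) (s j))) = true

theorem hasPacking_of_not_bad {k i : α} (hk : f.High k) (hi : f.High i) (hik : i ≠ k)
    {s : Four → Perm α}
    (hsign : ∀ i, Perm.sign (s i) = Perm.sign (s .a)) (hne : ∃ i j, s i k ≠ s j k)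
    (hbad : ¬ f.Bad k s) : ∃ a : α, HasPacking {c // c ≠ a} f.graph (Set.range s) := by
  classical
  have hS : ∀ v ∈ Set.range s, Perm.sign v = Perm.sign (s .a) := by
    rintro _ ⟨i, rfl⟩; exact hsign i
  have hcase := Four.pattern_cases (e := fun i j => decide (s i k = s j k))
    (c := fun i j => decide (f.Conf k (s i) (s j))) (by simp) (by simp [eq_comm])
    (by simp only [decide_eq_true_eq]; intro i j l h1 h2; exact h1.trans h2)
    (by simpa using hne) (by simp [Conf])
    (fun i j => by simp only [decide_eq_decide]; exact ⟨fun h => h.symm hk, fun h => h.symm hk⟩)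
  rcases hcase with h | h | h | h
  · exact absurd (by unfold Bad; convert h) hbad
  · simp only [Four.covering, Four.any_iff, Four.all_iff, Bool.or_eq_true, Bool.and_eq_true,
      Bool.not_eq_true', decide_eq_true_eq, decide_eq_false_iff_not, Four.same_iff] at h
    obtain ⟨y, h⟩ := h
    refine ⟨s y k, hasPacking_of_center hk (s y k) ⟨_, .a, rfl⟩ hS (s y) (s y) (s y k)
      ⟨y, rfl⟩ rfl (fun h => absurd rfl h) (fun h => absurd rfl h) ?_ ?_ (fun h => absurd rfl h)⟩
    · rintro _ ⟨i, rfl⟩ _ ⟨j, rfl⟩ hc h1 h2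
      rcases h i j with h3 | h3
      · exact absurd hc h3
      · exact absurd h3.1 (by tauto)
    · rintro _ ⟨i, rfl⟩ _ ⟨j, rfl⟩ hc h1 h2
      rcases h i j with h3 | h3
      · exact absurd hc h3
      · rcases h3.2 with ((h4 | h4) | h4) | h4
        · exact absurd h1 h4
        · exact absurd h2 h4
        · exact Or.inl (by rw [h4])
        · exact Or.inr (by rw [h4])
  · simp only [Four.almostCovering, Four.any_iff, Four.all_iff, Bool.or_eq_true,
      Bool.and_eq_true, Bool.not_eq_true', decide_eq_true_eq, decide_eq_false_iff_not,
      Four.same_iff] at h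
    obtain ⟨w, r, hwr, y₀, ⟨⟨hwy, hry⟩, hfree⟩, hpairs⟩ := h
    set a := s y₀ k with ha
    have hcen : ∃ y, s y k = a ∧ ∀ e, s e k = a →
        f.nb (f.mate (f.fl k (f.nb (s w) a))) (f.lab k (s w) (s r)) = f.mate (s e) →
        s e = s y := by
      by_cases h1 : ∃ e, s e k = a ∧
          f.nb (f.mate (f.fl k (f.nb (s w) a))) (f.lab k (s w) (s r)) = f.mate (s e)
      · obtain ⟨e, h2, h3⟩ := h1
        exact ⟨e, h2, fun e' h4 h5 => mate_injective (h5.symm.trans h3)⟩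
      · exact ⟨y₀, rfl, fun e h2 h3 => absurd ⟨e, h2, h3⟩ h1⟩
    obtain ⟨y, hya, hcen⟩ := hcen
    have hlab : f.lab k (s w) (s r) ≠ s w k := by
      rw [lab]
      split_ifs with h1
      · rw [h1]
        exact fun h => hk.2.2 ((s r).injective h).symm
      · exact fun h => h1 h.symm
    refine ⟨a, hasPacking_of_center hk a ⟨_, .a, rfl⟩ hS (s y) (s w)
      (f.lab k (s w) (s r)) ⟨y, rfl⟩ hya (fun _ => ⟨⟨w, rfl⟩, hwy, hlab⟩) ?_ ?_ ?_ ?_⟩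
    · rintro - _ ⟨u, rfl⟩ hu
      rcases hfree u with h | h
      · exact absurd hu h
      · exact h
    · rintro _ ⟨i, rfl⟩ _ ⟨j, rfl⟩ hc h1 h2
      rcases hpairs i j with h3 | h3
      · exact absurd hc h3
      · rcases h3.1 with ((h4 | h4) | h4) | h4
        · exact absurd h4 h1
        · exact absurd h4 h2
        · exact Or.inl (by rw [h4.1, h4.2]; exact ⟨rfl, rfl⟩)
        · exact Or.inr (by rw [h4.1, h4.2]; exact ⟨rfl, rfl⟩)
    · rintro _ ⟨i, rfl⟩ _ ⟨j, rfl⟩ hc h1 h2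
      rcases hpairs i j with h3 | h3
      · exact absurd hc h3
      · rcases h3.2 with (h4 | h4) | h4
        · exact absurd h1 h4
        · exact absurd h2 h4
        · rcases h4 y with (h5 | h5) | h5
          · exact absurd hya h5
          · exact Or.inl (by rw [h5])
          · exact Or.inr (by rw [h5])
    · rintro - _ ⟨e, rfl⟩ h1 h2
      exact hcen e h1 h2
  · simp only [Four.triangle, Four.any_iff, Four.all_iff, Bool.or_eq_true, Bool.and_eq_true,
      Bool.not_eq_true', decide_eq_true_eq, decide_eq_false_iff_not, Four.same_iff] at h
    obtain ⟨x, y, ⟨hyx, hxy⟩, z, ⟨⟨⟨hzx, hxz⟩, hyz⟩, hin⟩, hout⟩ := h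
    refine ⟨s x k, hasPacking_of_triangle hk hi hik (s x k) hS ⟨x, rfl⟩ ⟨y, rfl⟩ ⟨z, rfl⟩ rfl hyx
      hzx hxy hxz hyz ?_ ?_⟩
    · rintro _ ⟨v, rfl⟩ hv
      rcases hin v with ((h | h) | h) | h
      · exact absurd hv h
      · exact Or.inl (by rw [h])
      · exact Or.inr (Or.inl (by rw [h]))
      · exact Or.inr (Or.inr (by rw [h]))
    · rintro _ ⟨v, rfl⟩ _ ⟨u, rfl⟩ hc
      rcases hout v u with (h | h) | h
      · exact absurd hc h
      · exact Or.inl h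
      · exact Or.inr h

end Frame

namespace Four

/-- Three given elements of different clusters in pairwise conflict. -/
def tri (e c : Four → Four → Bool) (x y z : Four) : Bool :=
  c x y && c y z && c x z && !e x y && !e y z && !e x z

/-- A given cycle of four conflicts with opposite members in different clusters. -/
def cyc (e c : Four → Four → Bool) (x y z w : Four) : Bool :=
  c x y && c y z && c z w && c w x && !e x z && !e y w

lemma bad_cases {e c : Four → Four → Bool} (he : ∀ i, e i i = true)
    (hes : ∀ i j, e i j = e j i) (hc : ∀ i, c i i = false) (hcs : ∀ i j, c i j = c j i)
    (hb : bad e c = true) :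
    tri e c a b .c ∨ tri e c a b d ∨ tri e c a .c d ∨ tri e c b .c d ∨
      cyc e c a b .c d ∨ cyc e c a b d .c ∨ cyc e c a .c b d := by
  have key : (forallPairs true fun e => forallPairs false fun c => !bad e c ||
      (tri e c a b .c || (tri e c a b d || (tri e c a .c d || (tri e c b .c d ||
      (cyc e c a b .c d || (cyc e c a b d .c || cyc e c a .c b d))))))) = true := by
    decide +kernel
  have h1 := forallPairs_iff.mp (forallPairs_iff.mp key e he hes) c hc hcs
  simpa [hb] using h1

end Four

/-- The values at a position `j` of two permutations conflicting at a position where they have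
different values. -/
def Cross {α : Type*} (vt vk vj ut uk uj : α) : Prop :=
  (vj = uk ∧ ((uj = vk ∧ vt = ut) ∨ (uj ≠ vk ∧ uj = vt))) ∨
    (vj ≠ uk ∧ ((uj = vk ∧ vj = ut) ∨ (uj ≠ vk ∧ vj = uj)))

/-- The values at a position `j` of two permutations conflicting at a position where they have
the same value. -/
def Inner {α : Type*} (vt vj ut uj : α) : Prop := (vj = ut ∧ uj = vt) ∨ (vj ≠ ut ∧ vj = uj)

/-- The consequences at `j` and `l` of a conflict at `k`. -/
def Trace {α : Type*} (t k j l : Four → α) (v u : Four) : Prop :=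
  (k v ≠ k u ∧ Cross (t v) (k v) (j v) (t u) (k u) (j u) ∧
    Cross (t v) (k v) (l v) (t u) (k u) (l u)) ∨
  (k v = k u ∧ t v ≠ t u ∧ Inner (t v) (j v) (t u) (j u) ∧ Inner (t v) (l v) (t u) (l u))

/-- Three elements with different values in pairwise conflict. -/
def TraceTri {α : Type*} (t k j l : Four → α) (x y z : Four) : Prop :=
  Trace t k j l x y ∧ Trace t k j l y z ∧ Trace t k j l x z ∧ k x ≠ k y ∧ k y ≠ k z ∧ k x ≠ k z

/-- A cycle of four conflicts with different values at opposite members. -/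
def TraceCyc {α : Type*} (t k j l : Four → α) (x y z w : Four) : Prop :=
  Trace t k j l x y ∧ Trace t k j l y z ∧ Trace t k j l z w ∧ Trace t k j l w x ∧
    k x ≠ k z ∧ k y ≠ k w

/-- The bad patterns on four elements. -/
def TraceBad {α : Type*} (t k j l : Four → α) : Prop :=
  TraceTri t k j l .a .b .c ∨ TraceTri t k j l .a .b .d ∨ TraceTri t k j l .a .c .d ∨
  TraceTri t k j l .b .c .d ∨ TraceCyc t k j l .a .b .c .d ∨ TraceCyc t k j l .a .b .d .c ∨
  TraceCyc t k j l .a .c .b .d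

/-- The four values of each element are distinct. -/
def Rows {α : Type*} (t k j l : Four → α) : Prop :=
  ∀ x, t x ≠ k x ∧ t x ≠ j x ∧ t x ≠ l x ∧ k x ≠ j x ∧ k x ≠ l x ∧ j x ≠ l x

set_option maxHeartbeats 4000000 in
lemma not_traceTri {α : Type*} {t k j l : Four → α} (hr : Rows t k j l)
    (hk : TraceTri t k j l .a .b .c) (hj : TraceBad t j k l) (hl : TraceBad t l j k) : False := by
  have ha := hr .a
  have hb := hr .b
  have hc := hr .c
  have hd := hr .d
  clear hr
  rcases hj with hj | hj | hj | hj | hj | hj | hj <;>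
  rcases hl with hl | hl | hl | hl | hl | hl | hl <;>
  · unfold TraceTri at *
    try unfold TraceCyc at *
    unfold Trace Cross Inner at *
    grind (splits := 60)

set_option maxHeartbeats 4000000 in
lemma not_traceCyc {α : Type*} {t k j l : Four → α} (hr : Rows t k j l)
    (hk : TraceCyc t k j l .a .b .c .d) (hj : TraceBad t j k l) (hl : TraceBad t l j k) :
    False := by
  have ha := hr .a
  have hb := hr .b
  have hc := hr .c
  have hd := hr .d
  clear hr
  rcases hj with hj | hj | hj | hj | hj | hj | hj <;>
  rcases hl with hl | hl | hl | hl | hl | hl | hl <;>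
  · unfold TraceCyc at *
    try unfold TraceTri at *
    unfold Trace Cross Inner at *
    grind (splits := 60)

namespace Frame

variable {α : Type*} [DecidableEq α] [Fintype α] {f : Frame α}

lemma Bad.comp {k : α} {s : Four → Perm α} (h : f.Bad k s) (σ : Perm Four) :
    f.Bad k (s ∘ σ) := by
  unfold Bad Four.bad at *
  simp only [Four.any_iff, Bool.and_eq_true, Bool.or_eq_true, Bool.not_eq_true',
    decide_eq_true_eq, decide_eq_false_iff_not, Function.comp_apply] at h ⊢
  obtain ⟨x, y, h1, z, ⟨h2, h3⟩, h4⟩ := h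
  refine ⟨σ.symm x, σ.symm y, by simpa using h1, σ.symm z, by simpa using ⟨h2, h3⟩, ?_⟩
  refine h4.imp (fun h => by simpa using h) (fun ⟨w, h⟩ => ⟨σ.symm w, by simpa using h⟩)

lemma Conf.trace {k j l : α} (hj : f.High j) (hl : f.High l) (hjk : j ≠ k)
    (hlk : l ≠ k) {s : Four → Perm α} {v u : Four} (h : f.Conf k (s v) (s u)) :
    Trace (fun i => s i f.t) (fun i => s i k) (fun i => s i j) (fun i => s i l) v u := by
  have key : ∀ j, f.High j → j ≠ k → s v k ≠ s u k →
      f.fl k (f.nb (s v) (s u k)) = f.nb (s u) (s v k) →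
      Cross (s v f.t) (s v k) (s v j) (s u f.t) (s u k) (s u j) := by
    intro j hj hjk h1 h2
    have h3 := congrArg (fun m => m j) h2
    simp only [fl_high _ hj, if_neg hjk, nb_high _ _ hj] at h3
    unfold Cross
    split_ifs at h3 <;> tauto
  have key' : ∀ j, f.High j → f.nb (s v) (s u f.t) = s u →
      Inner (s v f.t) (s v j) (s u f.t) (s u j) := by
    intro j hj h2
    have h3 := congrArg (fun m => m j) h2
    simp only [nb_high _ _ hj] at h3
    unfold Inner
    split_ifs at h3 <;> tauto
  obtain ⟨h1, ⟨h2, h3⟩ | ⟨h2, h3⟩⟩ := h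
  · exact Or.inl ⟨h2, key j hj hjk h2 h3, key l hl hlk h2 h3⟩
  · refine Or.inr ⟨h2, fun h4 => h1 ?_, key' j hj h3, key' l hl h3⟩
    rw [← h3]
    exact (nb_eq_self.mpr h4.symm).symm

open Classical in
lemma Bad.patterns {k j l : α} (hk : f.High k) (hj : f.High j) (hl : f.High l) (hjk : j ≠ k)
    (hlk : l ≠ k) {s : Four → Perm α} (h : f.Bad k s) :
    TraceBad (fun i => s i f.t) (fun i => s i k) (fun i => s i j) (fun i => s i l) := by
  have h1 := Four.bad_cases (by simp) (by simp [eq_comm]) (by simp [Conf])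
    (fun i j => by simp only [decide_eq_decide]; exact ⟨fun h => h.symm hk, fun h => h.symm hk⟩) h
  simp only [Four.tri, Four.cyc, Bool.and_eq_true, Bool.not_eq_true',
    decide_eq_true_eq, decide_eq_false_iff_not, and_assoc] at h1
  have ht : ∀ x y z, f.Conf k (s x) (s y) ∧ f.Conf k (s y) (s z) ∧ f.Conf k (s x) (s z) ∧
      s x k ≠ s y k ∧ s y k ≠ s z k ∧ s x k ≠ s z k → TraceTri (fun i => s i f.t)
        (fun i => s i k) (fun i => s i j) (fun i => s i l) x y z :=
    fun x y z ⟨c1, c2, c3, e⟩ => ⟨c1.trace hj hl hjk hlk, c2.trace hj hl hjk hlk,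
      c3.trace hj hl hjk hlk, e⟩
  have hc : ∀ x y z w, f.Conf k (s x) (s y) ∧ f.Conf k (s y) (s z) ∧ f.Conf k (s z) (s w) ∧
      f.Conf k (s w) (s x) ∧ s x k ≠ s z k ∧ s y k ≠ s w k → TraceCyc (fun i => s i f.t)
        (fun i => s i k) (fun i => s i j) (fun i => s i l) x y z w :=
    fun x y z w ⟨c1, c2, c3, c4, e⟩ => ⟨c1.trace hj hl hjk hlk, c2.trace hj hl hjk hlk,
      c3.trace hj hl hjk hlk, c4.trace hj hl hjk hlk, e⟩
  exact h1.imp (ht _ _ _) (.imp (ht _ _ _) (.imp (ht _ _ _) (.imp (ht _ _ _)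
    (.imp (hc _ _ _ _) (.imp (hc _ _ _ _) (hc _ _ _ _))))))

/-- No four permutations are bad at three positions. -/
theorem not_bad_three {k j l : α} (hk : f.High k) (hj : f.High j) (hl : f.High l)
    (hkj : k ≠ j) (hkl : k ≠ l) (hjl : j ≠ l) {s : Four → Perm α} (bk : f.Bad k s)
    (bj : f.Bad j s) (bl : f.Bad l s) : False := by
  have hr : ∀ s : Four → Perm α, Rows (fun i => s i f.t) (fun i => s i k) (fun i => s i j)
      (fun i => s i l) := fun s x => by
    simp only [ne_eq, (s x).injective.eq_iff]
    exact ⟨hk.2.2.symm, hj.2.2.symm, hl.2.2.symm, hkj, hkl, hjl⟩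
  have tri (σ : Perm Four) (h : TraceTri (fun i => s i f.t) (fun i => s i k) (fun i => s i j)
      (fun i => s i l) (σ .a) (σ .b) (σ .c)) : False :=
    not_traceTri (hr (s ∘ σ)) h ((bj.comp σ).patterns hj hk hl hkj hjl.symm)
      ((bl.comp σ).patterns hl hj hk hjl hkl)
  have cyc (σ : Perm Four) (h : TraceCyc (fun i => s i f.t) (fun i => s i k) (fun i => s i j)
      (fun i => s i l) (σ .a) (σ .b) (σ .c) (σ .d)) : False :=
    not_traceCyc (hr (s ∘ σ)) h ((bj.comp σ).patterns hj hk hl hkj hjl.symm)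
      ((bl.comp σ).patterns hl hj hk hjl hkl)
  rcases bk.patterns hk hj hl hkj.symm hkl.symm with h | h | h | h | h | h | h
  · exact tri 1 h
  · exact tri (swap .c .d) h
  · exact tri (swap .b .c * swap .c .d) h
  · exact tri (swap .a .b * swap .b .c * swap .c .d) h
  · exact cyc 1 h
  · exact cyc (swap .c .d) h
  · exact cyc (swap .b .c) h

end Frame

namespace Frame

variable {α : Type*} [DecidableEq α] [Fintype α] {f : Frame α}

/-- The permutations whose value at `k` is not `c` form a connecting piece for any set of
permutations with value `c` at `k`. -/
lemma complement_connected {k c : α} (hk : f.High k) {S : Set (Perm α)}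
    (hS : ∀ v ∈ S, v k = c) : ∃ r, ∀ a ∈ S ∪ {m : Perm α | m k ≠ c},
      Relation.ReflTransGen (LinkAdj f.graph S {m | m k ≠ c} (fun _ _ => False)) a r := by
  set X : Set (Perm α) := {m | m k ≠ c} with hX
  obtain ⟨c', hc'⟩ : ∃ c', c' ≠ c := by
    by_contra! h
    exact f.pq ((h _).trans (h _).symm)
  have link : ∀ {a b : Perm α}, f.graph.Adj a b → a ∈ X → b ∈ X →
      LinkAdj f.graph S X (fun _ _ => False) a b :=
    fun h h1 h2 => ⟨h, Or.inr h1, Or.inr h2, Or.inl h1⟩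
  have hub : ∀ {m m' : Perm α}, m' ∈ X → Perm.sign m = Perm.sign m' → m k = m' k →
      Relation.ReflTransGen (LinkAdj f.graph S X (fun _ _ => False)) m m' := by
    intro m m' hm' h1 h2
    refine Relation.ReflTransGen.mono (fun a b (h : f.HubAdj _ _ _ a b) => link h.1 ?_ ?_) _ _
      (hub_connected hk h1 h2)
    · exact fun h3 => hm' (h.2.1.2 ▸ h3)
    · exact fun h3 => hm' (h.2.2.2 ▸ h3)
  have move : ∀ a ∈ X, ∃ b, Perm.sign b = Perm.sign a ∧ b k = c' ∧
      Relation.ReflTransGen (LinkAdj f.graph S X (fun _ _ => False)) a b := by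
    intro a ha
    by_cases h : a k = c'
    · exact ⟨a, rfl, h, .refl⟩
    · have h1 : f.nb a c' k = a k := by rw [nb_high _ _ hk, if_neg h]
      have h2 : f.fl k (f.nb a c') k = c' := by rw [fl_high _ hk, if_pos rfl, nb_t]
      refine ⟨f.fl k (f.nb a c'), by simp, h2, (hub (m' := f.nb a c') ?_ (by simp)
        h1.symm).tail (link (adj_fl hk _) ?_ ?_)⟩
      · exact fun h3 => ha (h1.symm.trans h3)
      · exact fun h3 => ha (h1.symm.trans h3)
      · exact fun h3 => hc' (h2.symm.trans h3)
  refine ⟨swap k c', ?_⟩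
  have hr : (swap k c') k = c' := swap_apply_left _ _
  have hrX : swap k c' ∈ X := fun h => hc' (hr.symm.trans h)
  have main : ∀ a ∈ X, Relation.ReflTransGen (LinkAdj f.graph S X (fun _ _ => False)) a
      (swap k c') := by
    intro a ha
    obtain ⟨b, h1, h2, h3⟩ := move a ha
    refine h3.trans ?_
    by_cases h4 : Perm.sign b = Perm.sign (swap k c')
    · exact hub hrX h4 (h2.trans hr.symm)
    · have h5 : f.mate b k = c' := by rw [mate_high _ hk, h2]
      refine (Relation.ReflTransGen.single (link (adj_mate b) (fun h => hc' (h2.symm.trans h))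
        (fun h => hc' (h5.symm.trans h)))).trans (hub hrX ?_ (h5.trans hr.symm))
      rw [sign_mate]
      exact (Int.units_ne_iff_eq_neg.mp (Ne.symm h4)).symm
  rintro a (ha | ha)
  · have h1 : f.fl k a ∈ X := by
      intro h
      rw [fl_high _ hk, if_pos rfl, ← hS a ha] at h
      exact hk.2.2 (a.injective h).symm
    exact .head ⟨adj_fl hk a, Or.inl ha, Or.inr h1, Or.inr (Or.inl h1)⟩ (main _ h1)
  · exact main a ha

variable {β : Type*} [DecidableEq β] [Fintype β] {g : Frame β}

/-- Frame preserving extension of permutations preserves adjacency. -/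
lemma adj_extendDomain {k : α} (e : β ≃ {i : α // i ≠ k}) (hk : f.High k)
    (hp : (e g.p : α) = f.p) (hq : (e g.q : α) = f.q) (ht : (e g.t : α) = f.t)
    {u v : Perm β} (h : g.graph.Adj u v) :
    f.graph.Adj (u.extendDomain e) (v.extendDomain e) := by
  have high : ∀ i, g.High i → f.High (e i) := by
    intro i hi
    refine ⟨?_, ?_, ?_⟩ 
    · rw [← hp]; exact fun h => hi.1 (e.injective (Subtype.ext h))
    · rw [← hq]; exact fun h => hi.2.1 (e.injective (Subtype.ext h))
    · rw [← ht]; exact fun h => hi.2.2 (e.injective (Subtype.ext h))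
  have low : ∀ j, f.High j → j = k ∨ ∃ i, g.High i ∧ (e i : α) = j := by
    intro j hj
    by_cases h : j = k
    · exact Or.inl h
    · refine Or.inr ⟨e.symm ⟨j, h⟩, ⟨?_, ?_, ?_⟩, by simp⟩ <;> intro h1
      · exact hj.1 (by rw [← hp, ← h1]; simp)
      · exact hj.2.1 (by rw [← hq, ← h1]; simp)
      · exact hj.2.2 (by rw [← ht, ← h1]; simp)
  have hfix : ∀ u : Perm β, u.extendDomain e k = k :=
    fun u => Perm.extendDomain_apply_not_subtype _ _ (by simp)
  obtain ⟨hne, h1⟩ := h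
  refine ⟨fun h2 => hne (Perm.extendDomainHom_injective e h2), ?_⟩
  rcases h1 with rfl | ⟨c, rfl⟩
  · left
    refine ext_sign (f := f) (by simp [Perm.sign_extendDomain]) ?_ fun j hj => ?_
    · rw [mate_t, ← ht, Perm.extendDomain_apply_image, Perm.extendDomain_apply_image, mate_t]
    · rcases low j hj with rfl | ⟨i, hi, rfl⟩
      · rw [mate_high _ hk, hfix, hfix]
      · rw [mate_high _ (high i hi), Perm.extendDomain_apply_image,
          Perm.extendDomain_apply_image, mate_high _ hi]
  · right
    refine ⟨e c, ext_sign (f := f) (by simp [Perm.sign_extendDomain]) ?_ fun j hj => ?_⟩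
    · rw [nb_t, ← ht, Perm.extendDomain_apply_image, nb_t]
    · rcases low j hj with rfl | ⟨i, hi, rfl⟩
      · rw [nb_high _ _ hk, hfix, hfix, if_neg (e c).2.symm]
      · rw [nb_high _ _ (high i hi), ← ht, Perm.extendDomain_apply_image,
          Perm.extendDomain_apply_image, Perm.extendDomain_apply_image, nb_high _ _ hi]
        simp only [← Subtype.ext_iff, e.injective.eq_iff]
        split_ifs <;> rfl

/-- Packings for permutations that agree at a position outside the frame. -/
theorem hasPacking_of_constant {ι : Type*} {k : α} (e : β ≃ {i : α // i ≠ k}) (hk : f.High k)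
    (hp : (e g.p : α) = f.p) (hq : (e g.q : α) = f.q) (ht : (e g.t : α) = f.t)
    {s : Four → Perm α} (hs : Function.Injective s)
    (hsign : ∀ i, Perm.sign (s i) = Perm.sign (s .a)) (hc : ∀ i, s i k = s .a k)
    (ih : ∀ s' : Four → Perm β, Function.Injective s' →
      (∀ i, Perm.sign (s' i) = Perm.sign (s' .a)) → HasPacking ι g.graph (Set.range s')) :
    HasPacking (Option ι) f.graph (Set.range s) := by
  set φ : Perm β → Perm α := fun u => s .a * u.extendDomain e with hφ
  have hinj : Function.Injective φ := fun u v h =>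
    Perm.extendDomainHom_injective e (mul_left_cancel h)
  have hfix : ∀ u, φ u k = s .a k := fun u => by
    simp only [hφ, Perm.mul_apply]
    rw [Perm.extendDomain_apply_not_subtype _ _ (by simp)]
  have hsφ : ∀ u, Perm.sign (φ u) = Perm.sign (s .a) * Perm.sign u := fun u => by
    simp [hφ, Perm.sign_extendDomain]
  have hsurj : ∀ i, ∃ u, φ u = s i := by
    intro i
    have hik : ((s .a)⁻¹ * s i) k = k := by simp [hc i]
    have hne : ∀ x, ((s .a)⁻¹ * s i) x ≠ k ↔ x ≠ k := fun x => by
      rw [not_iff_not]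
      exact ⟨fun h => ((s .a)⁻¹ * s i).injective (h.trans hik.symm), fun h => h ▸ hik⟩
    refine ⟨e.symm.permCongr (((s .a)⁻¹ * s i).subtypePerm hne), ?_⟩
    have : (e.symm.permCongr (((s .a)⁻¹ * s i).subtypePerm hne)).extendDomain e
        = (s .a)⁻¹ * s i := by
      ext x
      by_cases hx : x = k
      · rw [hx, Perm.extendDomain_apply_not_subtype (p := (· ≠ k)) _ _ (not_not.mpr rfl), hik]
      · rw [Perm.extendDomain_apply_subtype (p := (· ≠ k)) _ _ hx]
        simp [Equiv.permCongr_apply]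
    simp [hφ, this]
  choose s' hs' using hsurj
  have hmap := HasPacking.map φ hinj (H := f.graph)
    (fun a b h => adj_mul_left _ (adj_extendDomain e hk hp hq ht h))
    (ih s' (fun i j h => hs (by rw [← hs' i, ← hs' j, h])) fun i => by
      have h1 := hsign i
      rw [← hs' i, hsφ] at h1
      have h2 := hsφ (s' .a)
      rw [hs'] at h2
      exact mul_left_cancel (h1.trans h2))
  obtain ⟨U, F, h, hU⟩ := hmap
  have himg : φ '' Set.range s' = Set.range s := by
    rw [← Set.range_comp]
    exact congrArg Set.range (funext hs')
  rw [himg] at h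
  have hS : ∀ v ∈ Set.range s, v k = s .a k := by
    rintro _ ⟨i, rfl⟩; exact hc i
  obtain ⟨r, hr⟩ := complement_connected hk hS
  refine h.insert {m | m k ≠ s .a k} r (fun a ha => ⟨fun h1 => ha (hS a h1), fun i h1 => ?_⟩) hr
  obtain ⟨u, rfl⟩ := hU i h1
  exact ha (hfix u)

end Frame

/-- Coded vertices: parity bit, value at the pivot, values at the remaining high positions. -/
abbrev Code := List ℕ

namespace Code

/-- The neighbour of a coded vertex with pivot value `c`, or its mate if `c = n`. -/
def move (n c : ℕ) : Code → Code
  | s :: t :: r =>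
    bif c == n then (1 - s) :: t :: r else s :: c :: r.map fun x => bif x == c then t else x
  | κ => κ

/-- The edges of the tree grown from the vertices `L` by a list of instructions: an instruction
`(i, c)` attaches the neighbour with label `c` of the `i`-th most recent vertex. -/
def grow (n : ℕ) : List (ℕ × ℕ) → List Code → List (Code × Code)
  | [], _ => []
  | (i, c) :: r, L => match L[i]? with
    | none => []
    | some κ => bif c < n + 1 then (κ, move n c κ) :: grow n r (move n c κ :: L) else []

/-- Two trees given by their edges meet only in `T` and have no common edge inside `T`. -/
def compatible (T : List Code) (E E' : List (Code × Code)) : Bool :=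
  (E.all fun e => !(E'.any fun e' => e'.2 == e.2) || T.contains e.2) &&
  (E.all fun e => !(T.contains e.1 && T.contains e.2) ||
    !(E'.contains e || E'.contains (e.2, e.1)))

/-- Boolean check that a relation holds for all pairs of entries in order. -/
def pairwise {A : Type*} (R : A → A → Bool) : List A → Bool
  | [] => true
  | x :: l => l.all (R x) && pairwise R l

lemma pairwise_iff {A : Type*} {R : A → A → Bool} {l : List A} :
    pairwise R l = true ↔ l.Pairwise (fun x y => R x y = true) := by
  induction l with
  | nil => simp [pairwise]
  | cons x l ih => simp [pairwise, ih]

/-- Check of a system of trees grown from the vertex `b` and connecting `T`. -/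
def check (n : ℕ) (b : Code) (T : List Code) (trees : List (List (ℕ × ℕ))) : Bool :=
  T.contains b &&
  (trees.all fun τ => T.all fun κ => κ == b || (grow n τ [b]).any fun e => e.2 == κ) &&
  pairwise (fun τ τ' => compatible T (grow n τ [b]) (grow n τ' [b])) trees

lemma compatible_iff {T : List Code} {E E' : List (Code × Code)} : compatible T E E' = true ↔
    (∀ e ∈ E, ∀ e' ∈ E', e'.2 = e.2 → e.2 ∈ T) ∧
    ∀ e ∈ E, e.1 ∈ T → e.2 ∈ T → e ∉ E' ∧ (e.2, e.1) ∉ E' := by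
  simp only [compatible, Bool.and_eq_true, List.all_eq_true, Bool.or_eq_true, Bool.not_eq_true',
    List.any_eq_false, List.contains_eq_mem, decide_eq_true_eq, Bool.and_eq_false_iff,
    beq_iff_eq, decide_eq_false_iff_not, Bool.or_eq_false_iff]
  refine and_congr (forall₂_congr fun e he => ?_) (forall₂_congr fun e he => by tauto)
  constructor
  · rintro (h | h) e' he' h1
    · exact absurd h1 (h e' he')
    · exact h
  · intro h
    by_cases h1 : e.2 ∈ T
    · exact Or.inr h1
    · exact Or.inl fun e' he' h2 => h1 (h e' he' h2)

end Code

namespace Frame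

open Code

variable {α : Type*} [DecidableEq α] [Fintype α] {f : Frame α}

/-- The code of `v` for the labelling `g` of values, the high positions `l` and the sign `ε`. -/
def code (f : Frame α) (g : α → ℕ) (l : List α) (ε : ℤˣ) (v : Perm α) : Code :=
  (if Perm.sign v = ε then 0 else 1) :: g (v f.t) :: l.map fun j => g (v j)

variable {g : α → ℕ} {l : List α} {ε : ℤˣ}

lemma code_injective (hg : Function.Injective g) (hl : ∀ j, f.High j → j ∈ l) :
    Function.Injective (f.code g l ε) := by
  intro u v h
  simp only [code, List.cons.injEq, List.map_inj_left, hg.eq_iff] at h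
  refine ext_sign (f := f) ?_ h.2.1 fun j hj => h.2.2 j (hl j hj)
  have h1 := h.1
  split_ifs at h1 with h2 h3 h3
  · rw [h2, h3]
  · rw [Int.units_ne_iff_eq_neg.mp h2, Int.units_ne_iff_eq_neg.mp h3]

lemma code_mate {n : ℕ} (hl : ∀ j ∈ l, f.High j) (v : Perm α) :
    f.code g l ε (f.mate v) = move n n (f.code g l ε v) := by
  simp only [code, move, beq_self_eq_true, cond_true, mate_t, sign_mate, List.cons.injEq,
    List.map_inj_left, true_and]
  refine ⟨?_, fun j hj => by rw [mate_high _ (hl j hj)]⟩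
  rcases Int.units_eq_one_or (Perm.sign v) with h | h <;>
    rcases Int.units_eq_one_or ε with h' | h' <;> simp [h, h']

lemma code_nb {n : ℕ} (hg : Function.Injective g) (hl : ∀ j ∈ l, f.High j) (v : Perm α) {c : α}
    (hc : g c ≠ n) : f.code g l ε (f.nb v c) = move n (g c) (f.code g l ε v) := by
  simp only [code, move, beq_eq_false_iff_ne.mpr hc, cond_false, nb_t, sign_nb, List.map_map,
    List.cons.injEq, List.map_inj_left, true_and, Function.comp_apply]
  intro j hj
  rw [nb_high _ _ (hl j hj)]
  by_cases h : v j = c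
  · simp [h]
  · simp [h, beq_eq_false_iff_ne.mpr (hg.ne h)]

/-- The trees described by a checked certificate. -/
theorem hasPacking_of_check {n : ℕ} (hg : Function.Injective g) (hgn : ∀ c < n, ∃ x, g x = c)
    (hng : ∀ x, g x ≠ n) (hl : ∀ j, f.High j ↔ j ∈ l) {S : Set (Perm α)} {b : Code}
    {T : List Code} (hT : ∀ κ, κ ∈ T ↔ ∃ v ∈ S, f.code g l ε v = κ)
    {trees : List (List (ℕ × ℕ))} (h : check n b T trees = true) :
    HasPacking (Fin trees.length) f.graph S := by
  have hinj := code_injective (f := f) (ε := ε) hg (fun j hj => (hl j).mp hj)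
  simp only [check, Bool.and_eq_true, List.all_eq_true, Bool.or_eq_true, beq_iff_eq,
    List.any_eq_true, List.contains_eq_mem, decide_eq_true_eq, pairwise_iff,
    compatible_iff] at h
  obtain ⟨⟨hb, hcov⟩, hpair⟩ := h
  have hTS : ∀ v, f.code g l ε v ∈ T ↔ v ∈ S := fun v => by
    rw [hT]
    exact ⟨fun ⟨u, hu, h⟩ => hinj h ▸ hu, fun h => ⟨v, h, rfl⟩⟩
  obtain ⟨r, hr, hrb⟩ := (hT b).mp hb
  set E : Fin trees.length → List (Code × Code) := fun i => grow n trees[i] [b] with hE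
  set U : Fin trees.length → Set (Perm α) :=
    fun i => {v | v ∉ S ∧ ∃ e ∈ E i, e.2 = f.code g l ε v} with hU
  have hcomp : ∀ i j : Fin trees.length, i < j → _ := fun i j hij =>
    List.pairwise_iff_getElem.mp hpair i j i.2 j.2 hij
  refine ⟨U, fun i v u => (f.code g l ε v, f.code g l ε u) ∈ E i, ?_, fun i a h h1 => h1.1 h,
    ?_, fun i => ⟨r, ?_⟩⟩
  · rintro i j a hij ⟨ha, e, he, hea⟩ ⟨-, e', he', hea'⟩
    rcases lt_or_gt_of_ne hij with h | h
    · have := (hcomp i j h).1 e he e' he' (hea'.trans hea.symm)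
      rw [hea, hTS] at this
      exact ha this
    · have := (hcomp j i h).1 e' he' e he (hea.trans hea'.symm)
      rw [hea', hTS] at this
      exact ha this
  · intro i j a c hij ha hc h1
    rw [← hTS] at ha hc
    rcases lt_or_gt_of_ne hij with h | h
    · exact (hcomp i j h).2 _ h1 ha hc
    · exact ⟨fun h2 => ((hcomp j i h).2 _ h2 ha hc).1 h1,
        fun h2 => ((hcomp j i h).2 _ h2 hc ha).2 h1⟩
  · have main : ∀ (τ : List (ℕ × ℕ)) (L : List Code),
        (∀ κ ∈ L, ∃ v ∈ S ∪ U i, f.code g l ε v = κ ∧ Relation.ReflTransGen (LinkAdj f.graph S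
          (U i) fun v u => (f.code g l ε v, f.code g l ε u) ∈ E i) v r) →
        (∀ e ∈ grow n τ L, e ∈ E i) → ∀ e ∈ grow n τ L, ∃ v ∈ S ∪ U i, f.code g l ε v = e.2 ∧
          Relation.ReflTransGen (LinkAdj f.graph S (U i)
            fun v u => (f.code g l ε v, f.code g l ε u) ∈ E i) v r := by
      intro τ
      induction τ with
      | nil => simp [grow]
      | cons p τ ih =>
        obtain ⟨m, c⟩ := p
        intro L hL hEi
        unfold grow at hEi ⊢
        split at hEi <;> rename_i κ hκ
        · simp
        by_cases hcn : c < n + 1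
        swap
        · simp [hcn]
        simp only [hcn, decide_true, cond_true, List.mem_cons, forall_eq_or_imp] at hEi ⊢
        obtain ⟨v, hvU, hvκ, hvr⟩ := hL κ (List.mem_of_getElem? hκ)
        have hstep : ∃ u, f.code g l ε u = move n c κ ∧ (u = v ∨ f.graph.Adj u v) := by
          rcases Nat.lt_succ_iff_lt_or_eq.mp hcn with h | h
          · obtain ⟨x, hx⟩ := hgn c h
            refine ⟨f.nb v x, by rw [code_nb hg (fun j => (hl j).mpr) v (hng x), hx, hvκ], ?_⟩
            by_cases hxt : x = v f.t
            · exact Or.inl (nb_eq_self.mpr hxt)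
            · exact Or.inr (adj_nb hxt).symm
          · exact ⟨f.mate v, by rw [code_mate (n := n) (fun j => (hl j).mpr), hvκ, h],
              Or.inr (adj_mate v).symm⟩
        obtain ⟨u, hu, huv⟩ := hstep
        have huU : u ∈ S ∪ U i := by
          by_cases h : u ∈ S
          · exact Or.inl h
          · exact Or.inr ⟨h, _, hEi.1, hu.symm⟩
        have hur : ∃ v ∈ S ∪ U i, f.code g l ε v = move n c κ ∧
            Relation.ReflTransGen (LinkAdj f.graph S (U i)
              fun v u => (f.code g l ε v, f.code g l ε u) ∈ E i) v r := by
          refine ⟨u, huU, hu, ?_⟩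
          rcases huv with rfl | huv
          · exact hvr
          · refine .head ⟨huv, huU, hvU, Or.inr (Or.inr (Or.inr ?_))⟩ hvr
            show (f.code g l ε v, f.code g l ε u) ∈ E i
            rw [hvκ, hu]
            exact hEi.1
        refine ⟨hur, ih _ ?_ hEi.2⟩
        rintro κ' (_ | ⟨_, h⟩)
        · exact hur
        · exact hL κ' h
    have hall := main trees[i] [b] (fun κ hκ => by
      rw [List.mem_singleton] at hκ
      exact ⟨r, Or.inl hr, hrb.trans hκ.symm, .refl⟩) (fun e he => he)
    intro a ha
    by_cases hab : f.code g l ε a = b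
    · rw [hinj (hab.trans hrb.symm)]
    · have : ∃ e ∈ E i, e.2 = f.code g l ε a := by
        rcases ha with ha | ha
        · exact (hcov _ (List.getElem_mem i.2) _ ((hTS a).mpr ha)).resolve_left hab
        · exact ha.2
      obtain ⟨e, he, hea⟩ := this
      obtain ⟨v, -, hv, hvr⟩ := hall e he
      rw [← hinj (hv.trans hea)]
      exact hvr

end Frame

/-- Rows of values, with the instructions for trees grown from the first row. -/
abbrev Cert := List (List ℕ) × List (List (ℕ × ℕ))

namespace Code

/-- The words of length `m` without repeated letters in the alphabet `0, …, n - 1`. -/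
def words (n : ℕ) : ℕ → List (List ℕ)
  | 0 => [[]]
  | m + 1 => (words n m).flatMap fun w => ((List.range n).filter (!w.contains ·)).map (· :: w)

lemma mem_words {n m : ℕ} {w : List ℕ} (h : w.length = m) (hw : w.Nodup) (hn : ∀ x ∈ w, x < n) :
    w ∈ words n m := by
  induction m generalizing w with
  | zero => simp [words, List.length_eq_zero_iff.mp h]
  | succ m ih =>
    obtain ⟨x, w, rfl⟩ := List.exists_cons_of_length_eq_add_one h
    simp only [List.length_cons, Nat.add_right_cancel_iff, List.nodup_cons, List.mem_cons,
      forall_eq_or_imp] at h hw hn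
    simp only [words, List.mem_flatMap]
    exact ⟨w, ih h hw.2 hn.2, by simp [hn.1, hw.1]⟩

/-- The relabelling of the rows `rs` by the positions in `o` has the same entries as `ts`. -/
def fits (ts rs : List (List ℕ)) (o : List ℕ) : Bool :=
  (rs.all fun r => ts.contains (r.map o.idxOf)) &&
    ts.all fun r => (rs.map fun r => r.map o.idxOf).contains r

/-- Some relabelling of `rs` that normalises one of the rows is certified. -/
def cover (n : ℕ) (certs : List Cert) (rs : List (List ℕ)) : Bool :=
  rs.any fun r => [((List.range n).filter (!r.contains ·)) ++ r,
      ((List.range n).filter (!r.contains ·)).reverse ++ r].any fun o =>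
    certs.any fun C => fits C.1 rs o

/-- Check of a list of certificates for systems of `n - 1` trees. -/
def checkAll (n : ℕ) (certs : List Cert) : Bool :=
  certs.all fun C => C.2.length == n - 1 &&
    check n (0 :: C.1.headD []) (C.1.map (0 :: ·)) C.2

/-- Systems of trees connecting four rows of values for `n = 4`. -/
def certsFour : List Cert := [
  ([[2, 3], [0, 1], [0, 2], [0, 3]], [[(0, 0), (1, 3), (0, 0), (2, 3), (0, 1), (0, 0)], [(0, 1),
    (0, 0), (1, 3), (0, 0), (0, 2), (0, 1), (0, 0)], [(0, 4), (0, 0), (0, 4), (2, 3), (0, 0), (0,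
    4), (4, 1), (0, 3), (0, 0), (0, 4)]]),
  ([[2, 3], [0, 1], [0, 2], [1, 0]], [[(0, 3), (0, 0), (0, 2), (0, 1), (0, 0)], [(0, 0), (0, 3),
    (0, 1), (3, 1), (0, 3), (0, 0), (0, 2), (0, 1), (0, 0)], [(0, 4), (0, 3), (0, 0), (0, 4), (1,
    2), (0, 1), (0, 4), (1, 0), (0, 4)]]),
  ([[2, 3], [0, 1], [0, 2], [1, 2]], [[(0, 3), (0, 0), (1, 1), (0, 2), (0, 0)], [(0, 1), (0, 3),
    (0, 0), (0, 1), (0, 2), (0, 0), (0, 1)], [(0, 4), (0, 3), (0, 0), (0, 4), (2, 1), (0, 4), (1,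
    2), (0, 0), (0, 4)]]),
  ([[2, 3], [0, 1], [0, 2], [1, 3]], [[(0, 1), (1, 3), (0, 0), (2, 3), (0, 0)], [(0, 0), (0, 1),
    (1, 3), (0, 2), (0, 0), (1, 1), (0, 0)], [(0, 4), (0, 3), (0, 0), (0, 4), (3, 1), (0, 4), (1,
    3), (0, 0), (0, 4)]]),
  ([[2, 3], [0, 1], [0, 2], [2, 0]], [[(0, 3), (0, 0), (0, 2), (0, 1), (0, 0)], [(0, 1), (0, 3),
    (0, 0), (3, 0), (0, 3), (0, 2), (3, 2), (0, 1), (0, 0)], [(0, 4), (0, 3), (0, 0), (0, 4), (1,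
    2), (0, 4), (1, 1), (0, 0), (0, 4)]]),
  ([[2, 3], [0, 1], [0, 2], [2, 1]], [[(0, 3), (0, 0), (0, 1), (0, 2), (0, 0)], [(0, 1), (0, 3),
    (0, 2), (1, 0), (0, 1), (0, 2), (0, 0)], [(0, 4), (0, 3), (0, 0), (0, 4), (2, 1), (0, 2), (0,
    4), (1, 0), (0, 4)]]),
  ([[2, 3], [0, 1], [0, 2], [3, 0]], [[(0, 3), (0, 0), (2, 0), (0, 3), (0, 1), (0, 0)], [(0, 1),
    (0, 3), (0, 0), (0, 2), (0, 1), (0, 0), (0, 2), (0, 3)], [(0, 4), (0, 0), (0, 3), (0, 4), (1,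
    2), (0, 0), (0, 4), (2, 1), (0, 0), (0, 4)]]),
  ([[2, 3], [0, 1], [0, 2], [3, 1]], [[(0, 3), (0, 0), (2, 1), (0, 3), (0, 0)], [(0, 4), (0, 3),
    (0, 0), (0, 4), (3, 1), (0, 3), (0, 4), (1, 0), (0, 4)], [(0, 0), (0, 3), (0, 2), (0, 0), (2,
    1), (0, 0), (0, 2), (0, 3)]]),
  ([[2, 3], [0, 1], [0, 2], [3, 2]], [[(0, 3), (0, 0), (0, 2), (0, 1), (0, 0)], [(0, 1), (0, 3),
    (0, 0), (1, 2), (0, 1), (0, 0), (1, 3)], [(0, 4), (0, 3), (0, 4), (1, 0), (0, 4), (4, 1), (0,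
    3), (0, 0), (0, 4)]]),
  ([[2, 3], [0, 1], [0, 3], [1, 0]], [[(0, 0), (0, 3), (0, 1), (0, 0)], [(0, 1), (0, 0), (1, 3),
    (0, 0), (4, 3), (0, 0), (0, 2), (0, 1)], [(0, 4), (0, 0), (0, 4), (1, 3), (0, 1), (0, 4), (1,
    0), (0, 4)]]),
  ([[2, 3], [0, 1], [0, 3], [1, 3]], [[(0, 1), (1, 0), (1, 3), (0, 0)], [(0, 3), (0, 1), (0, 2),
    (0, 0), (0, 1), (0, 3), (0, 0), (0, 1)], [(0, 4), (0, 1), (0, 4), (2, 0), (0, 4), (3, 3), (0,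
    0), (0, 4)]]),
  ([[2, 3], [0, 1], [0, 3], [2, 1]], [[(0, 0), (1, 3), (0, 1), (0, 2), (0, 0)], [(0, 1), (0, 0),
    (1, 3), (0, 0), (1, 2)], [(0, 4), (0, 0), (0, 4), (1, 3), (0, 1), (0, 0), (0, 4), (1, 2), (0,
    4)]]),
  ([[2, 3], [0, 1], [0, 3], [3, 0]], [[(0, 0), (0, 3), (0, 1), (0, 0)], [(0, 1), (0, 0), (1, 3),
    (0, 0), (4, 3), (0, 0), (0, 2), (0, 3)], [(0, 4), (0, 0), (0, 4), (1, 3), (0, 4), (1, 1), (0,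
    0), (0, 4)]]),
  ([[2, 3], [0, 1], [0, 3], [3, 1]], [[(0, 0), (0, 3), (0, 1), (0, 0), (0, 3)], [(0, 1), (0, 0),
    (1, 3), (0, 2), (0, 0)], [(0, 4), (0, 0), (0, 4), (1, 1), (0, 3), (0, 4), (1, 0), (0, 4)]]),
  ([[2, 3], [0, 1], [1, 0], [3, 0]], [[(0, 0), (0, 3), (0, 1), (0, 0)], [(0, 1), (0, 3), (0, 0),
    (0, 4), (0, 1), (0, 4), (1, 3), (0, 4)], [(0, 3), (0, 0), (0, 2), (0, 1), (1, 3), (3, 1), (0,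
    2), (0, 0)]]),
  ([[2, 3], [0, 1], [1, 0], [3, 2]], [[(0, 3), (1, 0), (0, 3), (0, 1), (0, 0)], [(0, 4), (0, 3),
    (0, 4), (1, 1), (0, 2), (0, 0), (0, 4), (1, 1), (0, 4)], [(0, 1), (0, 3), (0, 0), (0, 2), (0,
    1), (0, 3), (1, 0), (0, 2), (0, 1)]]),
  ([[2, 3], [0, 1], [1, 2], [1, 3]], [[(0, 1), (0, 3), (0, 0), (3, 3), (0, 1)], [(0, 0), (0, 1),
    (1, 3), (0, 1), (0, 0), (0, 2), (0, 1)], [(0, 4), (0, 1), (0, 4), (1, 3), (0, 0), (0, 4), (5,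
    3), (0, 1), (0, 4)]]),
  ([[2, 3], [0, 1], [1, 2], [3, 0]], [[(0, 3), (0, 1), (0, 2), (0, 0), (0, 1), (0, 3)], [(0, 0),
    (0, 3), (1, 1), (0, 3), (0, 0), (3, 2), (0, 0), (0, 1)], [(0, 4), (0, 3), (0, 1), (0, 4), (1,
    2), (0, 0), (0, 4), (1, 1), (0, 3), (0, 4)]]),
  ([[2, 3], [0, 1], [1, 2], [3, 1]], [[(0, 3), (0, 1), (2, 1), (0, 3), (0, 0)], [(0, 0), (0, 3),
    (0, 1), (0, 0), (0, 2), (0, 1), (1, 3)], [(0, 4), (0, 3), (0, 1), (0, 4), (1, 2), (0, 3), (0,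
    4), (1, 0), (0, 4)]]),
  ([[2, 3], [0, 1], [1, 3], [3, 1]], [[(0, 1), (0, 3), (0, 0)], [(0, 0), (0, 1), (1, 3), (0, 1),
    (0, 0), (0, 2), (0, 3)], [(0, 4), (0, 1), (0, 4), (1, 3), (0, 4), (1, 0), (0, 4)]]),
  ([[2, 3], [0, 2], [0, 3], [2, 0]], [[(0, 0), (1, 3), (0, 0), (0, 2)], [(0, 1), (0, 0), (0, 3),
    (0, 2), (3, 3), (0, 2), (0, 1), (0, 0)], [(0, 4), (0, 0), (0, 4), (2, 3), (0, 0), (0, 4), (1,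
    2), (0, 4)]]),
  ([[2, 3], [0, 2], [0, 3], [3, 0]], [[(0, 0), (0, 3), (2, 3), (0, 0)], [(0, 1), (0, 0), (1, 3),
    (0, 2), (0, 1), (0, 0), (0, 2), (0, 3)], [(0, 4), (0, 0), (0, 4), (2, 3), (0, 0), (0, 4), (4,
    3), (0, 4)]]),
  ([[2, 3], [0, 2], [0, 3], [3, 2]], [[(0, 3), (1, 0), (1, 0)], [(0, 1), (0, 0), (1, 3), (0, 2),
    (0, 1), (0, 3), (1, 0)], [(0, 4), (0, 3), (0, 4), (1, 0), (0, 4), (4, 0), (0, 4)]]),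
  ([[2, 3], [0, 2], [1, 2], [2, 0]], [[(0, 3), (0, 1), (1, 0), (0, 2)], [(0, 0), (0, 3), (0, 2),
    (3, 1), (0, 3), (0, 2), (0, 1), (0, 0)], [(0, 4), (0, 3), (0, 0), (0, 4), (1, 1), (0, 4), (3,
    2), (0, 4)]]),
  ([[2, 3], [0, 2], [1, 2], [3, 2]], [[(0, 3), (0, 0), (0, 1)], [(0, 0), (0, 3), (0, 2), (0, 0),
    (1, 1), (0, 0), (0, 2), (0, 1), (0, 3)], [(0, 4), (0, 3), (0, 4), (1, 0), (0, 4), (1, 1), (0,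
    4)]]),
  ([[2, 3], [0, 2], [2, 0], [2, 1]], [[(0, 1), (0, 3), (0, 2), (3, 3), (0, 0), (0, 2)], [(0, 0),
    (0, 3), (0, 2), (1, 1), (0, 0), (0, 2), (0, 1), (0, 0)], [(0, 4), (0, 3), (0, 1), (0, 2), (0,
    4), (2, 0), (0, 4), (1, 2), (0, 4)]]),
  ([[2, 3], [0, 2], [2, 0], [3, 2]], [[(0, 3), (0, 0), (0, 2)], [(0, 4), (0, 3), (0, 4), (1, 0),
    (0, 4), (1, 2), (0, 4)], [(0, 0), (0, 3), (0, 2), (3, 1), (0, 3), (0, 2), (0, 1), (0, 3), (1,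
    0)]])]

/-- Systems of trees connecting four rows of values for `n = 5`. -/
def certsFive : List Cert := [
  ([[2, 3, 4], [0, 1, 2], [1, 2, 0], [2, 0, 1]], [[(0, 3), (0, 0), (0, 4), (0, 1), (0, 2), (0, 0),
    (0, 1), (0, 2)], [(0, 4), (0, 1), (0, 3), (0, 0), (2, 2), (0, 3), (0, 0), (0, 2), (1, 1)],
    [(0, 1), (0, 4), (0, 0), (0, 3), (0, 2), (2, 1), (0, 2), (0, 3), (0, 1), (8, 3), (0, 2), (0,
    4), (0, 0)], [(0, 0), (0, 3), (0, 1), (0, 4), (0, 2), (0, 5), (0, 1), (0, 0), (0, 5), (1, 2),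
    (0, 1), (0, 5)]]),
  ([[2, 3, 4], [0, 1, 2], [3, 4, 2], [4, 2, 3]], [[(0, 3), (0, 4), (0, 2), (0, 3), (0, 1), (0, 4),
    (0, 0)], [(0, 4), (0, 3), (1, 1), (0, 3), (0, 0), (1, 2), (0, 1), (0, 4)], [(0, 5), (0, 4),
    (0, 3), (0, 5), (3, 3), (0, 4), (0, 5), (4, 1), (0, 4), (0, 0), (0, 5)], [(0, 0), (0, 3), (0,
    2), (0, 4), (0, 1), (0, 0), (2, 0), (0, 3), (6, 4), (0, 2), (0, 0), (0, 4)]]),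
  ([[2, 3, 4], [0, 1, 3], [0, 2, 3], [2, 3, 0]], [[(0, 0), (0, 4), (0, 2), (0, 3), (0, 0), (0, 1),
    (0, 2), (0, 0)], [(0, 4), (0, 0), (0, 2), (1, 3), (0, 2), (0, 0), (1, 1), (0, 0)], [(0, 3),
    (0, 4), (0, 0), (3, 1), (0, 3), (0, 4), (0, 0), (0, 3), (0, 1), (0, 2)], [(0, 5), (0, 4), (0,
    0), (0, 2), (0, 5), (1, 3), (0, 0), (0, 5), (4, 1), (0, 3), (0, 0), (0, 5)]]),
  ([[2, 3, 4], [0, 2, 3], [0, 3, 2], [2, 0, 3]], [[(0, 4), (0, 0), (0, 3), (0, 2), (0, 0)], [(0,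
    0), (0, 4), (0, 2), (0, 0), (1, 3), (0, 0), (5, 3), (0, 4), (0, 2)], [(0, 5), (0, 4), (0, 0),
    (0, 5), (1, 3), (0, 2), (0, 5), (1, 0), (0, 5)], [(0, 3), (0, 4), (0, 0), (1, 1), (0, 2), (0,
    3), (0, 1), (0, 0), (3, 0), (0, 1), (0, 2)]]),
  ([[2, 3, 4], [0, 2, 3], [0, 3, 2], [2, 1, 3]], [[(0, 4), (0, 0), (0, 1), (0, 3), (0, 2), (0, 1),
    (0, 0)], [(0, 3), (0, 4), (0, 0), (0, 2), (0, 3), (0, 0), (2, 1), (0, 0), (0, 2)], [(0, 5),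
    (0, 4), (0, 0), (0, 5), (3, 3), (0, 4), (0, 0), (0, 5), (1, 1), (0, 2), (0, 5)], [(0, 1), (0,
    3), (0, 4), (0, 2), (3, 0), (0, 4), (0, 2), (0, 0), (1, 3), (0, 0)]]),
  ([[2, 3, 4], [0, 2, 3], [0, 3, 2], [2, 4, 3]], [[(0, 4), (0, 0), (1, 3), (0, 2), (0, 4), (0,
    0)], [(0, 0), (0, 4), (0, 2), (0, 0), (1, 3), (0, 0), (4, 3), (0, 0), (0, 2)], [(0, 5), (0,
    4), (0, 0), (0, 5), (2, 3), (0, 2), (0, 5), (1, 4), (0, 0), (0, 5)], [(0, 1), (0, 3), (0, 4),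
    (0, 1), (0, 2), (2, 2), (0, 1), (0, 0), (2, 3), (0, 1), (0, 0)]]),
  ([[2, 3, 4], [0, 2, 3], [0, 3, 2], [3, 0, 2]], [[(0, 3), (0, 4), (0, 0), (3, 4), (0, 0), (0,
    3)], [(0, 5), (0, 4), (0, 0), (0, 5), (1, 3), (0, 5), (0, 2), (0, 0)], [(0, 0), (0, 4), (0,
    2), (0, 0), (1, 3), (0, 0), (5, 3), (0, 2), (0, 4), (0, 3)], [(0, 1), (0, 4), (0, 2), (0, 1),
    (0, 0), (2, 3), (0, 1), (0, 0), (4, 3), (0, 0), (0, 1), (0, 3)]]),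
  ([[2, 3, 4], [0, 2, 3], [0, 3, 2], [3, 1, 2]], [[(0, 4), (0, 0), (1, 1), (0, 3), (0, 2), (0, 1),
    (0, 0)], [(0, 3), (0, 4), (0, 0), (2, 1), (0, 2), (0, 4), (0, 3), (4, 3), (0, 2), (0, 0)],
    [(0, 5), (0, 4), (0, 1), (0, 3), (0, 5), (2, 0), (0, 5), (3, 2), (0, 1), (0, 0), (0, 5)], [(0,
    0), (0, 3), (0, 4), (0, 2), (0, 0), (1, 3), (0, 0), (1, 1), (0, 0), (0, 3)]]),
  ([[2, 3, 4], [0, 2, 3], [0, 3, 2], [3, 4, 2]], [[(0, 4), (0, 3), (1, 0), (0, 2), (0, 3), (0,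
    0)], [(0, 3), (0, 4), (0, 0), (1, 2), (0, 3), (2, 2), (0, 3), (0, 0)], [(0, 1), (0, 4), (0,
    2), (0, 1), (0, 0), (2, 3), (0, 1), (0, 0), (2, 4), (0, 2), (0, 1), (0, 3)], [(0, 5), (0, 4),
    (0, 0), (0, 5), (2, 3), (0, 5), (5, 3), (0, 4), (0, 0), (0, 5)]]),
  ([[2, 3, 4], [0, 2, 3], [0, 4, 3], [2, 3, 0]], [[(0, 3), (0, 4), (0, 0), (0, 3), (0, 2), (3, 2),
    (0, 0)], [(0, 4), (0, 0), (0, 2), (1, 3), (0, 2), (0, 0), (1, 4), (0, 0)], [(0, 0), (0, 4),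
    (0, 2), (1, 3), (0, 0), (2, 5), (0, 3), (0, 0), (0, 5)], [(0, 1), (0, 4), (0, 0), (0, 1), (0,
    2), (3, 3), (0, 1), (0, 0), (6, 2), (0, 3), (0, 1), (0, 0)]]),
  ([[2, 3, 4], [0, 2, 3], [2, 0, 3], [2, 3, 0]], [[(0, 4), (0, 0), (0, 2), (1, 3), (0, 2), (0,
    0)], [(0, 0), (0, 4), (0, 2), (0, 3), (0, 0), (4, 3), (0, 4), (0, 2)], [(0, 3), (0, 4), (0,
    0), (0, 5), (0, 2), (0, 5), (2, 3), (0, 2), (0, 5)], [(0, 1), (0, 4), (0, 0), (0, 1), (0, 2),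
    (2, 3), (0, 1), (0, 2), (1, 0), (0, 2), (0, 1), (0, 0)]]),
  ([[2, 3, 4], [0, 2, 3], [2, 3, 0], [3, 0, 2]], [[(0, 4), (0, 0), (0, 2), (1, 3), (1, 3), (0,
    0)], [(0, 0), (0, 4), (0, 2), (3, 3), (0, 4), (0, 0), (0, 2), (0, 3)], [(0, 1), (0, 4), (0,
    0), (0, 1), (0, 2), (2, 3), (0, 2), (0, 1), (0, 3), (7, 2), (0, 3), (0, 1), (0, 0)], [(0, 5),
    (0, 4), (0, 0), (0, 2), (0, 5), (2, 3), (0, 5), (1, 2), (0, 0), (0, 5)]]),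
  ([[2, 3, 4], [0, 2, 3], [3, 4, 2], [4, 2, 3]], [[(0, 4), (0, 3), (2, 3), (0, 4), (0, 0)], [(0,
    5), (0, 4), (0, 3), (0, 5), (3, 3), (0, 4), (0, 5), (1, 0), (0, 5)], [(0, 0), (0, 3), (0, 4),
    (0, 2), (0, 0), (2, 0), (0, 2), (0, 3), (1, 4)], [(0, 1), (0, 4), (0, 2), (0, 3), (0, 1), (0,
    0), (1, 4), (3, 4), (0, 2), (0, 1), (0, 3)]]),
  ([[2, 3, 4], [0, 2, 4], [2, 4, 0], [4, 0, 2]], [[(0, 3), (0, 0), (0, 4), (0, 2), (0, 0), (0,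
    4)], [(0, 0), (0, 3), (0, 2), (0, 0), (1, 4), (4, 4), (0, 3), (0, 2)], [(0, 5), (0, 3), (0,
    0), (0, 5), (1, 4), (0, 2), (0, 5), (1, 0), (0, 4), (0, 5)], [(0, 4), (0, 0), (0, 3), (0, 4),
    (4, 1), (0, 3), (0, 2), (0, 1), (0, 0), (2, 0), (0, 4), (0, 1), (0, 2)]]),
  ([[2, 3, 4], [0, 2, 4], [3, 4, 2], [4, 2, 3]], [[(0, 3), (0, 4), (1, 0), (3, 4), (0, 3)], [(0,
    0), (0, 3), (0, 2), (0, 0), (1, 4), (0, 0), (0, 3), (0, 2), (0, 4)], [(0, 5), (0, 3), (0, 4),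
    (0, 5), (2, 0), (0, 5), (5, 4), (0, 3), (0, 5)], [(0, 1), (0, 3), (0, 4), (0, 2), (0, 1), (0,
    4), (4, 2), (0, 1), (0, 0), (2, 4), (0, 1), (0, 3)]]),
  ([[2, 3, 4], [0, 3, 4], [0, 4, 3], [2, 4, 3]], [[(0, 0), (0, 4), (0, 3), (0, 0), (0, 2)], [(0,
    1), (0, 0), (2, 4), (0, 3), (0, 2), (0, 1), (0, 0)], [(0, 3), (0, 4), (0, 2), (1, 0), (0, 2),
    (0, 4), (0, 0), (1, 3), (0, 0)], [(0, 5), (0, 0), (0, 5), (1, 4), (0, 3), (0, 0), (0, 5), (1,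
    2), (0, 5)]]),
  ([[2, 3, 4], [2, 4, 3], [3, 2, 4], [3, 4, 2]], [[(0, 3), (1, 4), (0, 3), (0, 2)], [(0, 5), (0,
    3), (0, 5), (1, 4), (0, 2), (0, 5), (1, 3), (0, 5)], [(0, 0), (0, 4), (0, 3), (0, 0), (0, 2),
    (2, 2), (0, 0), (0, 3), (3, 4), (0, 3)], [(0, 1), (0, 3), (0, 4), (0, 1), (0, 2), (3, 2), (0,
    1), (0, 3), (2, 4), (0, 1), (0, 3)]]),
  ([[2, 3, 4], [2, 4, 3], [3, 2, 4], [4, 2, 3]], [[(0, 3), (0, 4), (0, 2)], [(0, 5), (0, 3), (0,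
    5), (1, 4), (0, 5), (1, 2), (0, 5)], [(0, 4), (0, 3), (0, 2), (1, 0), (0, 2), (0, 4), (0, 0),
    (0, 3), (2, 3), (0, 0), (0, 4)], [(0, 1), (0, 3), (0, 2), (0, 1), (0, 3), (3, 4), (0, 1), (0,
    2), (2, 2), (0, 1), (0, 4)]]),
  ([[2, 3, 4], [2, 4, 3], [3, 2, 4], [4, 3, 2]], [[(0, 4), (1, 3), (1, 3), (0, 2)], [(0, 5), (0,
    4), (0, 5), (1, 3), (0, 2), (0, 5), (5, 3), (0, 5)], [(0, 0), (0, 4), (0, 3), (0, 0), (0, 2),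
    (3, 2), (0, 0), (0, 4), (3, 4), (0, 3)], [(0, 1), (0, 4), (0, 3), (0, 1), (0, 2), (3, 2), (0,
    1), (0, 4), (2, 3), (0, 4), (0, 1), (0, 3)]])]

/-- Conflict of two rows of length three at the second entry. -/
def conf : List ℕ → List ℕ → Bool
  | [vt, vk, vl], [ut, uk, ul] => bif vk == uk then
      !(vt == ut) && (bif vl == ut then ul == vt else vl == ul)
    else bif vl == uk then (bif ul == vk then vt == ut else ul == vt)
    else bif ul == vk then vl == ut else vl == ul
  | _, _ => false

/-- The second entries of two rows of length three differ. -/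
def apart : List ℕ → List ℕ → Bool
  | [_, vk, _], [_, uk, _] => !(vk == uk)
  | _, _ => false

/-- Exchange of the second and third entry. -/
def flip : List ℕ → List ℕ
  | [t, k, l] => [t, l, k]
  | _ => []

/-- Three rows with different second entries in pairwise conflict. -/
def tri (x y z : List ℕ) : Bool :=
  conf x y && conf y z && conf x z && apart x y && apart y z && apart x z

/-- A cycle of four conflicts with different second entries at opposite rows. -/
def cyc (x y z w : List ℕ) : Bool :=
  conf x y && conf y z && conf z w && conf w x && apart x z && apart y w

/-- The bad patterns for four rows. -/
def bad (a b c d : List ℕ) : Bool :=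
  tri a b c || (tri a b d || (tri a c d || (tri b c d || (cyc a b c d || (cyc a b d c ||
    cyc a c b d)))))

/-- Four rows of length three which are not bad at the third entry or are certified. -/
def settled (certs : List Cert) (a b c d : List ℕ) : Bool :=
  !bad (flip a) (flip b) (flip c) (flip d) || cover 5 certs [a, b, c, d] ||
    cover 5 certs [flip a, flip b, flip c, flip d]

/-- All rows forming a triangle of conflicts with `a` are settled. -/
def settledTri (certs : List Cert) (a : List ℕ) : Bool :=
  (words 5 3).all fun b => !(conf a b && apart a b) || (words 5 3).all fun c =>
    !tri a b c || (words 5 3).all fun d => (d == a || d == b || d == c) || settled certs a b c d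

/-- All rows forming a cycle of conflicts with `a` are settled. -/
def settledCyc (certs : List Cert) (a : List ℕ) : Bool :=
  (words 5 3).all fun b => !conf a b || (words 5 3).all fun c =>
    !(conf b c && apart a c) || (words 5 3).all fun d => !cyc a b c d || settled certs a b c d

/-- All sets of four rows of length two containing `a` are certified. -/
def settledFour (certs : List Cert) (a : List ℕ) : Bool :=
  (words 4 2).all fun b => b == a || (words 4 2).all fun c => (c == a || c == b) ||
    (words 4 2).all fun d => (d == a || d == b || d == c) || cover 4 certs [a, b, c, d]

lemma checkAll_four : checkAll 4 certsFour = true := by decide +kernel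

lemma checkAll_five : checkAll 5 certsFive = true := by decide +kernel

lemma settledFour_four : settledFour certsFour [2, 3] = true := by decide +kernel

lemma settledTri_five : settledTri certsFive [2, 3, 4] = true := by decide +kernel

lemma settledCyc_five : settledCyc certsFive [2, 3, 4] = true := by decide +kernel

end Code

namespace Code

lemma perm_range {n : ℕ} {r : List ℕ} (hr : r.Nodup) (hn : ∀ x ∈ r, x < n) :
    ((List.range n).filter (!r.contains ·) ++ r).Perm (List.range n) := by
  rw [List.perm_ext_iff_of_nodup _ List.nodup_range]
  · intro x
    by_cases h : x ∈ r <;> simp [h, hn]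
  · rw [List.nodup_append']
    refine ⟨List.nodup_range.filter _, hr, fun x h1 h2 => ?_⟩
    simp [h2] at h1

/-- The Boolean form of a conflict of two rows. -/
lemma conf_of_trace {α : Type*} {g : α → ℕ} (hg : Function.Injective g) {t k l : Four → α}
    {v u : Four} (h : Trace t k l l v u) :
    conf [g (t v), g (k v), g (l v)] [g (t u), g (k u), g (l u)] = true := by
  unfold Trace Cross Inner at h
  simp only [conf, Bool.cond_eq_ite, beq_iff_eq, hg.eq_iff]
  split_ifs <;> simp [hg.eq_iff] <;> grind

variable {α : Type*} {g : α → ℕ} {t k l : Four → α}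

lemma tri_of_trace (hg : Function.Injective g) {x y z : Four} (h : TraceTri t k l l x y z) :
    tri [g (t x), g (k x), g (l x)] [g (t y), g (k y), g (l y)]
      [g (t z), g (k z), g (l z)] = true := by
  obtain ⟨h1, h2, h3, h4, h5, h6⟩ := h
  simp [tri, apart, conf_of_trace hg h1, conf_of_trace hg h2, conf_of_trace hg h3, hg.eq_iff,
    h4, h5, h6]

lemma cyc_of_trace (hg : Function.Injective g) {x y z w : Four}
    (h : TraceCyc t k l l x y z w) :
    cyc [g (t x), g (k x), g (l x)] [g (t y), g (k y), g (l y)] [g (t z), g (k z), g (l z)]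
      [g (t w), g (k w), g (l w)] = true := by
  obtain ⟨h1, h2, h3, h4, h5, h6⟩ := h
  simp [cyc, apart, conf_of_trace hg h1, conf_of_trace hg h2, conf_of_trace hg h3,
    conf_of_trace hg h4, hg.eq_iff, h5, h6]

lemma bad_of_trace (hg : Function.Injective g) (h : TraceBad t k l l) :
    bad [g (t .a), g (k .a), g (l .a)] [g (t .b), g (k .b), g (l .b)]
      [g (t .c), g (k .c), g (l .c)] [g (t .d), g (k .d), g (l .d)] = true := by
  rcases h with h | h | h | h | h | h | h <;>
  first
  | simp only [bad, tri_of_trace hg h, Bool.or_true, Bool.true_or]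
  | simp only [bad, cyc_of_trace hg h, Bool.or_true, Bool.true_or]

end Code

namespace Frame

open Code

variable {n : ℕ} {f : Frame (Fin n)} {h : Perm (Fin n)} {l : List (Fin n)}

/-- The relabelled values of `v` at the pivot and at the positions `l`. -/
def row (f : Frame (Fin n)) (h : Perm (Fin n)) (l : List (Fin n)) (v : Perm (Fin n)) : List ℕ :=
  (f.t :: l).map fun j => (h (v j)).val

lemma row_lt {v : Perm (Fin n)} {x : ℕ} (hx : x ∈ f.row h l v) : x < n := by
  simp only [row, List.mem_map] at hx
  obtain ⟨j, -, rfl⟩ := hx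
  exact (h (v j)).2

lemma row_nodup (hl : ∀ j, f.High j ↔ j ∈ l) (hnd : l.Nodup) (v : Perm (Fin n)) :
    (f.row h l v).Nodup := by
  refine List.Nodup.map (fun a b hab => v.injective (h.injective (Fin.ext hab))) ?_
  exact List.nodup_cons.mpr ⟨fun ht => ((hl _).mpr ht).2.2 rfl, hnd⟩

lemma row_mem_words {m : ℕ} (hl : ∀ j, f.High j ↔ j ∈ l) (hnd : l.Nodup) (hm : l.length + 1 = m)
    (v : Perm (Fin n)) : f.row h l v ∈ words n m :=
  mem_words (by simp [row, hm]) (row_nodup hl hnd v) fun _ hx => row_lt hx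

lemma row_ne (hl : ∀ j, f.High j ↔ j ∈ l) {u v : Perm (Fin n)}
    (hs : Perm.sign u = Perm.sign v) (huv : u ≠ v) : f.row h l u ≠ f.row h l v := by
  intro he
  simp only [row, List.map_cons, List.cons.injEq, List.map_inj_left, Fin.val_inj,
    EmbeddingLike.apply_eq_iff_eq] at he
  exact huv (ext_sign hs he.1 fun j hj => he.2 j ((hl j).mp hj))

/-- Four permutations whose rows are certified admit `n - 1` internally disjoint trees. -/
theorem hasPacking_of_cover (hl : ∀ j, f.High j ↔ j ∈ l) (hnd : l.Nodup) {s : Four → Perm (Fin n)}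
    (hsign : ∀ i, Perm.sign (s i) = Perm.sign (s .a)) {certs : List Cert}
    (hcert : checkAll n certs = true) {rs : List (List ℕ)}
    (hrs : ∀ r, r ∈ rs ↔ ∃ i, f.row h l (s i) = r) (hcov : cover n certs rs = true) :
    HasPacking (Fin (n - 1)) f.graph (Set.range s) := by
  simp only [cover, List.any_eq_true] at hcov
  obtain ⟨r, hr, o, ho, C, hC, hfit⟩ := hcov
  obtain ⟨i, rfl⟩ := (hrs r).mp hr
  have hperm := perm_range (row_nodup (h := h) hl hnd (s i)) fun x hx => row_lt hx
  have hop : o.Perm (List.range n) := by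
    simp only [List.mem_cons, List.not_mem_nil, or_false] at ho
    rcases ho with rfl | rfl
    · exact hperm
    · exact ((List.reverse_perm _).append_right _).trans hperm
  have hmem : ∀ x : Fin n, (h x).val ∈ o := fun x => hop.mem_iff.mpr (List.mem_range.mpr (h x).2)
  have hlen : o.length = n := by rw [hop.length_eq, List.length_range]
  have hlt : ∀ x : Fin n, o.idxOf (h x).val < n := fun x =>
    (List.idxOf_lt_length_iff.mpr (hmem x)).trans_eq hlen
  have hg : Function.Injective fun x : Fin n => o.idxOf (h x).val := fun x y hxy =>
    h.injective (Fin.ext ((List.idxOf_inj (hmem x)).mp hxy))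
  simp only [checkAll, List.all_eq_true, Bool.and_eq_true, beq_iff_eq] at hcert
  obtain ⟨hclen, hcheck⟩ := hcert C hC
  rw [← hclen]
  refine hasPacking_of_check (ε := Perm.sign (s .a)) hg (fun c hc => ?_)
    (fun x hx => (hlt x).ne hx) hl (fun κ => ?_) hcheck
  · have hc' : c < o.length := by rwa [hlen]
    have hb : o[c] < n := List.mem_range.mp (hop.mem_iff.mp (List.getElem_mem hc'))
    refine ⟨h.symm ⟨o[c], hb⟩, ?_⟩
    simp only [apply_symm_apply]
    exact (hop.nodup_iff.mpr List.nodup_range).idxOf_getElem c hc'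
  · have hcode : ∀ i, f.code (fun x => o.idxOf (h x).val) l (Perm.sign (s .a)) (s i) =
        0 :: (f.row h l (s i)).map o.idxOf := fun i => by simp [code, row, hsign]
    simp only [fits, Bool.and_eq_true, List.all_eq_true, List.contains_eq_mem,
      decide_eq_true_eq, List.mem_map] at hfit
    simp only [Set.exists_range_iff, hcode, List.mem_map]
    constructor
    · rintro ⟨w, hw, rfl⟩
      obtain ⟨r, hr, rfl⟩ := hfit.2 w hw
      obtain ⟨j, rfl⟩ := (hrs r).mp hr
      exact ⟨j, rfl⟩
    · rintro ⟨j, rfl⟩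
      exact ⟨_, hfit.1 _ ((hrs _).mpr ⟨j, rfl⟩), rfl⟩

lemma mem_rows (s : Four → Perm (Fin n)) (r : List ℕ) :
    r ∈ [f.row h l (s .a), f.row h l (s .b), f.row h l (s .c), f.row h l (s .d)] ↔
      ∃ i, f.row h l (s i) = r := by
  simp only [List.mem_cons, List.not_mem_nil, or_false]
  constructor
  · rintro (rfl | rfl | rfl | rfl)
    exacts [⟨_, rfl⟩, ⟨_, rfl⟩, ⟨_, rfl⟩, ⟨_, rfl⟩]
  · rintro ⟨_ | _ | _ | _, rfl⟩ <;> simp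

/-- The case of degree four. -/
theorem hasPacking_four {s : Four → Perm (Fin 4)} (hs : Function.Injective s)
    (hsign : ∀ i, Perm.sign (s i) = Perm.sign (s .a)) :
    HasPacking (Fin 3) (stdFrame 4 (by omega)).graph (Set.range s) := by
  set f := stdFrame 4 (by omega) with hf
  have hl : ∀ j, f.High j ↔ j ∈ [(3 : Fin 4)] := by
    unfold Frame.High
    decide
  have hnd : [(3 : Fin 4)].Nodup := by simp
  have hrow : f.row (s .a)⁻¹ [3] (s .a) = [2, 3] := by
    simp [row, hf, stdFrame]
  have hw := fun i => row_mem_words (h := (s .a)⁻¹) hl hnd rfl (s i)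
  have hne : ∀ i j, i ≠ j → f.row (s .a)⁻¹ [3] (s i) ≠ f.row (s .a)⁻¹ [3] (s j) := fun i j hij =>
    row_ne hl ((hsign i).trans (hsign j).symm) (hs.ne hij)
  have key := settledFour_four
  simp only [settledFour, List.all_eq_true, Bool.or_eq_true, beq_iff_eq, ← hrow] at key
  have hc := ((((key _ (hw .b)).resolve_left (hne _ _ (by decide)) _ (hw .c)).resolve_left
    (by simp [hne])) _ (hw .d)).resolve_left (by simp [hne])
  exact hasPacking_of_cover hl hnd hsign checkAll_four (mem_rows s) hc

/-- Four permutations of degree five which are bad at the position `l` and whose rows are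
settled. -/
lemma hasPacking_of_settled {f : Frame (Fin 5)} {h : Perm (Fin 5)} {k l : Fin 5} (hkl : k ≠ l)
    (hl : ∀ j, f.High j ↔ j ∈ [k, l]) {s : Four → Perm (Fin 5)}
    (hsign : ∀ i, Perm.sign (s i) = Perm.sign (s .a)) (hbad : f.Bad l s)
    (hset : settled certsFive (f.row h [k, l] (s .a)) (f.row h [k, l] (s .b))
      (f.row h [k, l] (s .c)) (f.row h [k, l] (s .d)) = true) :
    HasPacking (Fin 4) f.graph (Set.range s) := by
  have hl' : ∀ j, f.High j ↔ j ∈ [l, k] := fun j => by rw [hl]; simp [or_comm]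
  have hflip : ∀ v, Code.flip (f.row h [k, l] v) = f.row h [l, k] v := fun v => rfl
  have hk := (hl k).mpr (by simp)
  have hb := bad_of_trace (g := fun x : Fin 5 => (h x).val)
    (fun x y hxy => h.injective (Fin.ext hxy))
    (hbad.patterns ((hl l).mpr (by simp)) hk hk hkl hkl)
  have hb' : Code.bad (f.row h [l, k] (s .a)) (f.row h [l, k] (s .b)) (f.row h [l, k] (s .c))
    (f.row h [l, k] (s .d)) = true := hb
  simp only [settled, hflip, hb', Bool.not_true, Bool.false_or, Bool.or_eq_true] at hset
  rcases hset with hset | hset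
  · exact hasPacking_of_cover hl (by simp [hkl]) hsign checkAll_five (mem_rows s) hset
  · exact hasPacking_of_cover hl' (by simp [hkl.symm]) hsign checkAll_five (mem_rows s) hset

/-- Four permutations of degree five which are bad at both high positions. -/
theorem hasPacking_of_bad_bad {s : Four → Perm (Fin 5)} (hs : Function.Injective s)
    (hsign : ∀ i, Perm.sign (s i) = Perm.sign (s .a))
    (hbad : ∀ k, (stdFrame 5 (by omega)).High k → (stdFrame 5 (by omega)).Bad k s) :
    HasPacking (Fin 4) (stdFrame 5 (by omega)).graph (Set.range s) := by
  set f := stdFrame 5 (by omega) with hf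
  have hl : ∀ j, f.High j ↔ j ∈ [(3 : Fin 5), 4] := by
    unfold Frame.High
    decide
  have h34 : (3 : Fin 5) ≠ 4 := by decide
  have h3 := (hl 3).mpr (by simp)
  have h4 := (hl 4).mpr (by simp)
  have hw : ∀ (h : Perm (Fin 5)) v, f.row h [3, 4] v ∈ words 5 3 := fun h v =>
    row_mem_words hl (by simp) rfl v
  suffices H : ∃ σ : Perm Four,
      TraceTri (fun i => s (σ i) f.t) (fun i => s (σ i) 3) (fun i => s (σ i) 4)
        (fun i => s (σ i) 4) .a .b .c ∨
      TraceCyc (fun i => s (σ i) f.t) (fun i => s (σ i) 3) (fun i => s (σ i) 4)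
        (fun i => s (σ i) 4) .a .b .c .d by
    obtain ⟨σ, H⟩ := H
    rw [← σ.surjective.range_comp s]
    have hsign' : ∀ i, Perm.sign ((s ∘ σ) i) = Perm.sign ((s ∘ σ) .a) := fun i =>
      (hsign _).trans (hsign _).symm
    refine hasPacking_of_settled (h := (s (σ .a))⁻¹) h34 hl hsign' ((hbad 4 h4).comp σ) ?_
    have hrow : f.row (s (σ .a))⁻¹ [3, 4] (s (σ .a)) = [2, 3, 4] := by
      simp [row, hf, stdFrame]
    have hg : Function.Injective fun x : Fin 5 => ((s (σ .a))⁻¹ x).val := fun x y hxy =>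
      (s (σ .a))⁻¹.injective (Fin.ext hxy)
    have hne : ∀ i j, i ≠ j → f.row (s (σ .a))⁻¹ [3, 4] (s (σ i)) ≠
        f.row (s (σ .a))⁻¹ [3, 4] (s (σ j)) := fun i j hij =>
      row_ne hl ((hsign _).trans (hsign _).symm) (hs.ne (σ.injective.ne hij))
    rcases H with H | H
    · have hT : tri (f.row (s (σ .a))⁻¹ [3, 4] (s (σ .a))) (f.row (s (σ .a))⁻¹ [3, 4] (s (σ .b)))
        (f.row (s (σ .a))⁻¹ [3, 4] (s (σ .c))) = true := tri_of_trace hg H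
      have key := settledTri_five
      simp only [settledTri, List.all_eq_true, Bool.or_eq_true, Bool.not_eq_true', beq_iff_eq,
        ← hrow] at key
      have hab := hT
      simp only [tri, Bool.and_eq_true] at hab
      have h1 := (key _ (hw (s (σ .a))⁻¹ (s (σ .b)))).resolve_left (by simp [hab])
      have h2 := (h1 _ (hw (s (σ .a))⁻¹ (s (σ .c)))).resolve_left (by simp [hT])
      exact (h2 _ (hw (s (σ .a))⁻¹ (s (σ .d)))).resolve_left (by simp [hne])
    · have hT : cyc (f.row (s (σ .a))⁻¹ [3, 4] (s (σ .a))) (f.row (s (σ .a))⁻¹ [3, 4] (s (σ .b)))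
        (f.row (s (σ .a))⁻¹ [3, 4] (s (σ .c))) (f.row (s (σ .a))⁻¹ [3, 4] (s (σ .d))) = true :=
        cyc_of_trace hg H
      have key := settledCyc_five
      simp only [settledCyc, List.all_eq_true, Bool.or_eq_true, Bool.not_eq_true', ← hrow] at key
      have hab := hT
      simp only [cyc, Bool.and_eq_true] at hab
      have h1 := (key _ (hw (s (σ .a))⁻¹ (s (σ .b)))).resolve_left (by simp [hab])
      have h2 := (h1 _ (hw (s (σ .a))⁻¹ (s (σ .c)))).resolve_left (by simp [hab])
      exact (h2 _ (hw (s (σ .a))⁻¹ (s (σ .d)))).resolve_left (by simp [hT])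
  rcases (hbad 3 h3).patterns h3 h4 h4 h34.symm h34.symm with h | h | h | h | h | h | h
  exacts [⟨1, .inl h⟩, ⟨swap .c .d, .inl h⟩, ⟨swap .b .c * swap .c .d, .inl h⟩,
    ⟨swap .a .b * swap .b .c * swap .c .d, .inl h⟩, ⟨1, .inr h⟩, ⟨swap .c .d, .inr h⟩,
    ⟨swap .b .c, .inr h⟩]

end Frame

lemma high_stdFrame {n : ℕ} {hn : 3 ≤ n} {i : Fin n} : (stdFrame n hn).High i ↔ 3 ≤ i.val := by
  simp only [Frame.High, stdFrame, ne_eq, Fin.ext_iff]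
  omega

/-- Four permutations of the same sign admit `n - 1` internally disjoint trees. -/
theorem hasPacking_stdFrame {n : ℕ} (hn : 4 ≤ n) (hn₃ : 3 ≤ n) {s : Four → Perm (Fin n)}
    (hs : Function.Injective s) (hsign : ∀ i, Perm.sign (s i) = Perm.sign (s .a)) :
    HasPacking (Fin (n - 1)) (stdFrame n hn₃).graph (Set.range s) := by
  induction n, hn using Nat.le_induction with
  | base => exact Frame.hasPacking_four hs hsign
  | succ n hn ih =>
    set f := stdFrame (n + 1) hn₃ with hf
    by_cases hconst : ∃ k, f.High k ∧ ∀ i, s i k = s .a k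
    · obtain ⟨k, hk, hc⟩ := hconst
      have hk3 : 3 ≤ k.val := high_stdFrame.mp hk
      have hval : ∀ j : Fin n, j.val < 3 → ((finSuccAboveEquiv k j : Fin (n + 1)) : ℕ) = j := by
        intro j hj
        have hlt : j.castSucc < k := by
          rw [Fin.lt_def, Fin.val_castSucc]
          omega
        exact congrArg Fin.val (Fin.succAbove_of_castSucc_lt k j hlt)
      have hpack := Frame.hasPacking_of_constant (g := stdFrame n (by omega))
        (finSuccAboveEquiv k) hk (Fin.ext (hval _ (by simp [stdFrame])))
        (Fin.ext (hval _ (by simp [stdFrame]))) (Fin.ext (hval _ (by simp [stdFrame])))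
        hs hsign hc fun s' hs' hsign' => ih (by omega) hs' hsign'
      exact hpack.congr (Fintype.equivOfCardEq (by simp; omega))
    push Not at hconst
    have h3 : f.High ⟨3, by omega⟩ := high_stdFrame.mpr le_rfl
    have h4 : f.High ⟨4, by omega⟩ := high_stdFrame.mpr (by simp)
    by_cases hbad : ∃ k, f.High k ∧ ¬ f.Bad k s
    · obtain ⟨k, hk, hb⟩ := hbad
      obtain ⟨i, hi⟩ := hconst k hk
      obtain ⟨j, hj, hjk⟩ : ∃ j, f.High j ∧ j ≠ k := by
        by_cases h : k = ⟨3, by omega⟩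
        · exact ⟨_, h4, by simp [h]⟩
        · exact ⟨_, h3, Ne.symm h⟩
      obtain ⟨a, ha⟩ := Frame.hasPacking_of_not_bad hk hj hjk hsign ⟨i, .a, hi⟩ hb
      exact ha.congr (Fintype.equivOfCardEq (by simp [Fintype.card_subtype_compl]))
    push Not at hbad
    rcases hn.eq_or_lt with rfl | hn5
    · exact Frame.hasPacking_of_bad_bad hs hsign hbad
    · have h5 : f.High ⟨5, by omega⟩ := high_stdFrame.mpr (by simp)
      exact (Frame.not_bad_three h3 h4 h5 (by simp) (by simp) (by simp) (hbad _ h3) (hbad _ h4)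
        (hbad _ h5)).elim

/-- Let n ≥ 4 and let S = {x, y, z, w} be four distinct vertices of EA_n all of
the same parity. Then there exist n − 1 pairwise internally edge disjoint
S-trees in EA_n. -/
theorem IDSTs_same_parity (n : ℕ) (hn : 4 ≤ n) (x y z w : Equiv.Perm (Fin n))
    (hxy : x ≠ y) (hxz : x ≠ z) (hxw : x ≠ w) (hyz : y ≠ z) (hyw : y ≠ w)
    (hzw : z ≠ w)
    (hsy : Equiv.Perm.sign y = Equiv.Perm.sign x)
    (hsz : Equiv.Perm.sign z = Equiv.Perm.sign x)
    (hsw : Equiv.Perm.sign w = Equiv.Perm.sign x) :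
    ∃ T : Fin (n - 1) → (godanGraph n (by omega)).Subgraph,
      IsIDSTFamily (godanGraph n (by omega))
        ({x, y, z, w} : Set (Equiv.Perm (Fin n))) T := by
  set s : Four → Equiv.Perm (Fin n) := fun i => match i with
    | .a => x
    | .b => y
    | .c => z
    | .d => w with hs
  have hinj : Function.Injective s := by
    rintro (_ | _ | _ | _) (_ | _ | _ | _) h <;> first | rfl | (simp only [hs] at h; grind)
  have hsign : ∀ i, Equiv.Perm.sign (s i) = Equiv.Perm.sign (s .a) := by
    rintro (_ | _ | _ | _)
    exacts [rfl, hsy, hsz, hsw]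
  have hrange : Set.range s = {x, y, z, w} := by
    ext v
    simp only [Set.mem_range, Set.mem_insert_iff, Set.mem_singleton_iff]
    constructor
    · rintro ⟨_ | _ | _ | _, rfl⟩ <;> simp [hs]
    · rintro (rfl | rfl | rfl | rfl)
      exacts [⟨.a, rfl⟩, ⟨.b, rfl⟩, ⟨.c, rfl⟩, ⟨.d, rfl⟩]
  obtain ⟨U, F, h, -⟩ := (hasPacking_stdFrame hn (by omega) hinj hsign).map id Function.injective_id
    fun _ _ => stdFrame_graph_le n (by omega)
  rw [Set.image_id, hrange] at h
  exact HasPacking.exists_isIDSTFamily ⟨x, by simp⟩ (Fintype.card_fin _) ⟨U, F, h⟩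

end Godan
end
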